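/- arXiv:math/0304043 — 6 statements merged into one kernel-verified Lean document; each statement's English description precedes it below -/
import Mathlib

section
/- Let ψ₀ ∈ V and let ψ(x) = |x|^{-n} γ(x)(ψ₀) for x ≠ 0. Then, in the sense of distributions on ℝⁿ, Dψ = -ω_{n-1} δ₀ ψ₀; explicitly, for every smooth compactly supported function φ : ℝⁿ → ℝ one has -Σᵢ ∫_{ℝⁿ} ∂ᵢφ(x) · γᵢ(|x|^{-n} γ(x)(ψ₀)) dx = -ω_{n-1} φ(0) ψ₀. -/
open MeasureTheory Metric
open scoped InnerProductSpace

/-- Clifford multiplication `γ(v) = ∑ i, vⁱ γᵢ` applied to a spinor. -/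
noncomputable def cliffordMul {n : ℕ} {V : Type*} [NormedAddCommGroup V]
    [NormedSpace ℂ V] (γ : Fin n → V →ₗ[ℂ] V)
    (v : EuclideanSpace ℝ (Fin n)) (ψ : V) : V :=
  ∑ i, v i • γ i ψ

/-- `ω_{n-1}`, the `(n-1)`-dimensional volume of the unit sphere `S^{n-1} ⊆ ℝⁿ`,
expressed via the classical identity `ω_{n-1} = n · vol(Bⁿ)`. -/
noncomputable def sphereVol (n : ℕ) : ℝ :=
  n * (volume (ball (0 : EuclideanSpace ℝ (Fin n)) 1)).toReal


open Set Filter Topology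

theorem aux_int (n : ℕ) (hn : 3 ≤ n) (φ : EuclideanSpace ℝ (Fin n) → ℝ)
    (hφ : ContDiff ℝ (⊤ : ℕ∞) φ) (hc : HasCompactSupport φ) :
    Integrable (fun x => ‖fderiv ℝ φ x‖ * (‖x‖ * (‖x‖ ^ n)⁻¹)) := by
  have : NeZero n := ⟨by omega⟩
  have : Nontrivial (EuclideanSpace ℝ (Fin n)) :=
    ⟨0, EuclideanSpace.single 0 1, fun h => by
      have := congrArg norm h
      simp at this⟩
  have hcd : Continuous (fderiv ℝ φ) := hφ.continuous_fderiv (by simp)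
  have hcs : HasCompactSupport (fderiv ℝ φ) := hc.fderiv ℝ
  obtain ⟨C, hC⟩ := hcs.exists_bound_of_continuous hcd
  obtain ⟨R, hR⟩ := hcs.isCompact.isBounded.subset_ball 0
  have h1 : IntegrableOn (fun x : EuclideanSpace ℝ (Fin n) => ‖x‖ * (‖x‖ ^ n)⁻¹)
      (ball 0 R) := by
    rw [integrableOn_fun_norm_addHaar (μ := volume) (f := fun r : ℝ => r * (r ^ n)⁻¹)]
    have : IntegrableOn (fun _ : ℝ => (1 : ℝ)) (Ioo 0 R) := by
      simp
    refine this.congr_fun ?_ measurableSet_Ioo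
    intro r hr
    have hr0 : r ≠ 0 := hr.1.ne'
    simp only [finrank_euclideanSpace, Fintype.card_fin, smul_eq_mul]
    obtain ⟨m, rfl⟩ : ∃ m, n = m + 1 := ⟨n - 1, by omega⟩
    simp only [Nat.add_sub_cancel]
    field_simp
    ring
  have h2 : IntegrableOn (fun x => ‖fderiv ℝ φ x‖ * (‖x‖ * (‖x‖ ^ n)⁻¹)) (ball 0 R) := by
    refine Integrable.bdd_mul (c := C) h1 ?_ ?_
    · exact hcd.norm.aestronglyMeasurable
    · filter_upwards with x
      simpa using hC x
  rw [integrableOn_iff_integrable_of_support_subset] at h2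
  · exact h2
  · intro x hx
    apply hR
    apply subset_tsupport
    intro h
    simp [h] at hx

theorem aux_polar (n : ℕ) (hn : 3 ≤ n) (φ : EuclideanSpace ℝ (Fin n) → ℝ)
    (hφ : ContDiff ℝ (⊤ : ℕ∞) φ) (hc : HasCompactSupport φ) :
    ∫ x : EuclideanSpace ℝ (Fin n), fderiv ℝ φ x x * (‖x‖ ^ n)⁻¹ = - (sphereVol n * φ 0) := by
  have : NeZero n := ⟨by omega⟩
  have hcd : Continuous (fderiv ℝ φ) := hφ.continuous_fderiv (by simp)
  have hd : Differentiable ℝ φ := hφ.differentiable (by simp)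
  set μ : Measure (EuclideanSpace ℝ (Fin n)) := volume with hμ
  let F : EuclideanSpace ℝ (Fin n) → ℝ := fun x => fderiv ℝ φ x x * (‖x‖ ^ n)⁻¹
  have hF : Integrable F μ := by
    refine (aux_int n hn φ hφ hc).mono' ?_ ?_
    · apply Measurable.aestronglyMeasurable
      apply Measurable.mul
      · exact (hcd.clm_apply continuous_id).measurable
      · fun_prop
    · filter_upwards with x
      rw [norm_mul, ← mul_assoc]
      gcongr
      · exact ContinuousLinearMap.le_opNorm _ _
      · simp
  let G : sphere (0 : EuclideanSpace ℝ (Fin n)) 1 × Ioi (0:ℝ) → ℝ :=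
    fun p => F (p.2.1 • p.1.1)
  have hGF : ∀ x : ({(0)}ᶜ : Set (EuclideanSpace ℝ (Fin n))),
      G (homeomorphUnitSphereProd _ x) = F x.1 := by
    intro x
    have h := congrArg Subtype.val ((homeomorphUnitSphereProd _).symm_apply_apply x)
    simp only [G]
    congr 1
  have hmp := μ.measurePreserving_homeomorphUnitSphereProd
  have hGint : Integrable G (μ.toSphere.prod (.volumeIoiPow (n - 1))) := by
    have := hmp.integrable_comp_emb (g := G) (Homeomorph.measurableEmbedding _)
    simp only [finrank_euclideanSpace, Fintype.card_fin] at this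
    rw [← this]
    have h3 : G ∘ homeomorphUnitSphereProd (EuclideanSpace ℝ (Fin n)) = F ∘ Subtype.val := by
      ext x; exact hGF x
    rw [h3, ← integrableOn_iff_comap_subtypeVal (measurableSet_singleton _).compl]
    exact hF.integrableOn
  have e1 : ∫ x, F x ∂μ = ∫ p, G p ∂(μ.toSphere.prod (.volumeIoiPow (n - 1))) := by
    have := hmp.integral_comp (Homeomorph.measurableEmbedding _) G
    simp only [finrank_euclideanSpace, Fintype.card_fin] at this
    rw [← this]
    simp only [hGF]
    rw [integral_subtype_comap (measurableSet_singleton _).compl F, restrict_compl_singleton]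
  have e2 : ∀ θ : sphere (0 : EuclideanSpace ℝ (Fin n)) 1,
      ∫ r, G (θ, r) ∂(Measure.volumeIoiPow (n - 1)) = - φ 0 := by
    intro θ
    have hθ : ‖θ.1‖ = 1 := by simp
    simp only [Measure.volumeIoiPow, ENNReal.ofReal]
    rw [integral_withDensity_eq_integral_smul
      ((measurable_subtype_coe.pow_const _).real_toNNReal)]
    rw [integral_subtype_comap measurableSet_Ioi
      fun a : ℝ ↦ Real.toNNReal (a ^ (n - 1)) • F (a • θ.1)]
    have hder : ∀ r : ℝ, HasDerivAt (fun r : ℝ => φ (r • θ.1)) (fderiv ℝ φ (r • θ.1) θ.1) r := by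
      intro r
      have h1 : HasDerivAt (fun r : ℝ => r • θ.1) θ.1 r := by
        simpa using (hasDerivAt_id r).smul_const θ.1
      exact (hd _).hasFDerivAt.comp_hasDerivAt r h1
    have hcont : ContDiff ℝ 1 (fun r : ℝ => φ (r • θ.1)) := by
      have : ContDiff ℝ 1 φ := hφ.of_le (by exact_mod_cast le_top)
      exact this.comp (by fun_prop)
    have hcsr : HasCompactSupport (fun r : ℝ => φ (r • θ.1)) := by
      refine hc.comp_isClosedEmbedding (g := fun r : ℝ => r • θ.1) ?_
      refine Isometry.isClosedEmbedding ?_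
      refine Isometry.of_dist_eq fun a b => ?_
      rw [dist_eq_norm, dist_eq_norm, ← sub_smul, norm_smul, hθ, mul_one]
    have := hcsr.integral_Ioi_deriv_eq hcont 0
    simp only [zero_smul] at this
    rw [← this]
    refine setIntegral_congr_fun measurableSet_Ioi fun r hr => ?_
    have hr0 : (0:ℝ) < r := hr
    simp only [F]
    rw [NNReal.smul_def, Real.coe_toNNReal _ (pow_nonneg hr0.le _), (hder r).deriv, norm_smul, hθ,
      map_smul]
    obtain ⟨m, rfl⟩ : ∃ m, n = m + 1 := ⟨n - 1, by omega⟩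
    simp only [Nat.add_sub_cancel, smul_eq_mul, Real.norm_eq_abs, abs_of_pos hr0]
    field_simp
    ring
  show ∫ x, F x ∂μ = _
  rw [e1, integral_prod _ hGint]
  simp only [e2]
  rw [integral_const, μ.toSphere_real_apply_univ]
  simp [sphereVol, measureReal_def, hμ]

theorem aux_symm (n : ℕ) (hn : 3 ≤ n) (φ : EuclideanSpace ℝ (Fin n) → ℝ)
    (hφ : ContDiff ℝ (⊤ : ℕ∞) φ) (hc : HasCompactSupport φ) (ε : ℝ) (hε : 0 < ε)
    (i j : Fin n) (hij : i ≠ j) :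
    ∫ x : EuclideanSpace ℝ (Fin n), fderiv ℝ φ x (EuclideanSpace.single i 1) *
      (x j * (‖x‖ ^ 2 + ε) ^ (-(n:ℝ)/2)) =
    - ∫ x : EuclideanSpace ℝ (Fin n), φ x * (x i * x j *
      (-(n:ℝ) * (‖x‖ ^ 2 + ε) ^ (-(n:ℝ)/2 - 1))) := by
  have hcd : Continuous (fderiv ℝ φ) := hφ.continuous_fderiv (by simp)
  have hd : Differentiable ℝ φ := hφ.differentiable (by simp)
  have hpos : ∀ x : EuclideanSpace ℝ (Fin n), ‖x‖ ^ 2 + ε ≠ 0 := fun x => by positivity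
  let K : EuclideanSpace ℝ (Fin n) → ℝ := fun x => x j * (‖x‖ ^ 2 + ε) ^ (-(n:ℝ)/2)
  have hK : ContDiff ℝ 1 K := by
    refine ContDiff.mul (by fun_prop) ?_
    refine ContDiff.rpow_const_of_ne ?_ hpos
    exact (contDiff_norm_sq ℝ).add contDiff_const
  have hKd : Differentiable ℝ K := hK.differentiable (by simp)
  have hK' : ∀ x, fderiv ℝ K x (EuclideanSpace.single i 1) = x i * x j *
      (-(n:ℝ) * (‖x‖ ^ 2 + ε) ^ (-(n:ℝ)/2 - 1)) := by
    intro x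
    have h1 : HasFDerivAt (fun x : EuclideanSpace ℝ (Fin n) => x j)
      (EuclideanSpace.proj j : EuclideanSpace ℝ (Fin n) →L[ℝ] ℝ) x :=
      (EuclideanSpace.proj j : EuclideanSpace ℝ (Fin n) →L[ℝ] ℝ).hasFDerivAt
    have h2 := ((hasStrictFDerivAt_norm_sq x).hasFDerivAt.add_const ε).rpow_const
      (p := -(n:ℝ)/2) (Or.inl (hpos x))
    have h3 := (h1.mul h2).fderiv
    have h4 : fderiv ℝ K x = _ := h3
    rw [h4]
    simp [EuclideanSpace.inner_single_right, hij, hij.symm]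
    ring
  have key := integral_mul_fderiv_eq_neg_fderiv_mul_of_integrable (μ := volume)
    (f := φ) (g := K) (v := EuclideanSpace.single i 1) ?_ ?_ ?_
    (fun x _ => hd x) (fun x _ => hKd x)
  · simp only [hK'] at key
    rw [key, neg_neg]
  · refine Continuous.integrable_of_hasCompactSupport
      ((hcd.clm_apply continuous_const).mul hK.continuous) ?_
    exact (hc.fderiv_apply ℝ _).mul_right
  · refine Continuous.integrable_of_hasCompactSupport
      (hφ.continuous.mul ((hK.continuous_fderiv (by simp)).clm_apply continuous_const)) ?_
    exact hc.mul_right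
  · exact Continuous.integrable_of_hasCompactSupport (hφ.continuous.mul hK.continuous) hc.mul_right

theorem aux_entry (n : ℕ) (hn : 3 ≤ n) (φ : EuclideanSpace ℝ (Fin n) → ℝ)
    (hφ : ContDiff ℝ (⊤ : ℕ∞) φ) (hc : HasCompactSupport φ) (i j : Fin n) :
    Integrable (fun x : EuclideanSpace ℝ (Fin n) =>
      fderiv ℝ φ x (EuclideanSpace.single i 1) * (x j * (‖x‖ ^ n)⁻¹)) := by
  have hcd : Continuous (fderiv ℝ φ) := hφ.continuous_fderiv (by simp)
  refine (aux_int n hn φ hφ hc).mono' ?_ ?_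
  · apply Measurable.aestronglyMeasurable
    apply Measurable.mul
    · exact (hcd.clm_apply continuous_const).measurable
    · fun_prop
  · filter_upwards with x
    rw [norm_mul, norm_mul]
    gcongr
    · simpa using ContinuousLinearMap.le_opNorm (fderiv ℝ φ x) (EuclideanSpace.single i (1:ℝ))
    · exact PiLp.norm_apply_le x j
    · simp

theorem aux_lim (n : ℕ) (hn : 3 ≤ n) (φ : EuclideanSpace ℝ (Fin n) → ℝ)
    (hφ : ContDiff ℝ (⊤ : ℕ∞) φ) (hc : HasCompactSupport φ) (i j : Fin n) :
    Tendsto (fun ε : ℝ => ∫ x : EuclideanSpace ℝ (Fin n),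
      fderiv ℝ φ x (EuclideanSpace.single i 1) * (x j * (‖x‖ ^ 2 + ε) ^ (-(n:ℝ)/2)))
      (𝓝[>] 0) (𝓝 (∫ x : EuclideanSpace ℝ (Fin n),
      fderiv ℝ φ x (EuclideanSpace.single i 1) * (x j * (‖x‖ ^ n)⁻¹))) := by
  have : NeZero n := ⟨by omega⟩
  have hcd : Continuous (fderiv ℝ φ) := hφ.continuous_fderiv (by simp)
  have hpw : ∀ r : ℝ, 0 ≤ r → (r ^ 2) ^ (-(n:ℝ)/2) = (r ^ n)⁻¹ := by
    intro r hr
    rw [← Real.rpow_natCast, ← Real.rpow_mul hr, ← Real.rpow_natCast r n, ← Real.rpow_neg hr]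
    congr 1
    push_cast; ring
  refine tendsto_integral_filter_of_dominated_convergence
    (fun x => ‖fderiv ℝ φ x‖ * (‖x‖ * (‖x‖ ^ n)⁻¹)) ?_ ?_ (aux_int n hn φ hφ hc) ?_
  · filter_upwards with ε
    apply Measurable.aestronglyMeasurable
    apply Measurable.mul
    · exact (hcd.clm_apply continuous_const).measurable
    · fun_prop
  · filter_upwards [self_mem_nhdsWithin] with ε hε
    have hε : (0:ℝ) < ε := hε
    filter_upwards with x
    rcases eq_or_ne x 0 with rfl | hx
    · simp
    have hx0 : 0 < ‖x‖ := norm_pos_iff.2 hx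
    rw [norm_mul, norm_mul]
    gcongr
    · simpa using ContinuousLinearMap.le_opNorm (fderiv ℝ φ x) (EuclideanSpace.single i (1:ℝ))
    · exact PiLp.norm_apply_le x j
    · rw [Real.norm_of_nonneg (by positivity), ← hpw _ hx0.le]
      refine Real.rpow_le_rpow_of_nonpos (by positivity) (by linarith) ?_
      have : (0:ℝ) ≤ n := by positivity
      linarith
  · filter_upwards with x
    rcases eq_or_ne x 0 with rfl | hx
    · simp
    have hx0 : 0 < ‖x‖ := norm_pos_iff.2 hx
    refine (Tendsto.const_mul _ (Tendsto.const_mul _ ?_))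
    rw [← hpw _ hx0.le]
    have : ContinuousAt (fun ε : ℝ => (‖x‖ ^ 2 + ε) ^ (-(n:ℝ)/2)) 0 := by
      refine ContinuousAt.rpow_const (by fun_prop) (Or.inl ?_)
      positivity
    have h := this.tendsto
    simp only [add_zero] at h
    exact h.mono_left nhdsWithin_le_nhds

theorem aux_swap (n : ℕ) (hn : 3 ≤ n) (φ : EuclideanSpace ℝ (Fin n) → ℝ)
    (hφ : ContDiff ℝ (⊤ : ℕ∞) φ) (hc : HasCompactSupport φ) (i j : Fin n) :
    ∫ x : EuclideanSpace ℝ (Fin n),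
      fderiv ℝ φ x (EuclideanSpace.single i 1) * (x j * (‖x‖ ^ n)⁻¹) =
    ∫ x : EuclideanSpace ℝ (Fin n),
      fderiv ℝ φ x (EuclideanSpace.single j 1) * (x i * (‖x‖ ^ n)⁻¹) := by
  rcases eq_or_ne i j with rfl | hij
  · rfl
  refine tendsto_nhds_unique (aux_lim n hn φ hφ hc i j)
    ((aux_lim n hn φ hφ hc j i).congr' ?_)
  filter_upwards [self_mem_nhdsWithin] with ε hε
  rw [aux_symm n hn φ hφ hc ε hε i j hij, aux_symm n hn φ hφ hc ε hε j i hij.symm]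
  congr 2
  ext x
  ring

/-- In the sense of distributions, `D(|x|^{-n} γ(x) ψ₀) = -ω_{n-1} δ₀ ψ₀`. -/
theorem stmt1 (n : ℕ) (hn : 3 ≤ n) (V : Type*) [NormedAddCommGroup V]
    [InnerProductSpace ℂ V] [FiniteDimensional ℂ V] [Nontrivial V]
    (γ : Fin n → V →ₗ[ℂ] V)
    (hcl : ∀ i j (ψ : V), γ i (γ j ψ) + γ j (γ i ψ) =
      if i = j then (-2 : ℂ) • ψ else 0)
    (hsk : ∀ i (φ ψ : V), ⟪γ i φ, ψ⟫_ℂ = -⟪φ, γ i ψ⟫_ℂ)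
    (ψ₀ : V) :
    ∀ φ : EuclideanSpace ℝ (Fin n) → ℝ, ContDiff ℝ (⊤ : ℕ∞) φ → HasCompactSupport φ →
      -∑ i, ∫ x : EuclideanSpace ℝ (Fin n),
          (fderiv ℝ φ x (EuclideanSpace.single i 1)) •
            γ i ((‖x‖ ^ n)⁻¹ • cliffordMul γ x ψ₀) =
        -((sphereVol n * φ 0) • ψ₀) := by
  intro φ hφ hc
  let I : Fin n → Fin n → ℝ := fun i j => ∫ x : EuclideanSpace ℝ (Fin n),
      fderiv ℝ φ x (EuclideanSpace.single i 1) * (x j * (‖x‖ ^ n)⁻¹)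
  have hI : ∀ i j, I i j = I j i := aux_swap n hn φ hφ hc
  have hdiag : ∑ i, I i i = -(sphereVol n * φ 0) := by
    rw [← aux_polar n hn φ hφ hc]
    simp only [I]
    rw [← integral_finsetSum _ fun i _ => aux_entry n hn φ hφ hc i i]
    congr 1
    ext x
    have hx : x = ∑ i, x i • EuclideanSpace.single i (1:ℝ) := by
      ext k
      simp [Finset.sum_apply, Pi.single_apply]
    have h5 : fderiv ℝ φ x x = ∑ i, x i * fderiv ℝ φ x (EuclideanSpace.single i (1:ℝ)) := by
      conv_lhs => arg 2; rw [hx]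
      simp
    rw [h5, Finset.sum_mul]
    refine Finset.sum_congr rfl fun i _ => ?_
    ring
  have h1 : ∀ i, ∫ x : EuclideanSpace ℝ (Fin n),
          (fderiv ℝ φ x (EuclideanSpace.single i 1)) •
            γ i ((‖x‖ ^ n)⁻¹ • cliffordMul γ x ψ₀) = ∑ j, I i j • γ i (γ j ψ₀) := by
    intro i
    simp only [I]
    simp_rw [← integral_smul_const]
    rw [← integral_finsetSum _ fun j _ => (aux_entry n hn φ hφ hc i j).smul_const _]
    congr 1
    ext x
    simp only [cliffordMul, LinearMap.map_smul_of_tower, map_sum, Finset.smul_sum, smul_smul]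
    refine Finset.sum_congr rfl fun j _ => ?_
    congr 1
    ring
  simp only [h1]
  congr 1
  have h2 : ∑ i, ∑ j, I i j • γ i (γ j ψ₀) = ∑ i, ∑ j, I i j • γ j (γ i ψ₀) := by
    rw [Finset.sum_comm]
    refine Finset.sum_congr rfl fun i _ => Finset.sum_congr rfl fun j _ => ?_
    rw [hI]
  have h3 : ∑ i, ∑ j, I i j • γ i (γ j ψ₀) + ∑ i, ∑ j, I i j • γ i (γ j ψ₀) =
      (2:ℝ) • ((sphereVol n * φ 0) • ψ₀) := by
    nth_rewrite 2 [h2]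
    simp only [← Finset.sum_add_distrib, ← smul_add, hcl]
    have : (-2 : ℂ) • ψ₀ = (-2 : ℝ) • ψ₀ := by
      rw [← Complex.coe_smul]; simp
    simp only [this, smul_ite, smul_zero, Finset.sum_ite_eq, Finset.mem_univ, if_true]
    rw [← Finset.sum_smul, hdiag, smul_smul, smul_smul]
    congr 1
    ring
  rw [← two_smul ℝ] at h3
  exact smul_right_injective V (two_ne_zero (α := ℝ)) h3
end

section
/- Let k ∈ (-n, -1) and let α : ℝⁿ\{0} → V be a smooth spinor field homogeneous of order k. Then there exists a smooth spinor field β : ℝⁿ\{0} → V, homogeneous of order k+1, such that Dβ(x) = α(x) for all x ≠ 0. -/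
open MeasureTheory Metric
open scoped InnerProductSpace

/-- The flat Dirac operator `Df(x) = ∑ i, γᵢ (∂ᵢ f (x))`. -/
noncomputable def dirac {n : ℕ} {V : Type*} [NormedAddCommGroup V]
    [NormedSpace ℂ V] (γ : Fin n → V →ₗ[ℂ] V)
    (f : EuclideanSpace ℝ (Fin n) → V) (x : EuclideanSpace ℝ (Fin n)) : V :=
  ∑ i, γ i (fderiv ℝ f x (EuclideanSpace.single i 1))

section
open MeasureTheory Metric Set Filter Topology

theorem smooth_partial {T E V : Type*} [NormedAddCommGroup T] [NormedSpace ℝ T]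
    [NormedAddCommGroup E] [NormedSpace ℝ E]
    [NormedAddCommGroup V] [NormedSpace ℝ V] {O : Set T} (hO : IsOpen O) {S : Set E}
    (hS : IsOpen S) {H : T → E → V}
    (hH : ContDiffOn ℝ (⊤ : ℕ∞) (Function.uncurry H) (O ×ˢ S)) :
    (∀ t ∈ O, ∀ x ∈ S, HasFDerivAt (H t) (fderiv ℝ (H t) x) x) ∧
    ContDiffOn ℝ (⊤ : ℕ∞) (Function.uncurry (fun t x => fderiv ℝ (H t) x)) (O ×ˢ S) := by
  have key : ∀ t ∈ O, ∀ x ∈ S, HasFDerivAt (H t)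
      ((fderiv ℝ (Function.uncurry H) (t, x)).comp (ContinuousLinearMap.inr ℝ T E)) x := by
    intro t ht x hx
    have h1 : HasFDerivAt (Function.uncurry H) (fderiv ℝ (Function.uncurry H) (t, x)) (t, x) :=
      ((hH.contDiffAt ((hO.prod hS).mem_nhds ⟨ht, hx⟩)).differentiableAt (by simp)).hasFDerivAt
    exact h1.comp x (hasFDerivAt_prodMk_right t x)
  refine ⟨fun t ht x hx => (key t ht x hx).differentiableAt.hasFDerivAt, ?_⟩
  have h2 : ContDiffOn ℝ (⊤ : ℕ∞) (fun q : T × E =>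
      (fderiv ℝ (Function.uncurry H) q).comp (ContinuousLinearMap.inr ℝ T E)) (O ×ˢ S) := by
    have := ((contDiffOn_infty_iff_fderiv_of_isOpen (hO.prod hS)).1 hH).2
    exact this.clm_comp contDiffOn_const
  refine h2.congr ?_
  rintro ⟨t, x⟩ ⟨ht, hx⟩
  exact (key t ht x hx).fderiv

theorem param_hasFDerivAt {T E V : Type*} [NormedAddCommGroup T] [NormedSpace ℝ T]
    [MeasurableSpace T] [BorelSpace T] [SecondCountableTopology T] (μ : Measure T)
    [NormedAddCommGroup E] [NormedSpace ℝ E] [FiniteDimensional ℝ E]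
    [NormedAddCommGroup V] [NormedSpace ℝ V] 
    {K O : Set T} (hK : IsCompact K) (hO : IsOpen O) (hKO : K ⊆ O) {S : Set E}
    (hS : IsOpen S) {f : T → ℝ} (hf : IntegrableOn f K μ) {H : T → E → V}
    (hH : ContDiffOn ℝ (⊤ : ℕ∞) (Function.uncurry H) (O ×ˢ S)) {x : E} (hx : x ∈ S) :
    IntegrableOn (fun t => f t • H t x) K μ ∧
    IntegrableOn (fun t => f t • fderiv ℝ (H t) x) K μ ∧
    HasFDerivAt (fun x => ∫ t in K, f t • H t x ∂μ) (∫ t in K, f t • fderiv ℝ (H t) x ∂μ) x := by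
  obtain ⟨hd, hc⟩ := smooth_partial hO hS hH
  have hKm := hK.isClosed.measurableSet
  have cont1 : ∀ x ∈ S, ContinuousOn (fun t => H t x) K := by
    intro x hx
    exact hH.continuousOn.comp (f := fun t => (t, x)) (by fun_prop) (fun t ht => ⟨hKO ht, hx⟩)
  have cont2 : ∀ x ∈ S, ContinuousOn (fun t => fderiv ℝ (H t) x) K := by
    intro x hx
    exact hc.continuousOn.comp (f := fun t => (t, x)) (by fun_prop) (fun t ht => ⟨hKO ht, hx⟩)
  have int1 : ∀ x ∈ S, IntegrableOn (fun t => f t • H t x) K μ := 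
    fun x hx => hf.smul_continuousOn (cont1 x hx) hK
  have int2 : ∀ x ∈ S, IntegrableOn (fun t => f t • fderiv ℝ (H t) x) K μ :=
    fun x hx => hf.smul_continuousOn (cont2 x hx) hK
  refine ⟨int1 x hx, int2 x hx, ?_⟩
  obtain ⟨ε, hε, hb⟩ := Metric.nhds_basis_closedBall.mem_iff.1 (hS.mem_nhds hx)
  have hcomp : IsCompact (K ×ˢ closedBall x ε) := hK.prod (isCompact_closedBall x ε)
  obtain ⟨C, hC⟩ := hcomp.exists_bound_of_continuousOn
    (hc.continuousOn.mono (prod_mono hKO hb))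
  apply hasFDerivAt_integral_of_dominated_of_fderiv_le (bound := fun t => ‖f t‖ * C)
    (s := closedBall x ε) (F := fun x t => f t • H t x) (F' := fun x t => f t • fderiv ℝ (H t) x)
    (closedBall_mem_nhds x hε)
  · filter_upwards [hS.mem_nhds hx] with y hy using (int1 y hy).1
  · exact int1 x hx
  · exact (int2 x hx).1
  · filter_upwards [ae_restrict_mem hKm] with t ht y hy
    rw [norm_smul]
    gcongr
    exact hC (t, y) ⟨ht, hy⟩
  · exact hf.norm.mul_const C
  · filter_upwards [ae_restrict_mem hKm] with t ht y hy
    exact (hd t (hKO ht) y (hb hy)).const_smul (f t)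

theorem param_contDiffOn.{u} {T : Type*} {E : Type} [NormedAddCommGroup T] [NormedSpace ℝ T]
    [MeasurableSpace T] [BorelSpace T] [SecondCountableTopology T] (μ : Measure T)
    [NormedAddCommGroup E] [NormedSpace ℝ E] [FiniteDimensional ℝ E]
    {K O : Set T} (hK : IsCompact K) (hO : IsOpen O) (hKO : K ⊆ O) {S : Set E}
    (hS : IsOpen S) {f : T → ℝ} (hf : IntegrableOn f K μ) (m : ℕ) :
    ∀ {V : Type u} [NormedAddCommGroup V] [NormedSpace ℝ V] {H : T → E → V}
    (hH : ContDiffOn ℝ (⊤ : ℕ∞) (Function.uncurry H) (O ×ˢ S)),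
    ContDiffOn ℝ m (fun x => ∫ t in K, f t • H t x ∂μ) S := by
  induction m with
  | zero =>
    intro V _ _ H hH
    simp only [CharP.cast_eq_zero, contDiffOn_zero]
    intro x hx
    exact (param_hasFDerivAt μ hK hO hKO hS hf hH hx).2.2.continuousAt.continuousWithinAt
  | succ m ih =>
    intro V _ _ H hH
    have := fun x hx => (param_hasFDerivAt μ hK hO hKO hS hf hH (x := x) hx).2.2
    push_cast
    rw [contDiffOn_succ_iff_fderiv_of_isOpen hS]
    refine ⟨fun x hx => (this x hx).differentiableAt.differentiableWithinAt, by simp, ?_⟩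
    refine (ih (smooth_partial hO hS hH).2).congr fun x hx => (this x hx).fderiv

theorem param_smooth {T V : Type*} {E : Type} [NormedAddCommGroup T] [NormedSpace ℝ T]
    [MeasurableSpace T] [BorelSpace T] [SecondCountableTopology T] (μ : Measure T)
    [NormedAddCommGroup E] [NormedSpace ℝ E] [FiniteDimensional ℝ E]
    [NormedAddCommGroup V] [NormedSpace ℝ V] 
    {K O : Set T} (hK : IsCompact K) (hO : IsOpen O) (hKO : K ⊆ O) {S : Set E}
    (hS : IsOpen S) {f : T → ℝ} (hf : IntegrableOn f K μ) {H : T → E → V}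
    (hH : ContDiffOn ℝ (⊤ : ℕ∞) (Function.uncurry H) (O ×ˢ S)) :
    ContDiffOn ℝ (⊤ : ℕ∞) (fun x => ∫ t in K, f t • H t x ∂μ) S := by
  rw [contDiffOn_infty]
  exact fun m => param_contDiffOn μ hK hO hKO hS hf m hH

theorem cliff_sq {n : ℕ} {V : Type*} [NormedAddCommGroup V] [NormedSpace ℝ V]
    (A : Fin n → V →L[ℝ] V)
    (hA : ∀ i j (ψ : V), A i (A j ψ) + A j (A i ψ) = if i = j then (-2 : ℝ) • ψ else 0)
    (y : EuclideanSpace ℝ (Fin n)) (ψ : V) :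
    ∑ i, ∑ j, (y i * y j) • A i (A j ψ) = (-‖y‖ ^ 2) • ψ := by
  have h1 : ∑ i, ∑ j, (y i * y j) • A i (A j ψ) = ∑ i, ∑ j, (y i * y j) • A j (A i ψ) := by
    rw [Finset.sum_comm]
    refine Finset.sum_congr rfl fun i _ => Finset.sum_congr rfl fun j _ => by rw [mul_comm]
  have h2 : (2 : ℝ) • ∑ i, ∑ j, (y i * y j) • A i (A j ψ) = (2 : ℝ) • (-‖y‖ ^ 2) • ψ := by
    rw [two_smul]
    nth_rewrite 2 [h1]
    simp_rw [← Finset.sum_add_distrib, ← smul_add, hA]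
    simp only [smul_ite, smul_zero, Finset.sum_ite_eq, Finset.mem_univ, if_true]
    rw [EuclideanSpace.real_norm_sq_eq, smul_smul, ← Finset.sum_neg_distrib, Finset.mul_sum,
      Finset.sum_smul]
    refine Finset.sum_congr rfl fun i _ => ?_
    rw [smul_smul]; congr 1; ring
  exact smul_right_injective V (two_ne_zero (α := ℝ)) h2

/-- The components of the Dirac kernel. -/
noncomputable def dk (n : ℕ) (j : Fin n) (y : EuclideanSpace ℝ (Fin n)) : ℝ :=
  y j * (‖y‖ ^ n)⁻¹

theorem dk_contDiffOn (n : ℕ) (j : Fin n) : ContDiffOn ℝ (⊤ : ℕ∞) (dk n j) {0}ᶜ := by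
  unfold dk
  intro y hy
  have hy' : y ≠ 0 := hy
  apply ContDiffAt.contDiffWithinAt
  apply ContDiffAt.mul
  · exact (EuclideanSpace.proj (𝕜 := ℝ) j).contDiff.contDiffAt
  · apply ContDiffAt.inv
    · exact (contDiffAt_norm ℝ hy').pow n
    · positivity

theorem dk_abs_le (n : ℕ) (j : Fin n) (y : EuclideanSpace ℝ (Fin n)) (hy : y ≠ 0) :
    ‖dk n j y‖ ≤ 1 * ‖y‖ ^ (-((n : ℝ) - 1)) := by
  have h0 : 0 < ‖y‖ := norm_pos_iff.2 hy
  rw [dk, norm_mul, norm_inv, norm_pow, norm_norm, one_mul, neg_sub, Real.rpow_sub h0,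
    Real.rpow_one, Real.rpow_natCast, div_eq_mul_inv]
  gcongr
  exact PiLp.norm_apply_le y j

theorem dk_meas (n : ℕ) (j : Fin n) : Measurable (dk n j) := by
  unfold dk; fun_prop

theorem dk_locInt (n : ℕ) (hn : 3 ≤ n) (j : Fin n) :
    LocallyIntegrable (dk n j) volume := by
  have : NeZero n := ⟨by omega⟩
  apply locallyIntegrable_of_norm_le_rpow (C := 1) (α := (n : ℝ) - 1)
  · simp
  · have : ∀ᵐ y : EuclideanSpace ℝ (Fin n), y ≠ 0 := by
      simp [ae_iff]
    filter_upwards [this] with y hy using dk_abs_le n j y hy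
  · exact (dk_meas n j).aestronglyMeasurable
  · simp; omega

theorem dk_smul (n : ℕ) (hn : 3 ≤ n) (j : Fin n) (s : ℝ) (hs : 0 < s)
    (y : EuclideanSpace ℝ (Fin n)) :
    dk n j (s⁻¹ • y) = s ^ ((n : ℝ) - 1) * dk n j y := by
  rw [Real.rpow_sub hs, Real.rpow_one, Real.rpow_natCast]
  simp only [dk, norm_smul, norm_inv, Real.norm_of_nonneg hs.le, PiLp.smul_apply, smul_eq_mul]
  rw [mul_pow, mul_inv, inv_pow, inv_inv]
  field_simp

/-- regularised kernel -/
noncomputable def kr (n : ℕ) (ε : ℝ) (j : Fin n) (y : EuclideanSpace ℝ (Fin n)) : ℝ :=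
  y j * (‖y‖ ^ 2 + ε) ^ (-(n : ℝ) / 2)

theorem kr_contDiff (n : ℕ) {ε : ℝ} (hε : 0 < ε) (j : Fin n) :
    ContDiff ℝ (⊤ : ℕ∞) (kr n ε j) := by
  unfold kr
  apply ContDiff.mul
  · exact (EuclideanSpace.proj (𝕜 := ℝ) j).contDiff
  · apply ContDiff.rpow_const_of_ne
    · exact (contDiff_norm_sq ℝ).add contDiff_const
    · intro x; positivity

theorem kr_fderiv (n : ℕ) {ε : ℝ} (hε : 0 < ε) (i j : Fin n) (y : EuclideanSpace ℝ (Fin n)) :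
    fderiv ℝ (kr n ε j) y (EuclideanSpace.single i 1) =
      (if i = j then (‖y‖ ^ 2 + ε) ^ (-(n : ℝ) / 2) else 0)
       - n * (‖y‖ ^ 2 + ε) ^ (-((n : ℝ) + 2) / 2) * (y i * y j) := by
  have hq : 0 < ‖y‖ ^ 2 + ε := by positivity
  have h1 : HasFDerivAt (fun y : EuclideanSpace ℝ (Fin n) => y j)
      (EuclideanSpace.proj (𝕜 := ℝ) j : EuclideanSpace ℝ (Fin n) →L[ℝ] ℝ) y :=
    (EuclideanSpace.proj (𝕜 := ℝ) j).hasFDerivAt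
  have h2 := ((hasStrictFDerivAt_norm_sq y).hasFDerivAt.add_const ε).rpow_const
    (p := -(n : ℝ) / 2) (Or.inl hq.ne')
  have h3 := (h1.mul h2).fderiv
  have e : -(n : ℝ) / 2 - 1 = -((n : ℝ) + 2) / 2 := by ring
  have h4 : fderiv ℝ (kr n ε j) y = _ := h3
  rw [h4, e]
  simp [EuclideanSpace.inner_single_right, Pi.single_apply, eq_comm (a := j)]
  split_ifs <;> ring

theorem norm_kr_le (n : ℕ) {ε : ℝ} (hε : 0 < ε) (j : Fin n) (y : EuclideanSpace ℝ (Fin n))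
    (hy : y ≠ 0) : ‖kr n ε j y‖ ≤ ‖dk n j y‖ := by
  have h0 : 0 < ‖y‖ := norm_pos_iff.2 hy
  rw [dk, kr, norm_mul, norm_mul]
  gcongr
  rw [Real.norm_of_nonneg (by positivity), Real.norm_of_nonneg (by positivity)]
  have : (‖y‖ ^ n)⁻¹ = (‖y‖ ^ 2) ^ (-(n : ℝ) / 2) := by
    rw [← Real.rpow_natCast, ← Real.rpow_natCast, ← Real.rpow_mul h0.le, ← Real.rpow_neg h0.le]
    congr 1; push_cast; ring
  rw [this]
  apply Real.rpow_le_rpow_of_nonpos (by positivity) (by linarith)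
  have : (0 : ℝ) ≤ n := by positivity
  linarith

theorem kr_tendsto (n : ℕ) (j : Fin n) (y : EuclideanSpace ℝ (Fin n)) (hy : y ≠ 0) :
    Tendsto (fun δ : ℝ => kr n (δ ^ 2) j y) (𝓝[>] 0) (𝓝 (dk n j y)) := by
  have h0 : 0 < ‖y‖ := norm_pos_iff.2 hy
  have : dk n j y = kr n (0 ^ 2) j y := by
    rw [dk, kr]
    congr 1
    rw [← Real.rpow_natCast ‖y‖ n, zero_pow two_ne_zero, add_zero,
      ← Real.rpow_natCast, ← Real.rpow_mul h0.le, ← Real.rpow_neg h0.le]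
    congr 1; push_cast; ring
  rw [this]
  apply Tendsto.mono_left _ nhdsWithin_le_nhds
  have : ContinuousAt (fun δ : ℝ => kr n (δ ^ 2) j y) 0 := by
    unfold kr
    apply ContinuousAt.mul continuousAt_const
    apply ContinuousAt.rpow_const (by fun_prop)
    left; simp; exact hy
  exact this

theorem ibp (n : ℕ) {ε : ℝ} (hε : 0 < ε) {V : Type*} [NormedAddCommGroup V] [NormedSpace ℝ V]
    {η : EuclideanSpace ℝ (Fin n) → V} (hη : ContDiff ℝ (⊤ : ℕ∞) η) (hc : HasCompactSupport η)
    (i j : Fin n) (x : EuclideanSpace ℝ (Fin n)) :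
    Integrable (fun y => fderiv ℝ (kr n ε j) y (EuclideanSpace.single i 1) • η (x - y)) ∧
    ∫ y, kr n ε j y • fderiv ℝ η (x - y) (EuclideanSpace.single i 1) =
    ∫ y, fderiv ℝ (kr n ε j) y (EuclideanSpace.single i 1) • η (x - y) := by
  have hk := kr_contDiff n hε j
  have hg : ContDiff ℝ (⊤ : ℕ∞) (fun y => η (x - y)) := hη.comp (contDiff_const.sub contDiff_id)
  have hgc : HasCompactSupport (fun y => η (x - y)) :=
    hc.comp_homeomorph (Homeomorph.subLeft x)
  have hfd : ∀ y v, fderiv ℝ (fun y => η (x - y)) y v = - fderiv ℝ η (x - y) v := by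
    intro y v
    have h1 : HasFDerivAt η (fderiv ℝ η (x - y)) (x - y) :=
      (hη.differentiable (by simp) _).hasFDerivAt
    have h2 := (h1.comp y ((hasFDerivAt_id y).const_sub x)).fderiv
    have h3 : fderiv ℝ (fun y => η (x - y)) y = _ := h2
    rw [h3]; simp
  have int1 : Integrable (fun y => fderiv ℝ (kr n ε j) y (EuclideanSpace.single i 1) • η (x - y)) := by
    apply Continuous.integrable_of_hasCompactSupport
    · exact ((hk.continuous_fderiv (by simp)).clm_apply continuous_const).smul hg.continuous
    · exact hgc.smul_left
  refine ⟨int1, ?_⟩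
  have := integral_smul_fderiv_eq_neg_fderiv_smul_of_integrable (μ := volume) (f := kr n ε j)
    (g := fun y => η (x - y)) (v := EuclideanSpace.single i 1) int1 ?_ ?_ ?_ ?_
  · simp only [hfd, smul_neg, integral_neg, neg_inj] at this
    exact this
  · apply Continuous.integrable_of_hasCompactSupport
    · exact hk.continuous.smul ((hg.continuous_fderiv (by simp)).clm_apply continuous_const)
    · exact (hgc.fderiv_apply ℝ _).smul_left
  · apply Continuous.integrable_of_hasCompactSupport
    · exact hk.continuous.smul hg.continuous
    · exact hgc.smul_left
  · intro y _; exact hk.differentiable (by simp) y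
  · intro y _; exact hg.differentiable (by simp) y

theorem reg_sum (n : ℕ) {δ : ℝ} (hδ : 0 < δ) {V : Type*} [NormedAddCommGroup V] [NormedSpace ℝ V]
    [CompleteSpace V] (A : Fin n → V →L[ℝ] V)
    (hA : ∀ i j (ψ : V), A i (A j ψ) + A j (A i ψ) = if i = j then (-2 : ℝ) • ψ else 0)
    {η : EuclideanSpace ℝ (Fin n) → V} (hη : ContDiff ℝ (⊤ : ℕ∞) η) (hc : HasCompactSupport η)
    (x : EuclideanSpace ℝ (Fin n)) :
    ∑ i, ∑ j, A i (A j (∫ y, kr n (δ ^ 2) j y • fderiv ℝ η (x - y) (EuclideanSpace.single i 1)))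
    = (-(n : ℝ)) • ∫ z, (1 + ‖z‖ ^ 2) ^ (-((n : ℝ) + 2) / 2) • η (x - δ • z) := by
  have hε : 0 < δ ^ 2 := by positivity
  have I1 : ∀ i j, Integrable (fun y => A i (A j
      (fderiv ℝ (kr n (δ ^ 2) j) y (EuclideanSpace.single i 1) • η (x - y)))) := by
    intro i j
    exact (A i).integrable_comp ((A j).integrable_comp (ibp n hε hη hc i j x).1)
  have e1 : ∀ i j, A i (A j (∫ y, kr n (δ ^ 2) j y • fderiv ℝ η (x - y) (EuclideanSpace.single i 1)))
      = ∫ y, A i (A j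
      (fderiv ℝ (kr n (δ ^ 2) j) y (EuclideanSpace.single i 1) • η (x - y))) := by
    intro i j
    rw [(ibp n hε hη hc i j x).2, ← (A j).integral_comp_comm (ibp n hε hη hc i j x).1,
      ← (A i).integral_comp_comm ((A j).integrable_comp (ibp n hε hη hc i j x).1)]
  simp_rw [e1]
  have e2 : ∀ i, ∑ j, ∫ y, A i (A j
      (fderiv ℝ (kr n (δ ^ 2) j) y (EuclideanSpace.single i 1) • η (x - y))) = 
      ∫ y, ∑ j, A i (A j
      (fderiv ℝ (kr n (δ ^ 2) j) y (EuclideanSpace.single i 1) • η (x - y))) := by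
    intro i
    rw [integral_finsetSum _ (fun j _ => I1 i j)]
  simp_rw [e2]
  rw [← integral_finsetSum _ (fun i _ => integrable_finsetSum _ (fun j _ => I1 i j))]
  have e3 : ∀ y, ∑ i, ∑ j, A i (A j
      (fderiv ℝ (kr n (δ ^ 2) j) y (EuclideanSpace.single i 1) • η (x - y))) =
      (-(n : ℝ)) • (δ ^ 2 * (‖y‖ ^ 2 + δ ^ 2) ^ (-((n : ℝ) + 2) / 2)) • η (x - y) := by
    intro y
    set ψ := η (x - y)
    have hq : 0 < ‖y‖ ^ 2 + δ ^ 2 := by positivity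
    have hii : ∀ i, A i (A i ψ) = -ψ := by
      intro i
      have := hA i i ψ
      rw [if_pos rfl, ← two_smul ℝ (A i (A i ψ))] at this
      have h2 : (2 : ℝ) • A i (A i ψ) = (2 : ℝ) • (-ψ) := by rw [this]; simp
      exact smul_right_injective V (two_ne_zero (α := ℝ)) h2
    have hs := cliff_sq A hA y ψ
    simp only [map_smul]
    simp only [kr_fderiv n hε, sub_smul, Finset.sum_sub_distrib, ite_smul, zero_smul,
      Finset.sum_ite_eq, Finset.mem_univ, if_true, hii]
    simp only [mul_smul _ (_ * _ : ℝ), ← Finset.smul_sum, hs, mul_smul (n : ℝ)]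
    simp only [Finset.sum_const, Finset.card_univ, Fintype.card_fin, ← Nat.cast_smul_eq_nsmul ℝ,
      smul_smul, ← sub_smul, smul_neg, ← neg_smul]
    congr 1
    have : (‖y‖ ^ 2 + δ ^ 2) ^ (-(n : ℝ) / 2) =
      (‖y‖ ^ 2 + δ ^ 2) ^ (-((n : ℝ) + 2) / 2) * (‖y‖ ^ 2 + δ ^ 2) := by
      nth_rewrite 3 [← Real.rpow_one (‖y‖ ^ 2 + δ ^ 2)]
      rw [← Real.rpow_add hq]; congr 1; ring
    rw [this]; ring
  simp_rw [e3]
  rw [integral_smul]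
  congr 1
  have := Measure.integral_comp_smul (volume : Measure (EuclideanSpace ℝ (Fin n)))
    (fun y => (δ ^ 2 * (‖y‖ ^ 2 + δ ^ 2) ^ (-((n : ℝ) + 2) / 2)) • η (x - y)) δ
  rw [finrank_euclideanSpace_fin, abs_of_nonneg (by positivity), eq_inv_smul_iff₀ (by positivity)] at this
  rw [← this, ← integral_smul]
  congr 1
  ext z
  rw [smul_smul]
  congr 1
  rw [norm_smul, Real.norm_of_nonneg hδ.le]
  have : (δ * ‖z‖) ^ 2 + δ ^ 2 = δ ^ 2 * (1 + ‖z‖ ^ 2) := by ring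
  rw [this, Real.mul_rpow (by positivity) (by positivity), ← Real.rpow_natCast δ 2,
    ← Real.rpow_mul hδ.le, ← Real.rpow_natCast δ n, ← mul_assoc, ← mul_assoc, ← Real.rpow_add hδ,
    ← Real.rpow_add hδ]
  have : (n : ℝ) + ((2 : ℕ) : ℝ) + ((2 : ℕ) : ℝ) * (-((n : ℝ) + 2) / 2) = 0 := by push_cast; ring
  rw [this]; simp

/-- normalising constant -/
noncomputable def cst (n : ℕ) : ℝ :=
  -(n : ℝ) * ∫ z : EuclideanSpace ℝ (Fin n), (1 + ‖z‖ ^ 2) ^ (-((n : ℝ) + 2) / 2)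

theorem cst_int (n : ℕ) : Integrable
    (fun z : EuclideanSpace ℝ (Fin n) => (1 + ‖z‖ ^ 2) ^ (-((n : ℝ) + 2) / 2)) :=
  integrable_rpow_neg_one_add_norm_sq (by simp)

theorem cst_ne (n : ℕ) (hn : 3 ≤ n) : cst n ≠ 0 := by
  have : 0 < ∫ z : EuclideanSpace ℝ (Fin n), (1 + ‖z‖ ^ 2) ^ (-((n : ℝ) + 2) / 2) := by
    rw [integral_pos_iff_support_of_nonneg (fun z => by positivity) (cst_int n)]
    have : Function.support (fun z : EuclideanSpace ℝ (Fin n) =>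
      (1 + ‖z‖ ^ 2) ^ (-((n : ℝ) + 2) / 2)) = univ := by
      ext z; simp only [Function.mem_support, mem_univ, iff_true]; positivity
    rw [this]; exact isOpen_univ.measure_pos _ univ_nonempty
  have h2 : (n : ℝ) ≠ 0 := by positivity
  unfold cst
  exact mul_ne_zero (neg_ne_zero.2 h2) this.ne'

theorem fund (n : ℕ) (hn : 3 ≤ n) {V : Type*} [NormedAddCommGroup V] [NormedSpace ℝ V]
    [CompleteSpace V] (A : Fin n → V →L[ℝ] V)
    (hA : ∀ i j (ψ : V), A i (A j ψ) + A j (A i ψ) = if i = j then (-2 : ℝ) • ψ else 0)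
    {η : EuclideanSpace ℝ (Fin n) → V} (hη : ContDiff ℝ (⊤ : ℕ∞) η) (hc : HasCompactSupport η)
    (x : EuclideanSpace ℝ (Fin n)) :
    ∑ i, ∑ j, A i (A j (∫ y, dk n j y • fderiv ℝ η (x - y) (EuclideanSpace.single i 1)))
    = cst n • η x := by
  have : NeZero n := ⟨by omega⟩
  have hne : ∀ᵐ y : EuclideanSpace ℝ (Fin n), y ≠ 0 := by simp [ae_iff]
  have L1 : Tendsto (fun δ : ℝ => ∑ i, ∑ j, A i (A j (∫ y, kr n (δ ^ 2) j y •
      fderiv ℝ η (x - y) (EuclideanSpace.single i 1)))) (𝓝[>] 0)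
      (𝓝 (∑ i, ∑ j, A i (A j (∫ y, dk n j y •
      fderiv ℝ η (x - y) (EuclideanSpace.single i 1))))) := by
    refine tendsto_finsetSum _ fun i _ => tendsto_finsetSum _ fun j _ => ?_
    refine ((A i).continuous.tendsto _).comp (((A j).continuous.tendsto _).comp ?_)
    have hcont : Continuous (fun y => fderiv ℝ η (x - y) (EuclideanSpace.single i 1)) :=
      ((hη.continuous_fderiv (by simp)).comp (continuous_const.sub continuous_id)).clm_apply
        continuous_const
    have hcs : HasCompactSupport (fun y => fderiv ℝ η (x - y) (EuclideanSpace.single i 1)) :=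
      (hc.fderiv_apply ℝ (EuclideanSpace.single i 1)).comp_homeomorph (Homeomorph.subLeft x)
    apply tendsto_integral_filter_of_dominated_convergence
      (fun y => ‖dk n j y • fderiv ℝ η (x - y) (EuclideanSpace.single i 1)‖)
    · filter_upwards [self_mem_nhdsWithin] with δ hδ
      have hδ' : 0 < δ := hδ
      exact ((kr_contDiff n (by positivity) j).continuous.smul hcont).aestronglyMeasurable
    · filter_upwards [self_mem_nhdsWithin] with δ hδ
      have hδ' : 0 < δ := hδ
      filter_upwards [hne] with y hy
      rw [norm_smul, norm_smul]
      gcongr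
      exact norm_kr_le n (by positivity) j y hy
    · exact ((dk_locInt n hn j).integrable_smul_right_of_hasCompactSupport hcont hcs).norm
    · filter_upwards [hne] with y hy
      exact (kr_tendsto n j y hy).smul_const _
  have L2 : Tendsto (fun δ : ℝ => (-(n : ℝ)) • ∫ z, (1 + ‖z‖ ^ 2) ^ (-((n : ℝ) + 2) / 2) • η (x - δ • z))
      (𝓝[>] 0) (𝓝 ((-(n : ℝ)) • ∫ z : EuclideanSpace ℝ (Fin n), (1 + ‖z‖ ^ 2) ^ (-((n : ℝ) + 2) / 2) • η x)) := by
    apply Tendsto.const_smul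
    obtain ⟨C, hC⟩ := hη.continuous.bounded_above_of_compact_support hc
    apply tendsto_integral_filter_of_dominated_convergence
      (fun z => (1 + ‖z‖ ^ 2) ^ (-((n : ℝ) + 2) / 2) * C)
    · filter_upwards with δ
      apply AEStronglyMeasurable.smul (cst_int n).1
      exact (hη.continuous.comp (by fun_prop)).aestronglyMeasurable
    · filter_upwards with δ
      filter_upwards with y
      rw [norm_smul, Real.norm_of_nonneg (by positivity)]
      gcongr
      exact hC _
    · exact (cst_int n).mul_const C
    · filter_upwards with z
      apply Tendsto.const_smul
      apply Tendsto.mono_left _ nhdsWithin_le_nhds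
      have : Continuous (fun δ : ℝ => η (x - δ • z)) := hη.continuous.comp (by fun_prop)
      simpa using this.tendsto 0
  rw [integral_smul_const, smul_smul] at L2
  refine tendsto_nhds_unique L1 (L2.congr' ?_)
  filter_upwards [self_mem_nhdsWithin] with δ hδ
  exact (reg_sum n hδ A hA hη hc x).symm

/-- real version of the Dirac operator -/
noncomputable def DD {n : ℕ} {V : Type*} [NormedAddCommGroup V] [NormedSpace ℝ V]
    (A : Fin n → V →L[ℝ] V) (f : EuclideanSpace ℝ (Fin n) → V) (x : EuclideanSpace ℝ (Fin n)) : V :=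
  ∑ i, A i (fderiv ℝ f x (EuclideanSpace.single i 1))

/-- the solution of `D ζ = c η` -/
noncomputable def zeta {n : ℕ} {V : Type*} [NormedAddCommGroup V] [NormedSpace ℝ V]
    (A : Fin n → V →L[ℝ] V) (η : EuclideanSpace ℝ (Fin n) → V) (x : EuclideanSpace ℝ (Fin n)) : V :=
  ∑ j, A j (∫ y, dk n j y • η (x - y))

/-- the rescaled solution at infinity -/
noncomputable def Gf {n : ℕ} {V : Type*} [NormedAddCommGroup V] [NormedSpace ℝ V]
    (A : Fin n → V →L[ℝ] V) (η : EuclideanSpace ℝ (Fin n) → V) (s : ℝ)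
    (x : EuclideanSpace ℝ (Fin n)) : V :=
  ∑ j, A j (∫ y in closedBall (0 : EuclideanSpace ℝ (Fin n)) 2,
    (1 : ℝ) • (dk n j (x - s • y) • η y))

section
variable {n : ℕ} {V : Type*} [NormedAddCommGroup V] [NormedSpace ℝ V]

theorem conv_eq (j : Fin n) {W : Type*} [NormedAddCommGroup W] [NormedSpace ℝ W]
    (g : EuclideanSpace ℝ (Fin n) → W) (hg : ∀ z, 2 < ‖z‖ → g z = 0) (R : ℝ)
    (x : EuclideanSpace ℝ (Fin n)) (hx : ‖x‖ < R) :
    ∫ y in closedBall 0 (R + 2), dk n j y • g (x - y) = ∫ y, dk n j y • g (x - y) := by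
  apply setIntegral_eq_integral_of_forall_compl_eq_zero
  intro y hy
  rw [hg, smul_zero]
  rw [mem_closedBall_zero_iff, not_le] at hy
  have := norm_sub_norm_le y x
  rw [norm_sub_rev] at this
  linarith

theorem zeta_j (hn : 3 ≤ n) (j : Fin n) {η : EuclideanSpace ℝ (Fin n) → V}
    (hη : ContDiff ℝ (⊤ : ℕ∞) η) (hs : ∀ z, 2 ≤ ‖z‖ → η z = 0) :
    ContDiff ℝ (⊤ : ℕ∞) (fun x => ∫ y, dk n j y • η (x - y)) ∧
    ∀ x v, fderiv ℝ (fun x => ∫ y, dk n j y • η (x - y)) x v =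
      ∫ y, dk n j y • fderiv ℝ η (x - y) v := by
  have hs' : ∀ z, 2 < ‖z‖ → η z = 0 := fun z hz => hs z hz.le
  have hs2 : ∀ z, 2 < ‖z‖ → fderiv ℝ η z = 0 := by
    intro z hz
    have : η =ᶠ[𝓝 z] fun _ => 0 := by
      filter_upwards [continuous_norm.continuousAt.eventually (lt_mem_nhds hz)] with w hw
        using hs' w hw
    rw [this.fderiv_eq]; simp
  have hH : ∀ R : ℝ, ContDiffOn ℝ (⊤ : ℕ∞) (Function.uncurry
      (fun (y x : EuclideanSpace ℝ (Fin n)) => η (x - y))) (univ ×ˢ ball 0 R) := by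
    intro R
    exact (hη.comp (contDiff_snd.sub contDiff_fst)).contDiffOn
  have hi : ∀ R : ℝ, IntegrableOn (dk n j) (closedBall 0 (R + 2)) volume := fun R =>
    (dk_locInt n hn j).integrableOn_isCompact (isCompact_closedBall _ _)
  have hfd : ∀ x y : EuclideanSpace ℝ (Fin n),
      fderiv ℝ (fun x => η (x - y)) x = fderiv ℝ η (x - y) := by
    intro x y; rw [fderiv_comp_sub]
  constructor
  · rw [contDiff_iff_contDiffAt]
    intro x
    have := param_smooth volume (isCompact_closedBall (0 : EuclideanSpace ℝ (Fin n)) (‖x‖ + 1 + 2))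
      isOpen_univ (subset_univ _) (isOpen_ball (x := (0 : EuclideanSpace ℝ (Fin n))) (ε := ‖x‖ + 1))
      (hi (‖x‖ + 1)) (hH (‖x‖ + 1))
    have h2 := this.congr (f₁ := fun x => ∫ y, dk n j y • η (x - y)) (fun z hz =>
      (conv_eq j η hs' (‖x‖ + 1) z (by simpa using hz)).symm)
    exact h2.contDiffAt (isOpen_ball.mem_nhds (by simp))
  · intro x v
    obtain ⟨-, i2, h⟩ := param_hasFDerivAt volume (isCompact_closedBall (0 : EuclideanSpace ℝ (Fin n)) (‖x‖ + 1 + 2))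
      isOpen_univ (subset_univ _) (isOpen_ball (x := (0 : EuclideanSpace ℝ (Fin n))) (ε := ‖x‖ + 1))
      (hi (‖x‖ + 1)) (hH (‖x‖ + 1)) (x := x) (by simp)
    have h2 : (fun x => ∫ y, dk n j y • η (x - y)) =ᶠ[𝓝 x]
        fun x' => ∫ y in closedBall 0 (‖x‖ + 1 + 2), dk n j y • η (x' - y) := by
      filter_upwards [isOpen_ball.mem_nhds (show x ∈ ball (0 : EuclideanSpace ℝ (Fin n)) (‖x‖ + 1) by simp)]
        with z hz using (conv_eq j η hs' (‖x‖ + 1) z (by simpa using hz)).symm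
    rw [(h.congr_of_eventuallyEq h2).fderiv, ContinuousLinearMap.integral_apply i2]
    simp only [hfd, ContinuousLinearMap.smul_apply]
    exact conv_eq j (fun z => fderiv ℝ η z v) (fun z hz => by simp [hs2 z hz]) (‖x‖ + 1) x (by simp)

theorem zeta_smooth (hn : 3 ≤ n) (A : Fin n → V →L[ℝ] V) {η : EuclideanSpace ℝ (Fin n) → V}
    (hη : ContDiff ℝ (⊤ : ℕ∞) η) (hs : ∀ z, 2 ≤ ‖z‖ → η z = 0) :
    ContDiff ℝ (⊤ : ℕ∞) (zeta A η) := by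
  unfold zeta
  exact ContDiff.sum fun j _ => (A j).contDiff.comp (zeta_j hn j hη hs).1

theorem zeta_dirac (hn : 3 ≤ n) [CompleteSpace V] (A : Fin n → V →L[ℝ] V)
    (hA : ∀ i j (ψ : V), A i (A j ψ) + A j (A i ψ) = if i = j then (-2 : ℝ) • ψ else 0)
    {η : EuclideanSpace ℝ (Fin n) → V}
    (hη : ContDiff ℝ (⊤ : ℕ∞) η) (hs : ∀ z, 2 ≤ ‖z‖ → η z = 0) (x : EuclideanSpace ℝ (Fin n)) :
    DD A (zeta A η) x = cst n • η x := by
  have hc : HasCompactSupport η := by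
    apply HasCompactSupport.intro (isCompact_closedBall 0 2)
    intro z hz
    rw [mem_closedBall_zero_iff, not_le] at hz
    exact hs z hz.le
  rw [← fund n hn A hA hη hc x, DD]
  refine Finset.sum_congr rfl fun i _ => ?_
  have h : HasFDerivAt (zeta A η) (∑ j, (A j).comp (fderiv ℝ (fun x => ∫ y, dk n j y • η (x - y)) x)) x := by
    unfold zeta
    apply HasFDerivAt.fun_sum
    intro j _
    exact (A j).hasFDerivAt.comp x
      (((zeta_j hn j hη hs).1.differentiable (by simp)) x).hasFDerivAt
  rw [h.fderiv]
  simp [(zeta_j hn _ hη hs).2]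

theorem zeta_G (hn : 3 ≤ n) (A : Fin n → V →L[ℝ] V) {η : EuclideanSpace ℝ (Fin n) → V}
    (hs : ∀ z, 2 ≤ ‖z‖ → η z = 0) (s : ℝ) (hs0 : 0 < s) (x : EuclideanSpace ℝ (Fin n)) :
    zeta A η (s⁻¹ • x) = s ^ ((n : ℝ) - 1) • Gf A η s x := by
  unfold zeta Gf
  rw [Finset.smul_sum]
  refine Finset.sum_congr rfl fun j _ => ?_
  rw [← map_smul]
  congr 1
  rw [setIntegral_eq_integral_of_forall_compl_eq_zero, ← integral_smul,
    ← integral_sub_left_eq_self _ _ (s⁻¹ • x)]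
  · congr 1
    ext y
    have : s⁻¹ • x - y = s⁻¹ • (x - s • y) := by
      rw [smul_sub, inv_smul_smul₀ hs0.ne']
    rw [sub_sub_cancel, this, dk_smul n hn j s hs0, one_smul, smul_smul]
  · intro y hy
    rw [mem_closedBall_zero_iff, not_le] at hy
    rw [hs y hy.le]; simp

theorem G_smooth (A : Fin n → V →L[ℝ] V) {η : EuclideanSpace ℝ (Fin n) → V}
    (hη : ContDiff ℝ (⊤ : ℕ∞) η) (r : ℝ) (hr : 0 < r) :
    ContDiffOn ℝ (⊤ : ℕ∞) (Function.uncurry (Gf A η)) (Ioo (-(r / 3)) (r / 3) ×ˢ {x | r < ‖x‖}) := by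
  have : Function.uncurry (Gf A η) = fun p : ℝ × EuclideanSpace ℝ (Fin n) =>
      ∑ j, A j (∫ y in closedBall (0 : EuclideanSpace ℝ (Fin n)) 2,
    (1 : ℝ) • (fun (y : EuclideanSpace ℝ (Fin n)) (p : ℝ × EuclideanSpace ℝ (Fin n)) =>
      (dk n j (p.2 - p.1 • y) • η y)) y p) := by
    ext p; rfl
  rw [this]
  apply ContDiffOn.sum
  intro j _
  apply (A j).contDiff.comp_contDiffOn
  apply param_smooth volume (isCompact_closedBall (0 : EuclideanSpace ℝ (Fin n)) 2)
    (isOpen_ball (x := (0 : EuclideanSpace ℝ (Fin n))) (ε := 3))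
    (closedBall_subset_ball (by norm_num))
    (isOpen_Ioo.prod (isOpen_lt continuous_const continuous_norm))
    (integrableOn_const (by exact (isCompact_closedBall _ _).measure_lt_top.ne))
  apply ContDiffOn.smul
  · apply (dk_contDiffOn n j).comp (t := {0}ᶜ)
      (f := fun q : EuclideanSpace ℝ (Fin n) × (ℝ × EuclideanSpace ℝ (Fin n)) => q.2.2 - q.2.1 • q.1)
    · apply ContDiff.contDiffOn
      fun_prop
    · rintro ⟨y, s, x⟩ ⟨hy, hs, hx⟩
      simp only [mem_ball_zero_iff, mem_Ioo, mem_setOf_eq] at hy hs hx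
      have h1 : |s| < r / 3 := abs_lt.2 hs
      simp only [mem_compl_iff, mem_singleton_iff, sub_eq_zero]
      intro h
      rw [h, norm_smul, Real.norm_eq_abs] at hx
      have : |s| * ‖y‖ ≤ r / 3 * 3 := by gcongr
      linarith
  · exact (hη.comp contDiff_fst).contDiffOn

end

section
variable {n : ℕ} {V : Type*} [NormedAddCommGroup V] [NormedSpace ℝ V]

theorem rpow_int {p : ℝ} (hp : -1 < p) {a : ℝ} (ha : 0 ≤ a) :
    IntegrableOn (fun u : ℝ => u ^ p) (Icc 0 a) volume :=
  (intervalIntegrable_iff_integrableOn_Icc_of_le ha).1 (intervalIntegral.intervalIntegrable_rpow' hp)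

theorem param_DD [CompleteSpace V] (A : Fin n → V →L[ℝ] V)
    {K O : Set ℝ} (hK : IsCompact K) (hO : IsOpen O) (hKO : K ⊆ O)
    {S : Set (EuclideanSpace ℝ (Fin n))}
    (hS : IsOpen S) {f : ℝ → ℝ} (hf : IntegrableOn f K volume)
    {H : ℝ → EuclideanSpace ℝ (Fin n) → V}
    (hH : ContDiffOn ℝ (⊤ : ℕ∞) (Function.uncurry H) (O ×ˢ S))
    {x : EuclideanSpace ℝ (Fin n)} (hx : x ∈ S) :
    DD A (fun x => ∫ t in K, f t • H t x) x = ∫ t in K, f t • DD A (H t) x := by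
  obtain ⟨-, i2, h⟩ := param_hasFDerivAt volume hK hO hKO hS hf hH hx
  have i3 : ∀ i : Fin n, IntegrableOn (fun t => f t • fderiv ℝ (H t) x (EuclideanSpace.single i 1)) K :=
    fun i => (ContinuousLinearMap.apply ℝ V (EuclideanSpace.single i (1 : ℝ))).integrable_comp i2
  simp only [DD, h.fderiv, Finset.smul_sum]
  rw [integral_finsetSum]
  · refine Finset.sum_congr rfl fun i _ => ?_
    rw [ContinuousLinearMap.integral_apply i2]
    simp only [ContinuousLinearMap.smul_apply]
    rw [← (A i).integral_comp_comm (i3 i)]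
    simp only [map_smul]
  · intro i _
    have := (A i).integrable_comp (i3 i)
    simpa only [map_smul] using this

theorem DD_scale (A : Fin n → V →L[ℝ] V) {f : EuclideanSpace ℝ (Fin n) → V}
    (hf : Differentiable ℝ f) (u : ℝ) (x : EuclideanSpace ℝ (Fin n)) :
    DD A (fun x => f (u • x)) x = u • DD A f (u • x) := by
  have h : HasFDerivAt (fun x => f (u • x)) _ x :=
    (hf (u • x)).hasFDerivAt.comp x ((hasFDerivAt_id x).const_smul u)
  simp [DD, h.fderiv, Finset.smul_sum]

theorem DD_smul (A : Fin n → V →L[ℝ] V) {f : EuclideanSpace ℝ (Fin n) → V}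
    {x : EuclideanSpace ℝ (Fin n)} (hf : DifferentiableAt ℝ f x) (c : ℝ) :
    DD A (fun x => c • f x) x = c • DD A f x := by
  have h : HasFDerivAt (fun x => c • f x) _ x := hf.hasFDerivAt.const_smul c
  simp [DD, h.fderiv, Finset.smul_sum]

theorem DD_add (A : Fin n → V →L[ℝ] V) {f g : EuclideanSpace ℝ (Fin n) → V}
    {x : EuclideanSpace ℝ (Fin n)} (hf : DifferentiableAt ℝ f x) (hg : DifferentiableAt ℝ g x) :
    DD A (fun x => f x + g x) x = DD A f x + DD A g x := by
  have h : HasFDerivAt (fun x => f x + g x) _ x := hf.hasFDerivAt.add hg.hasFDerivAt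
  simp [DD, h.fderiv, Finset.sum_add_distrib]

/-- unnormalised solution -/
noncomputable def bet (A : Fin n → V →L[ℝ] V) (η : EuclideanSpace ℝ (Fin n) → V) (k : ℝ)
    (x : EuclideanSpace ℝ (Fin n)) : V :=
  ∫ u in Ioi (0 : ℝ), u ^ (-k - 2) • zeta A η (u • x)

theorem bet_hom (A : Fin n → V →L[ℝ] V) (η : EuclideanSpace ℝ (Fin n) → V) (k : ℝ)
    (s : ℝ) (hs : 0 < s) (x : EuclideanSpace ℝ (Fin n)) :
    bet A η k (s • x) = s ^ (k + 1) • bet A η k x := by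
  unfold bet
  have h := integral_comp_mul_left_Ioi' (fun u : ℝ => u ^ (-k - 2) • zeta A η (u • x)) 0 hs
  rw [mul_zero] at h
  rw [← h, smul_smul, ← integral_smul]
  apply setIntegral_congr_fun measurableSet_Ioi
  intro u hu
  have hu' : 0 < u := hu
  simp only
  rw [Real.mul_rpow hs.le hu'.le, smul_smul, smul_smul, mul_comm s u]
  congr 1
  have : s ^ (k + 1) * s * s ^ (-k - 2) = 1 := by
    nth_rewrite 2 [← Real.rpow_one s]
    rw [← Real.rpow_add hs, ← Real.rpow_add hs]
    have : k + 1 + 1 + (-k - 2) = 0 := by ring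
    rw [this, Real.rpow_zero]
  rw [← mul_assoc, this, one_mul]

theorem zeta_param (hn : 3 ≤ n) (A : Fin n → V →L[ℝ] V) {η : EuclideanSpace ℝ (Fin n) → V}
    (hη : ContDiff ℝ (⊤ : ℕ∞) η) (hs : ∀ z, 2 ≤ ‖z‖ → η z = 0) (S : Set (EuclideanSpace ℝ (Fin n))) :
    ContDiffOn ℝ (⊤ : ℕ∞) (Function.uncurry (fun (u : ℝ) (x : EuclideanSpace ℝ (Fin n)) =>
      zeta A η (u • x))) (univ ×ˢ S) :=
  ((zeta_smooth hn A hη hs).comp (contDiff_fst.smul contDiff_snd)).contDiffOn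

theorem isOpen_S (r : ℝ) : IsOpen {x : EuclideanSpace ℝ (Fin n) | r < ‖x‖} :=
  isOpen_lt continuous_const continuous_norm

theorem Icc_sub {r : ℝ} (hr : 0 < r) : Icc 0 (r / 4) ⊆ Ioo (-(r / 3)) (r / 3) := by
  intro s hs
  exact ⟨by linarith [hs.1], by linarith [hs.2]⟩

theorem bet_split (hn : 3 ≤ n) (A : Fin n → V →L[ℝ] V) {η : EuclideanSpace ℝ (Fin n) → V}
    (hη : ContDiff ℝ (⊤ : ℕ∞) η) (hs : ∀ z, 2 ≤ ‖z‖ → η z = 0) (k : ℝ)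
    (hk₁ : -(n : ℝ) < k) (hk₂ : k < -1) (r : ℝ) (hr : 0 < r)
    (x : EuclideanSpace ℝ (Fin n)) (hx : r < ‖x‖) :
    bet A η k x = (∫ u in Icc 0 (r / 4)⁻¹, u ^ (-k - 2) • zeta A η (u • x)) +
      ∫ s in Icc 0 (r / 4), s ^ (k + n - 1) • Gf A η s x := by
  set a := r / 4 with ha
  have ha0 : 0 < a := by positivity
  obtain ⟨i1, -, -⟩ := param_hasFDerivAt volume (isCompact_Icc (a := (0 : ℝ)) (b := a⁻¹))
    isOpen_univ (subset_univ _) (isOpen_S r) (rpow_int (p := -k - 2) (by linarith) (by positivity))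
    (zeta_param hn A hη hs {x | r < ‖x‖}) hx
  obtain ⟨i2, -, -⟩ := param_hasFDerivAt volume (isCompact_Icc (a := (0 : ℝ)) (b := a))
    isOpen_Ioo (Icc_sub hr) (isOpen_S r) (rpow_int (p := k + n - 1) (by linarith) ha0.le)
    (G_smooth A hη r hr) hx
  set F : ℝ → V := fun u => u ^ (-k - 2) • zeta A η (u • x) with hF
  set g : ℝ → V := (Ioi a⁻¹).indicator F with hg
  have key : ∀ s ∈ Ioi (0 : ℝ), (|(-1 : ℝ)| * s ^ ((-1 : ℝ) - 1)) • g (s ^ (-1 : ℝ)) =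
      (Iio a).indicator (fun s => s ^ (k + n - 1) • Gf A η s x) s := by
    intro s hs1
    have hs0 : 0 < s := hs1
    rw [Real.rpow_neg_one]
    by_cases h : s < a
    · have h1 : s⁻¹ ∈ Ioi a⁻¹ := (inv_lt_inv₀ ha0 hs0).2 h
      rw [hg, indicator_of_mem h1, indicator_of_mem (show s ∈ Iio a from h), hF]
      simp only
      rw [zeta_G hn A hs s hs0, smul_smul, smul_smul, abs_neg, abs_one, one_mul,
        Real.inv_rpow hs0.le, ← Real.rpow_neg hs0.le, ← Real.rpow_add hs0, ← Real.rpow_add hs0]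
      congr 2; ring
    · have h1 : s⁻¹ ∉ Ioi a⁻¹ := by
        intro h2; exact h ((inv_lt_inv₀ ha0 hs0).1 h2)
      rw [hg, indicator_of_notMem h1, indicator_of_notMem (show s ∉ Iio a from h), smul_zero]
  have hset : Ioi (0 : ℝ) ∩ Iio a = Ioo 0 a := Ioi_inter_Iio
  have i3 : IntegrableOn g (Ioi 0) := by
    rw [← integrableOn_Ioi_comp_rpow_iff g (p := -1) (by norm_num)]
    rw [integrableOn_congr_fun key measurableSet_Ioi, IntegrableOn, integrable_indicator_iff measurableSet_Iio,
      IntegrableOn, Measure.restrict_restrict measurableSet_Iio, inter_comm, hset]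
    exact i2.mono_set Ioo_subset_Icc_self
  have e3 : ∫ u in Ioi (0 : ℝ), g u = ∫ s in Icc 0 a, s ^ (k + n - 1) • Gf A η s x := by
    rw [← integral_comp_rpow_Ioi g (p := -1) (by norm_num),
      setIntegral_congr_fun measurableSet_Ioi key, setIntegral_indicator measurableSet_Iio, hset,
      integral_Icc_eq_integral_Ioo]
  have hpos : (0 : ℝ) ≤ a⁻¹ := by positivity
  have hsub : Ioi a⁻¹ ⊆ Ioi (0 : ℝ) := Ioi_subset_Ioi hpos
  have e4 : ∫ u in Ioi (0 : ℝ), g u = ∫ u in Ioi a⁻¹, F u := by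
    rw [setIntegral_indicator measurableSet_Ioi, inter_eq_right.2 hsub]
  have i4 : IntegrableOn F (Ioi a⁻¹) := by
    have := i3.mono_set hsub
    rwa [integrableOn_congr_fun (g := F) (fun u hu => indicator_of_mem hu F) measurableSet_Ioi] at this
  rw [← e3, e4, integral_Icc_eq_integral_Ioc, bet, ← Ioc_union_Ioi_eq_Ioi hpos]
  exact setIntegral_union (Ioc_disjoint_Ioi le_rfl) measurableSet_Ioi
    (i1.mono_set Ioc_subset_Icc_self) i4

theorem bet_main (hn : 3 ≤ n) [CompleteSpace V] (A : Fin n → V →L[ℝ] V)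
    (hA : ∀ i j (ψ : V), A i (A j ψ) + A j (A i ψ) = if i = j then (-2 : ℝ) • ψ else 0)
    {η : EuclideanSpace ℝ (Fin n) → V}
    (hη : ContDiff ℝ (⊤ : ℕ∞) η) (hs : ∀ z, 2 ≤ ‖z‖ → η z = 0) (k : ℝ)
    (hk₁ : -(n : ℝ) < k) (hk₂ : k < -1) (x : EuclideanSpace ℝ (Fin n)) (hx : x ≠ 0) :
    ContDiffAt ℝ (⊤ : ℕ∞) (bet A η k) x ∧
    DD A (bet A η k) x = ∫ u in Ioi (0 : ℝ), u ^ (-k - 2) • u • cst n • η (u • x) := by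
  have hx0 : 0 < ‖x‖ := norm_pos_iff.2 hx
  obtain ⟨r, hr, hrx⟩ : ∃ r, 0 < r ∧ r < ‖x‖ := exists_between hx0
  have hnh : {x : EuclideanSpace ℝ (Fin n) | r < ‖x‖} ∈ 𝓝 x := (isOpen_S r).mem_nhds hrx
  set a := r / 4 with ha
  have ha0 : 0 < a := by positivity
  have w1 := rpow_int (p := -k - 2) (by linarith) (a := a⁻¹) (by positivity)
  have w2 := rpow_int (p := k + n - 1) (by linarith) ha0.le
  have c1 := (param_smooth volume (isCompact_Icc (a := (0 : ℝ)) (b := a⁻¹))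
    isOpen_univ (subset_univ _) (isOpen_S r) w1
    (zeta_param hn A hη hs {x | r < ‖x‖})).contDiffAt hnh
  have c2 := (param_smooth volume (isCompact_Icc (a := (0 : ℝ)) (b := a))
    isOpen_Ioo (Icc_sub hr) (isOpen_S r) w2
    (G_smooth A hη r hr)).contDiffAt hnh
  have heq : bet A η k =ᶠ[𝓝 x] fun x => (∫ u in Icc 0 a⁻¹, u ^ (-k - 2) • zeta A η (u • x)) +
      ∫ s in Icc 0 a, s ^ (k + n - 1) • Gf A η s x := by
    filter_upwards [hnh] with y hy using bet_split hn A hη hs k hk₁ hk₂ r hr y hy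
  refine ⟨(c1.add c2).congr_of_eventuallyEq heq, ?_⟩
  have hz := (zeta_smooth hn A hη hs).differentiable (by simp)
  have h1 : DD A (bet A η k) x =
      DD A (fun x => ∫ u in Icc 0 a⁻¹, u ^ (-k - 2) • zeta A η (u • x)) x +
      DD A (fun x => ∫ s in Icc 0 a, s ^ (k + n - 1) • Gf A η s x) x := by
    rw [← DD_add A (c1.differentiableAt (by simp)) (c2.differentiableAt (by simp))]
    unfold DD
    rw [heq.fderiv_eq]
  rw [h1, param_DD A isCompact_Icc isOpen_univ (subset_univ _) (isOpen_S r) w1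
    (zeta_param hn A hη hs {x | r < ‖x‖}) hrx, param_DD A isCompact_Icc 
    isOpen_Ioo (Icc_sub hr) (isOpen_S r) w2 (G_smooth A hη r hr) hrx]
  have z2 : ∫ s in Icc 0 a, s ^ (k + n - 1) • DD A (Gf A η s) x = 0 := by
    rw [integral_Icc_eq_integral_Ioc]
    apply setIntegral_eq_zero_of_forall_eq_zero
    intro s hs1
    have hs0 : 0 < s := hs1.1
    have : Gf A η s = fun x => (s ^ ((n : ℝ) - 1))⁻¹ • (fun x => zeta A η (s⁻¹ • x)) x := by
      ext y
      simp only
      rw [zeta_G hn A hs s hs0, inv_smul_smul₀ (by positivity)]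
    rw [this, DD_smul A (f := fun x => zeta A η (s⁻¹ • x))
        (hz.comp (differentiable_id.const_smul s⁻¹)).differentiableAt,
      DD_scale A hz, zeta_dirac hn A hA hη hs, hs]
    · simp
    · rw [norm_smul, norm_inv, Real.norm_of_nonneg hs0.le, inv_mul_eq_div, le_div_iff₀ hs0]
      linarith [hs1.2]
  rw [z2, add_zero, integral_Icc_eq_integral_Ioc]
  have hpos : (0 : ℝ) ≤ a⁻¹ := by positivity
  have e5 : ∀ u : ℝ, u ^ (-k - 2) • DD A (fun x => zeta A η (u • x)) x =
      u ^ (-k - 2) • u • cst n • η (u • x) := by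
    intro u
    rw [DD_scale A hz, zeta_dirac hn A hA hη hs]
  simp only [e5]
  apply (setIntegral_eq_of_subset_of_forall_diff_eq_zero measurableSet_Ioi
    Ioc_subset_Ioi_self _).symm
  rintro u ⟨hu0, hu1⟩
  have hu0' : 0 < u := hu0
  have hu2 : a⁻¹ < u := by
    by_contra h
    exact hu1 ⟨hu0, not_lt.1 h⟩
  rw [hs, smul_zero, smul_zero, smul_zero]
  rw [norm_smul, Real.norm_of_nonneg hu0'.le]
  have h3 : a⁻¹ * r ≤ u * ‖x‖ := by gcongr
  have h4 : a⁻¹ * r = 4 := by rw [ha]; field_simp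
  linarith

/-- radial bump -/
noncomputable def bb : ContDiffBump (2 : ℝ) := ⟨1 / 2, 1, by norm_num, by norm_num⟩

theorem bb_zero {t : ℝ} (h : 1 ≤ |t - 2|) : bb t = 0 :=
  bb.zero_of_le_dist (by rw [Real.dist_eq]; exact h)

theorem eta_smooth {α : EuclideanSpace ℝ (Fin n) → V} (hα : ContDiffOn ℝ (⊤ : ℕ∞) α {0}ᶜ) :
    ContDiff ℝ (⊤ : ℕ∞) (fun x => bb (‖x‖ ^ 2) • α x) := by
  rw [contDiff_iff_contDiffAt]
  intro x
  by_cases hx : x = 0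
  · subst hx
    have : (fun x => bb (‖x‖ ^ 2) • α x) =ᶠ[𝓝 0] fun _ => 0 := by
      have hb : ball (0 : EuclideanSpace ℝ (Fin n)) 1 ∈ 𝓝 0 := ball_mem_nhds _ one_pos
      filter_upwards [hb] with y hy
      rw [mem_ball_zero_iff] at hy
      have h2 : ‖y‖ ^ 2 ≤ 1 := by nlinarith [norm_nonneg y]
      rw [bb_zero, zero_smul]
      rw [abs_sub_comm]
      exact le_trans (by linarith) (le_abs_self _)
    exact contDiffAt_const.congr_of_eventuallyEq this
  · apply ContDiffAt.smul
    · exact (bb.contDiff.comp (contDiff_norm_sq ℝ)).contDiffAt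
    · exact hα.contDiffAt (isOpen_compl_singleton.mem_nhds hx)

/-- second constant -/
noncomputable def cst2 : ℝ := ∫ u in Ioi (0 : ℝ), u⁻¹ * bb (u ^ 2)

theorem cst2_pos : 0 < cst2 := by
  unfold cst2
  have hz : ∀ u ∈ Ioi (0 : ℝ) \ Icc 1 2, u⁻¹ * bb (u ^ 2) = 0 := by
    rintro u ⟨hu0, hu⟩
    have hu0' : 0 < u := hu0
    rw [bb_zero, mul_zero]
    by_cases h : u < 1
    · rw [abs_sub_comm]
      exact le_trans (by nlinarith) (le_abs_self _)
    · have : 2 < u := by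
        by_contra h2
        exact hu ⟨not_lt.1 h, not_lt.1 h2⟩
      exact le_trans (by nlinarith) (le_abs_self _)
  have hi : IntegrableOn (fun u : ℝ => u⁻¹ * bb (u ^ 2)) (Ioi 0) := by
    apply IntegrableOn.of_forall_diff_eq_zero (s := Icc 1 2) _ measurableSet_Ioi hz
    apply ContinuousOn.integrableOn_Icc
    apply ContinuousOn.mul
    · apply continuousOn_inv₀.mono
      intro u hu
      have := hu.1
      simp; intro h; linarith
    · exact (bb.continuous.comp (continuous_pow 2)).continuousOn
  rw [setIntegral_pos_iff_support_of_nonneg_ae _ hi]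
  · have hsub : Ioo (1.3 : ℝ) 1.5 ⊆ (Function.support fun u : ℝ => u⁻¹ * bb (u ^ 2)) ∩ Ioi 0 := by
      intro u hu
      have h0 : 0 < u := by linarith [hu.1]
      refine ⟨?_, h0⟩
      rw [Function.mem_support, bb.one_of_mem_closedBall]
      · positivity
      · rw [mem_closedBall, Real.dist_eq, abs_le]
        change -(1 / 2) ≤ u ^ 2 - 2 ∧ u ^ 2 - 2 ≤ 1 / 2
        constructor <;> nlinarith [hu.1, hu.2]
    refine lt_of_lt_of_le ?_ (measure_mono hsub)
    simp; norm_num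
  · filter_upwards [ae_restrict_mem measurableSet_Ioi] with u hu
    have : 0 < u := hu
    have := bb.nonneg (x := u ^ 2)
    simp only [Pi.zero_apply]; positivity

theorem real_main (hn : 3 ≤ n) [CompleteSpace V] (A : Fin n → V →L[ℝ] V)
    (hA : ∀ i j (ψ : V), A i (A j ψ) + A j (A i ψ) = if i = j then (-2 : ℝ) • ψ else 0)
    (k : ℝ) (hk₁ : -(n : ℝ) < k) (hk₂ : k < -1)
    (α : EuclideanSpace ℝ (Fin n) → V)
    (hα : ContDiffOn ℝ (⊤ : ℕ∞) α {0}ᶜ)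
    (hhom : ∀ s : ℝ, 0 < s → ∀ x : EuclideanSpace ℝ (Fin n), x ≠ 0 →
      α (s • x) = s ^ k • α x) :
    ∃ β : EuclideanSpace ℝ (Fin n) → V,
      ContDiffOn ℝ (⊤ : ℕ∞) β {0}ᶜ ∧
      (∀ s : ℝ, 0 < s → ∀ x : EuclideanSpace ℝ (Fin n), x ≠ 0 →
        β (s • x) = s ^ (k + 1) • β x) ∧
      (∀ x : EuclideanSpace ℝ (Fin n), x ≠ 0 → DD A β x = α x) := by
  set η : EuclideanSpace ℝ (Fin n) → V := fun x => bb (‖x‖ ^ 2) • α x with hηd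
  have hη : ContDiff ℝ (⊤ : ℕ∞) η := eta_smooth hα
  have hs : ∀ z, 2 ≤ ‖z‖ → η z = 0 := by
    intro z hz
    rw [hηd]
    simp only
    rw [bb_zero, zero_smul]
    exact le_trans (by nlinarith) (le_abs_self _)
  have main := bet_main hn A hA hη hs k hk₁ hk₂
  refine ⟨fun x => (cst n * cst2)⁻¹ • bet A η k x, ?_, ?_, ?_⟩
  · intro x hx
    exact (contDiffAt_const.smul (main x hx).1).contDiffWithinAt
  · intro s hs0 x _
    simp only
    rw [bet_hom A η k s hs0, smul_comm]
  · intro x hx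
    have hx0 : 0 < ‖x‖ := norm_pos_iff.2 hx
    rw [DD_smul A ((main x hx).1.differentiableAt (by simp)), (main x hx).2]
    have e : ∀ u ∈ Ioi (0 : ℝ), u ^ (-k - 2) • u • cst n • η (u • x) =
        (‖x‖ * ((‖x‖ * u)⁻¹ * bb ((‖x‖ * u) ^ 2))) • (cst n • α x) := by
      intro u hu
      have hu0 : 0 < u := hu
      rw [hηd]
      simp only
      rw [hhom u hu0 x hx, norm_smul, Real.norm_of_nonneg hu0.le, mul_comm u ‖x‖]
      simp only [smul_smul]
      congr 1
      have h1 : u ^ (-k - 2) * u * u ^ k = u⁻¹ := by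
        nth_rewrite 2 [← Real.rpow_one u]
        rw [← Real.rpow_add hu0, ← Real.rpow_add hu0, ← Real.rpow_neg_one]
        congr 1; ring
      rw [mul_inv]
      calc _ = (u ^ (-k - 2) * u * u ^ k) * bb ((‖x‖ * u) ^ 2) * cst n := by ring
        _ = _ := by rw [h1]; field_simp
    rw [setIntegral_congr_fun measurableSet_Ioi e, integral_smul_const]
    have h := integral_comp_mul_left_Ioi' (fun u : ℝ => u⁻¹ * bb (u ^ 2)) 0 hx0
    rw [mul_zero, smul_eq_mul, ← integral_const_mul] at h
    rw [h]
    change _ • cst2 • cst n • α x = _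
    rw [smul_smul cst2, smul_smul, mul_comm cst2,
      inv_mul_cancel₀ (mul_ne_zero (cst_ne n hn) cst2_pos.ne'), one_smul]

end

end

/-- For a smooth spinor field `α` on `ℝⁿ \ {0}` homogeneous of order
`k ∈ (-n, -1)`, there is a smooth spinor field `β` homogeneous of order
`k + 1` with `Dβ = α` on `ℝⁿ \ {0}`. -/
theorem stmt6 (n : ℕ) (hn : 3 ≤ n) (V : Type*) [NormedAddCommGroup V]
    [InnerProductSpace ℂ V] [FiniteDimensional ℂ V] [Nontrivial V]
    (γ : Fin n → V →ₗ[ℂ] V)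
    (hcl : ∀ i j (ψ : V), γ i (γ j ψ) + γ j (γ i ψ) =
      if i = j then (-2 : ℂ) • ψ else 0)
    (hsk : ∀ i (φ ψ : V), ⟪γ i φ, ψ⟫_ℂ = -⟪φ, γ i ψ⟫_ℂ)
    (k : ℝ) (hk₁ : -(n : ℝ) < k) (hk₂ : k < -1)
    (α : EuclideanSpace ℝ (Fin n) → V)
    (hα : ContDiffOn ℝ (⊤ : ℕ∞) α {0}ᶜ)
    (hhom : ∀ s : ℝ, 0 < s → ∀ x : EuclideanSpace ℝ (Fin n), x ≠ 0 →
      α (s • x) = s ^ k • α x) :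
    ∃ β : EuclideanSpace ℝ (Fin n) → V,
      ContDiffOn ℝ (⊤ : ℕ∞) β {0}ᶜ ∧
      (∀ s : ℝ, 0 < s → ∀ x : EuclideanSpace ℝ (Fin n), x ≠ 0 →
        β (s • x) = s ^ (k + 1) • β x) ∧
      (∀ x : EuclideanSpace ℝ (Fin n), x ≠ 0 → dirac γ β x = α x) := by
  haveI : CompleteSpace V := FiniteDimensional.complete ℂ V
  exact real_main hn
    (fun i => ((γ i).toContinuousLinearMap).restrictScalars ℝ) (by
      intro i j ψ
      have h := hcl i j ψ
      have e : (-2 : ℂ) • ψ = (-2 : ℝ) • ψ := by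
        rw [← Complex.coe_smul]; norm_num
      rw [e] at h
      exact h) k hk₁ hk₂ α hα hhom
end

section
/- Let k ∈ (-n, -1) and let α : ℝⁿ\{0} → V be a smooth spinor field homogeneous of order k. Then for every x ≠ 0 the principal value integral β(x) := ω_{n-1}^{-1} · lim_{ρ→0⁺} ∫_{ℝⁿ \ (B(x,ρ) ∪ B(0,ρ))} |x-y|^{-n} γ(x-y)(α(y)) dy exists in V; here the integrand is absolutely integrable near infinity because k < -1, and the limit as ρ → 0⁺ exists because k > -n. -/
open MeasureTheory Metric Filter
open scoped InnerProductSpace Topology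

lemma aux_ball {n : ℕ} (hn : 3 ≤ n) (s r : ℝ) (hs : -(n:ℝ) < s) (hr : 0 < r) :
    Integrable (fun y : EuclideanSpace ℝ (Fin n) =>
      (Set.Iio r).indicator (fun t : ℝ => t ^ s) ‖y‖) volume := by
  have : Nonempty (Fin n) := ⟨⟨0, by omega⟩⟩
  have : Nontrivial (EuclideanSpace ℝ (Fin n)) := inferInstance
  have h := integrable_fun_norm_addHaar (volume : Measure (EuclideanSpace ℝ (Fin n)))
    (f := (Set.Iio r).indicator (fun t : ℝ => t ^ s))
  rw [h]
  have hd : Module.finrank ℝ (EuclideanSpace ℝ (Fin n)) = n := by simp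
  rw [hd]
  have h1 : IntegrableOn (fun t : ℝ => t ^ ((n:ℝ) - 1 + s)) (Set.Ioo 0 r) := by
    rw [intervalIntegral.integrableOn_Ioo_rpow_iff hr]
    linarith
  have h2 : IntegrableOn ((Set.Iio r).indicator (fun t : ℝ => t ^ ((n:ℝ) - 1 + s)))
      (Set.Ioi 0) := by
    rw [integrableOn_indicator_iff measurableSet_Iio]
    exact h1.mono_set (fun t ht => ⟨ht.2, ht.1⟩)
  refine h2.congr_fun (fun t ht => ?_) measurableSet_Ioi
  have ht : 0 < t := ht
  by_cases h : t < r
  · simp only [Set.indicator, Set.mem_Iio, h, if_true, smul_eq_mul]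
    rw [Real.rpow_add ht, ← Real.rpow_natCast, Nat.cast_sub (by omega), Nat.cast_one]
  · simp [Set.indicator, h]

lemma aux_cliff {n : ℕ} {V : Type*} [NormedAddCommGroup V]
    [NormedSpace ℂ V] [FiniteDimensional ℂ V] (γ : Fin n → V →ₗ[ℂ] V) :
    ∃ C : ℝ, 0 ≤ C ∧ ∀ v ψ, ‖cliffordMul γ v ψ‖ ≤ C * ‖v‖ * ‖ψ‖ := by
  refine ⟨∑ i, ‖(γ i).toContinuousLinearMap‖, Finset.sum_nonneg fun i _ => norm_nonneg _, ?_⟩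
  intro v ψ
  unfold cliffordMul
  refine (norm_sum_le _ _).trans ?_
  rw [Finset.sum_mul, Finset.sum_mul]
  refine Finset.sum_le_sum fun i _ => ?_
  rw [norm_smul]
  have h1 : ‖v i‖ ≤ ‖v‖ := PiLp.norm_apply_le v i
  have h2 : ‖γ i ψ‖ ≤ ‖(γ i).toContinuousLinearMap‖ * ‖ψ‖ :=
    (γ i).toContinuousLinearMap.le_opNorm ψ
  calc ‖v i‖ * ‖γ i ψ‖ ≤ ‖v‖ * (‖(γ i).toContinuousLinearMap‖ * ‖ψ‖) := by gcongr
    _ = _ := by ring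

lemma aux_hom {n : ℕ} {V : Type*} [NormedAddCommGroup V] [NormedSpace ℝ V] (k : ℝ)
    (α : EuclideanSpace ℝ (Fin n) → V) (hα : ContinuousOn α {0}ᶜ)
    (hhom : ∀ s : ℝ, 0 < s → ∀ x : EuclideanSpace ℝ (Fin n), x ≠ 0 →
      α (s • x) = s ^ k • α x) :
    ∃ M : ℝ, 0 ≤ M ∧ ∀ y, y ≠ 0 → ‖α y‖ ≤ M * ‖y‖ ^ k := by
  obtain ⟨M, hM⟩ := (isCompact_sphere (0 : EuclideanSpace ℝ (Fin n)) 1).exists_bound_of_continuousOn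
    (hα.mono (fun y hy => by
      rintro rfl
      simp at hy))
  refine ⟨max M 0, le_max_right _ _, fun y hy => ?_⟩
  have hy' : 0 < ‖y‖ := norm_pos_iff.2 hy
  have h1 : ‖y‖⁻¹ • y ≠ 0 := smul_ne_zero (inv_ne_zero hy'.ne') hy
  have h2 := hhom ‖y‖ hy' _ h1
  rw [smul_inv_smul₀ hy'.ne'] at h2
  rw [h2, norm_smul, Real.norm_of_nonneg (Real.rpow_nonneg hy'.le _), mul_comm]
  gcongr
  refine (hM _ ?_).trans (le_max_left _ _)
  simp [norm_smul, hy'.ne']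

lemma aux_int_s7 {n : ℕ} (hn : 3 ≤ n) {V : Type*} [NormedAddCommGroup V]
    [InnerProductSpace ℂ V] [FiniteDimensional ℂ V]
    (γ : Fin n → V →ₗ[ℂ] V)
    (k : ℝ) (hk₁ : -(n : ℝ) < k) (hk₂ : k < -1)
    (α : EuclideanSpace ℝ (Fin n) → V)
    (hα : ContinuousOn α {0}ᶜ)
    (hhom : ∀ s : ℝ, 0 < s → ∀ x : EuclideanSpace ℝ (Fin n), x ≠ 0 →
      α (s • x) = s ^ k • α x) (x : EuclideanSpace ℝ (Fin n)) (hx : x ≠ 0) :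
    Integrable (fun y => (‖x - y‖ ^ n)⁻¹ • cliffordMul γ (x - y) (α y)) volume := by
  have : Nonempty (Fin n) := ⟨⟨0, by omega⟩⟩
  have : Nontrivial (EuclideanSpace ℝ (Fin n)) := inferInstance
  obtain ⟨C, hC0, hC⟩ := aux_cliff γ
  obtain ⟨M, hM0, hM⟩ := aux_hom k α hα hhom
  obtain ⟨r, hr, hxr⟩ : ∃ r : ℝ, 0 < r ∧ ‖x‖ = 2 * r :=
    ⟨‖x‖ / 2, half_pos (norm_pos_iff.2 hx), by ring⟩
  have hn' : (3:ℝ) ≤ n := by exact_mod_cast hn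
  set c : ℝ := r / (3 * (1 + r)) with hc
  have hc0 : 0 < c := by positivity
  have hcr : c * (3 * (1 + r)) = r := by rw [hc]; field_simp
  have hae : ∀ᵐ y : EuclideanSpace ℝ (Fin n), y ∈ ({0, x}ᶜ : Set (EuclideanSpace ℝ (Fin n))) := by
    have : ({0, x} : Set (EuclideanSpace ℝ (Fin n))).Countable := by simp
    exact this.ae_notMem volume
  have hms : MeasurableSet ({0, x}ᶜ : Set (EuclideanSpace ℝ (Fin n))) :=
    (Set.toFinite _).measurableSet.compl
  -- dominating function
  have hg : Integrable (fun y : EuclideanSpace ℝ (Fin n) =>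
      (C * M) * (r ^ (1 - (n:ℝ)) * (Set.Iio r).indicator (fun t : ℝ => t ^ k) ‖y‖
      + r ^ k * (Set.Iio r).indicator (fun t : ℝ => t ^ (1 - (n:ℝ))) ‖x - y‖
      + c ^ (1 - (n:ℝ) + k) * (1 + ‖y‖) ^ (-((n:ℝ) - 1 - k)))) volume := by
    refine Integrable.const_mul (Integrable.add (Integrable.add ?_ ?_) ?_) _
    · exact (aux_ball hn k r hk₁ hr).const_mul _
    · exact ((aux_ball hn (1 - (n:ℝ)) r (by linarith) hr).comp_sub_left x).const_mul _
    · refine (integrable_one_add_norm ?_).const_mul _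
      simp
      linarith
  refine hg.mono' ?_ ?_
  · rw [← Measure.restrict_eq_self_of_ae_mem hae]
    refine ContinuousOn.aestronglyMeasurable ?_ hms
    have hα' : ContinuousOn α {0, x}ᶜ := hα.mono (by
      intro y hy; simp at hy ⊢; exact hy.1)
    have hcn : ContinuousOn (fun y : EuclideanSpace ℝ (Fin n) => ‖x - y‖ ^ n) {0, x}ᶜ := by
      fun_prop
    have hinv : ContinuousOn (fun y : EuclideanSpace ℝ (Fin n) => (‖x - y‖ ^ n)⁻¹) {0, x}ᶜ := by
      refine ContinuousOn.inv₀ hcn ?_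
      intro y hy
      simp at hy
      exact pow_ne_zero _ (norm_ne_zero_iff.2 (sub_ne_zero.2 (Ne.symm hy.2)))
    have hcl : ContinuousOn (fun y => cliffordMul γ (x - y) (α y)) {0, x}ᶜ := by
      unfold cliffordMul
      refine continuousOn_finset_sum _ fun i _ => ?_
      have hi : ContinuousOn (fun y : EuclideanSpace ℝ (Fin n) => (x - y) i) {0, x}ᶜ := by
        fun_prop
      have hj : ContinuousOn (fun y => γ i (α y)) {0, x}ᶜ :=
        (γ i).toContinuousLinearMap.continuous.comp_continuousOn hα'
      exact hi.smul hj
    exact hinv.smul hcl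
  · filter_upwards [hae] with y hy
    simp at hy
    obtain ⟨hy0, hyx⟩ := hy
    have hyp : 0 < ‖y‖ := norm_pos_iff.2 hy0
    have hxy : 0 < ‖x - y‖ := norm_pos_iff.2 (sub_ne_zero.2 (Ne.symm hyx))
    have htri : ‖x‖ ≤ ‖x - y‖ + ‖y‖ := by simpa using norm_add_le (x - y) y
    have htri2 : ‖y‖ ≤ ‖x - y‖ + ‖x‖ := by
      have := norm_sub_le x (x - y)
      simp at this; linarith
    have e1 : ‖(‖x - y‖ ^ n)⁻¹ • cliffordMul γ (x - y) (α y)‖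
        ≤ (C * M) * (‖x - y‖ ^ (1 - (n:ℝ)) * ‖y‖ ^ k) := by
      rw [norm_smul, norm_inv, norm_pow, norm_norm]
      calc (‖x - y‖ ^ n)⁻¹ * ‖cliffordMul γ (x - y) (α y)‖
          ≤ (‖x - y‖ ^ n)⁻¹ * (C * ‖x - y‖ * (M * ‖y‖ ^ k)) := by
            gcongr
            refine (hC _ _).trans ?_
            gcongr
            exact hM y hy0
        _ = _ := by
            rw [Real.rpow_sub hxy, Real.rpow_one, Real.rpow_natCast]
            field_simp
    refine e1.trans ?_
    refine mul_le_mul_of_nonneg_left ?_ (by positivity)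
    have i1 : ∀ s t : ℝ, 0 ≤ t → 0 ≤ (Set.Iio r).indicator (fun t : ℝ => t ^ s) t := by
      intro s t ht
      by_cases h : t < r
      · simp [Set.indicator, h]; positivity
      · simp [Set.indicator, h]
    have p1 : 0 ≤ r ^ (1 - (n:ℝ)) * (Set.Iio r).indicator (fun t : ℝ => t ^ k) ‖y‖ :=
      mul_nonneg (by positivity) (i1 _ _ hyp.le)
    have p2 : 0 ≤ r ^ k * (Set.Iio r).indicator (fun t : ℝ => t ^ (1 - (n:ℝ))) ‖x - y‖ :=
      mul_nonneg (by positivity) (i1 _ _ hxy.le)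
    have p3 : 0 ≤ c ^ (1 - (n:ℝ) + k) * (1 + ‖y‖) ^ (-((n:ℝ) - 1 - k)) := by positivity
    have hn1 : 1 - (n:ℝ) ≤ 0 := by linarith
    have hk0 : k ≤ 0 := by linarith
    by_cases h1 : ‖y‖ < r
    · have : ‖x - y‖ ^ (1 - (n:ℝ)) * ‖y‖ ^ k
          ≤ r ^ (1 - (n:ℝ)) * (Set.Iio r).indicator (fun t : ℝ => t ^ k) ‖y‖ := by
        simp only [Set.indicator, Set.mem_Iio, h1, if_true]
        gcongr ?_ * _
        exact Real.rpow_le_rpow_of_nonpos hr (by linarith) hn1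
      linarith
    · push Not at h1
      by_cases h2 : ‖x - y‖ < r
      · have : ‖x - y‖ ^ (1 - (n:ℝ)) * ‖y‖ ^ k
            ≤ r ^ k * (Set.Iio r).indicator (fun t : ℝ => t ^ (1 - (n:ℝ))) ‖x - y‖ := by
          simp only [Set.indicator, Set.mem_Iio, h2, if_true]
          rw [mul_comm]
          gcongr ?_ * _
          exact Real.rpow_le_rpow_of_nonpos hr h1 hk0
        linarith
      · push Not at h2
        have hb : c * (1 + ‖y‖) ≤ ‖y‖ / 3 := by
          rw [hc, div_mul_eq_mul_div, div_le_div_iff₀ (by positivity) (by norm_num)]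
          nlinarith
        have : ‖x - y‖ ^ (1 - (n:ℝ)) * ‖y‖ ^ k
            ≤ c ^ (1 - (n:ℝ) + k) * (1 + ‖y‖) ^ (-((n:ℝ) - 1 - k)) := by
          have hcy : 0 < c * (1 + ‖y‖) := by positivity
          calc ‖x - y‖ ^ (1 - (n:ℝ)) * ‖y‖ ^ k
              ≤ (c * (1 + ‖y‖)) ^ (1 - (n:ℝ)) * (c * (1 + ‖y‖)) ^ k := by
                gcongr ?_ * ?_
                · exact Real.rpow_le_rpow_of_nonpos hcy (by linarith) hn1
                · exact Real.rpow_le_rpow_of_nonpos hcy (by linarith) hk0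
            _ = _ := by
                rw [← Real.rpow_add hcy, Real.mul_rpow hc0.le (by positivity)]
                congr 2; ring
        linarith

/-- For a smooth spinor field `α` homogeneous of order `k ∈ (-n, -1)`, the
principal value integral
`β(x) = ω_{n-1}⁻¹ lim_{ρ→0⁺} ∫_{ℝⁿ \ (B(x,ρ) ∪ B(0,ρ))} |x-y|^{-n} γ(x-y)(α(y)) dy`
exists for every `x ≠ 0`: the integrand is (absolutely) integrable on the
complement of `B(x,ρ) ∪ B(0,ρ)` for each `ρ > 0`, and the limit as `ρ → 0⁺`
exists. -/
theorem stmt7 (n : ℕ) (hn : 3 ≤ n) (V : Type*) [NormedAddCommGroup V]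
    [InnerProductSpace ℂ V] [FiniteDimensional ℂ V] [Nontrivial V]
    (γ : Fin n → V →ₗ[ℂ] V)
    (hcl : ∀ i j (ψ : V), γ i (γ j ψ) + γ j (γ i ψ) =
      if i = j then (-2 : ℂ) • ψ else 0)
    (hsk : ∀ i (φ ψ : V), ⟪γ i φ, ψ⟫_ℂ = -⟪φ, γ i ψ⟫_ℂ)
    (k : ℝ) (hk₁ : -(n : ℝ) < k) (hk₂ : k < -1)
    (α : EuclideanSpace ℝ (Fin n) → V)
    (hα : ContDiffOn ℝ (⊤ : ℕ∞) α {0}ᶜ)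
    (hhom : ∀ s : ℝ, 0 < s → ∀ x : EuclideanSpace ℝ (Fin n), x ≠ 0 →
      α (s • x) = s ^ k • α x) :
    ∀ x : EuclideanSpace ℝ (Fin n), x ≠ 0 →
      (∀ ρ : ℝ, 0 < ρ →
        IntegrableOn (fun y => (‖x - y‖ ^ n)⁻¹ • cliffordMul γ (x - y) (α y))
          ((ball x ρ ∪ ball 0 ρ)ᶜ) volume) ∧
      ∃ L : V, Tendsto
        (fun ρ : ℝ => (sphereVol n)⁻¹ •
          ∫ y in (ball x ρ ∪ ball 0 ρ)ᶜ,
            (‖x - y‖ ^ n)⁻¹ • cliffordMul γ (x - y) (α y))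
        (𝓝[>] 0) (𝓝 L) := by
  intro x hx
  have hint := aux_int_s7 hn γ k hk₁ hk₂ α hα.continuousOn hhom x hx
  refine ⟨fun ρ _ => hint.integrableOn, ?_⟩
  refine ⟨(sphereVol n)⁻¹ • ∫ y, (‖x - y‖ ^ n)⁻¹ • cliffordMul γ (x - y) (α y),
    Tendsto.const_smul ?_ _⟩
  have : Nonempty (Fin n) := ⟨⟨0, by omega⟩⟩
  have : Nontrivial (EuclideanSpace ℝ (Fin n)) := inferInstance
  have hm : ∀ ρ : ℝ, MeasurableSet ((ball x ρ ∪ ball 0 ρ)ᶜ) := fun ρ =>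
    (measurableSet_ball.union measurableSet_ball).compl
  simp_rw [← integral_indicator (hm _)]
  refine tendsto_integral_filter_of_dominated_convergence
    (fun y => ‖(‖x - y‖ ^ n)⁻¹ • cliffordMul γ (x - y) (α y)‖) ?_ ?_ hint.norm ?_
  · exact Eventually.of_forall fun ρ => hint.aestronglyMeasurable.indicator (hm ρ)
  · exact Eventually.of_forall fun ρ => Eventually.of_forall fun y =>
      norm_indicator_le_norm_self _ _
  · have hae : ∀ᵐ y : EuclideanSpace ℝ (Fin n), y ∉ ({0, x} : Set (EuclideanSpace ℝ (Fin n))) :=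
      (show ({0, x} : Set (EuclideanSpace ℝ (Fin n))).Countable by simp).ae_notMem volume
    filter_upwards [hae] with y hy
    simp at hy
    refine tendsto_const_nhds.congr' ?_
    have h1 : ∀ᶠ ρ : ℝ in 𝓝[>] 0, ρ < dist y x :=
      nhdsWithin_le_nhds (eventually_lt_nhds (dist_pos.2 hy.2))
    have h2 : ∀ᶠ ρ : ℝ in 𝓝[>] 0, ρ < dist y 0 :=
      nhdsWithin_le_nhds (eventually_lt_nhds (dist_pos.2 hy.1))
    filter_upwards [h1, h2] with ρ a b
    rw [Set.indicator_of_mem]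
    simp only [Set.mem_compl_iff, Set.mem_union, mem_ball, not_or, not_lt]
    exact ⟨a.le, b.le⟩
end

section
/- Let k ∈ (-n, -1), let α : ℝⁿ\{0} → V be a smooth spinor field homogeneous of order k, and define β(x) := ω_{n-1}^{-1} · lim_{ρ→0⁺} ∫_{ℝⁿ \ (B(x,ρ) ∪ B(0,ρ))} |x-y|^{-n} γ(x-y)(α(y)) dy for x ≠ 0. Then β is homogeneous of order k+1, i.e. β(sx) = s^{k+1} β(x) for all s > 0 and x ≠ 0. -/
open MeasureTheory Metric Filter
open scoped InnerProductSpace Topology Pointwise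

/-- If `α` is a smooth spinor field homogeneous of order `k ∈ (-n, -1)` and `β`
is given by the principal value integral
`β(x) = ω_{n-1}⁻¹ lim_{ρ→0⁺} ∫_{ℝⁿ \ (B(x,ρ) ∪ B(0,ρ))} |x-y|^{-n} γ(x-y)(α(y)) dy`,
then `β` is homogeneous of order `k + 1`. -/
theorem stmt8 (n : ℕ) (hn : 3 ≤ n) (V : Type*) [NormedAddCommGroup V]
    [InnerProductSpace ℂ V] [FiniteDimensional ℂ V] [Nontrivial V]
    (γ : Fin n → V →ₗ[ℂ] V)
    (hcl : ∀ i j (ψ : V), γ i (γ j ψ) + γ j (γ i ψ) =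
      if i = j then (-2 : ℂ) • ψ else 0)
    (hsk : ∀ i (φ ψ : V), ⟪γ i φ, ψ⟫_ℂ = -⟪φ, γ i ψ⟫_ℂ)
    (k : ℝ) (hk₁ : -(n : ℝ) < k) (hk₂ : k < -1)
    (α : EuclideanSpace ℝ (Fin n) → V)
    (hα : ContDiffOn ℝ (⊤ : ℕ∞) α {0}ᶜ)
    (hhom : ∀ s : ℝ, 0 < s → ∀ x : EuclideanSpace ℝ (Fin n), x ≠ 0 →
      α (s • x) = s ^ k • α x)
    (β : EuclideanSpace ℝ (Fin n) → V)
    (hβ : ∀ x : EuclideanSpace ℝ (Fin n), x ≠ 0 →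
      Tendsto
        (fun ρ : ℝ => (sphereVol n)⁻¹ •
          ∫ y in (ball x ρ ∪ ball 0 ρ)ᶜ,
            (‖x - y‖ ^ n)⁻¹ • cliffordMul γ (x - y) (α y))
        (𝓝[>] 0) (𝓝 (β x))) :
    ∀ s : ℝ, 0 < s → ∀ x : EuclideanSpace ℝ (Fin n), x ≠ 0 →
      β (s • x) = s ^ (k + 1) • β x := by
  intro s hs x hx
  have hsx : s • x ≠ 0 := smul_ne_zero hs.ne' hx
  have key : ∀ ρ : ℝ, 0 < ρ →
      (sphereVol n)⁻¹ • ∫ y in (ball (s • x) (s * ρ) ∪ ball 0 (s * ρ))ᶜ,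
            (‖s • x - y‖ ^ n)⁻¹ • cliffordMul γ (s • x - y) (α y) =
      s ^ (k + 1) • ((sphereVol n)⁻¹ • ∫ y in (ball x ρ ∪ ball 0 ρ)ᶜ,
            (‖x - y‖ ^ n)⁻¹ • cliffordMul γ (x - y) (α y)) := by
    intro ρ hρ
    have hset : s • (ball x ρ ∪ ball (0 : EuclideanSpace ℝ (Fin n)) ρ)ᶜ =
        (ball (s • x) (s * ρ) ∪ ball 0 (s * ρ))ᶜ := by
      rw [← Set.preimage_smul_inv₀ hs.ne', Set.preimage_compl, Set.preimage_smul_inv₀ hs.ne', Set.smul_set_union,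
        _root_.smul_ball hs.ne', _root_.smul_ball hs.ne',
        smul_zero, Real.norm_of_nonneg hs.le]
    have h1 := Measure.setIntegral_comp_smul_of_pos volume
      (fun y => (‖s • x - y‖ ^ n)⁻¹ • cliffordMul γ (s • x - y) (α y))
      (ball x ρ ∪ ball (0 : EuclideanSpace ℝ (Fin n)) ρ)ᶜ hs
    rw [hset, finrank_euclideanSpace_fin] at h1
    have h2 : ∀ z ∈ (ball x ρ ∪ ball (0 : EuclideanSpace ℝ (Fin n)) ρ)ᶜ,
        (‖s • x - s • z‖ ^ n)⁻¹ • cliffordMul γ (s • x - s • z) (α (s • z)) =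
        ((s ^ n)⁻¹ * s ^ (k + 1)) • ((‖x - z‖ ^ n)⁻¹ • cliffordMul γ (x - z) (α z)) := by
      intro z hz
      have hz0 : z ≠ 0 := by
        rintro rfl
        exact hz (Or.inr (mem_ball_self hρ))
      have hc : cliffordMul γ (s • x - s • z) (α (s • z)) =
          s ^ (k + 1) • cliffordMul γ (x - z) (α z) := by
        unfold cliffordMul
        rw [hhom s hs z hz0, Finset.smul_sum, Real.rpow_add hs, Real.rpow_one]
        refine Finset.sum_congr rfl fun i _ => ?_
        rw [← smul_sub, PiLp.smul_apply, smul_eq_mul, LinearMap.map_smul_of_tower, smul_smul,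
          smul_smul]
        congr 1
        ring
      rw [hc, ← smul_sub, norm_smul, Real.norm_of_nonneg hs.le, mul_pow, mul_inv, smul_smul,
        smul_smul]
      congr 1
      ring
    have hm : MeasurableSet (ball x ρ ∪ ball (0 : EuclideanSpace ℝ (Fin n)) ρ)ᶜ :=
      (measurableSet_ball.union measurableSet_ball).compl
    rw [setIntegral_congr_fun hm h2, integral_smul, mul_smul] at h1
    have hsn : (s ^ n)⁻¹ ≠ 0 := inv_ne_zero (pow_ne_zero _ hs.ne')
    rw [← smul_right_injective V hsn h1, smul_comm]
  have hlim : Tendsto (fun ρ : ℝ => s * ρ) (𝓝[>] 0) (𝓝[>] 0) := by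
    refine tendsto_nhdsWithin_iff.2 ⟨?_, ?_⟩
    · have : Tendsto (fun ρ : ℝ => s * ρ) (𝓝 0) (𝓝 (s * 0)) := tendsto_id.const_mul s
      rw [mul_zero] at this
      exact this.mono_left nhdsWithin_le_nhds
    · filter_upwards [self_mem_nhdsWithin] with ρ hρ
      exact mul_pos hs hρ
  have hA := (hβ (s • x) hsx).comp hlim
  have hB := (hβ x hx).const_smul (s ^ (k + 1))
  refine tendsto_nhds_unique hA (hB.congr' ?_)
  filter_upwards [self_mem_nhdsWithin] with ρ hρ
  exact (key ρ hρ).symm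
end

section
/- (Regularity Lemma) Let α : ℝⁿ → V be locally integrable, vanishing outside a compact set, and smooth on ℝⁿ\{0}. Assume that the distributional Dirac derivative of α on all of ℝⁿ has no singular part at the origin, i.e. for every smooth compactly supported φ : ℝⁿ → ℝ one has -Σᵢ ∫ ∂ᵢφ(x) · γᵢ(α(x)) dx = ∫ φ(x) · Dα(x) dx, where Dα denotes the pointwise Dirac derivative on ℝⁿ\{0} (assumed locally integrable on ℝⁿ). Assume moreover that there is C > 0 with ‖Dα(x)‖ ≤ C/|x| and ‖∂ᵢ(Dα)(x)‖ ≤ C/|x|² for all x ≠ 0 and all i = 1,…,n. Then for every ε > 0 the functions x ↦ |x|^ε α(x) and x ↦ |x|^{1+ε} ‖(dα)ₓ‖ (where (dα)ₓ is the total derivative of α at x) extend continuously from ℝⁿ\{0} to all of ℝⁿ. -/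
open MeasureTheory Metric
open scoped InnerProductSpace

theorem aux_elem (N δ k a b t : ℝ) (hN : 3 ≤ N) (hδ : 0 < δ) (hδ1 : δ < 1) (hk : 1 ≤ k)
    (hk2 : k ≤ 2) (ha : 0 < a) (hb : 0 < b) (ht : 0 < t) (htab : t ≤ a + b) :
    a ^ (1 - N) * b ^ (-k) ≤ 4 * t ^ (-(k - 1 + δ)) * (a ^ (-(N - δ)) + b ^ (-(N - δ))) := by
  have hm : 0 < k - 1 + δ := by linarith
  have key : t ^ (k - 1 + δ) * (a ^ (1 - N) * b ^ (-k)) ≤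
      4 * (a ^ (-(N - δ)) + b ^ (-(N - δ))) := by
    have h2 : (2 : ℝ) ^ (k - 1 + δ) ≤ 4 := by
      calc (2 : ℝ) ^ (k - 1 + δ) ≤ (2 : ℝ) ^ (2 : ℝ) :=
            Real.rpow_le_rpow_of_exponent_le (by norm_num) (by linarith)
        _ = 4 := by norm_num
    have hap := Real.rpow_pos_of_pos ha
    have hbp := Real.rpow_pos_of_pos hb
    rcases le_total a b with hab | hab
    · have h1 : t ^ (k - 1 + δ) ≤ 4 * b ^ (k - 1 + δ) := by
        calc t ^ (k - 1 + δ) ≤ (2 * b) ^ (k - 1 + δ) :=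
              Real.rpow_le_rpow ht.le (by linarith) hm.le
          _ = 2 ^ (k - 1 + δ) * b ^ (k - 1 + δ) := Real.mul_rpow (by norm_num) hb.le
          _ ≤ _ := by gcongr
      calc t ^ (k - 1 + δ) * (a ^ (1 - N) * b ^ (-k))
          ≤ 4 * b ^ (k - 1 + δ) * (a ^ (1 - N) * b ^ (-k)) := by gcongr
        _ = 4 * (a ^ (1 - N) * (b ^ (k - 1 + δ) * b ^ (-k))) := by ring
        _ = 4 * (a ^ (1 - N) * b ^ (δ - 1)) := by
            rw [← Real.rpow_add hb]; congr 3; ring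
        _ ≤ 4 * (a ^ (1 - N) * a ^ (δ - 1)) := by
            have := Real.rpow_le_rpow_of_nonpos ha hab (z := δ - 1) (by linarith)
            have := (hap (1 - N)).le
            gcongr
        _ = 4 * a ^ (-(N - δ)) := by rw [← Real.rpow_add ha]; congr 2; ring
        _ ≤ _ := by have := (hbp (-(N - δ))).le; linarith
    · have h1 : t ^ (k - 1 + δ) ≤ 4 * a ^ (k - 1 + δ) := by
        calc t ^ (k - 1 + δ) ≤ (2 * a) ^ (k - 1 + δ) :=
              Real.rpow_le_rpow ht.le (by linarith) hm.le
          _ = 2 ^ (k - 1 + δ) * a ^ (k - 1 + δ) := Real.mul_rpow (by norm_num) ha.le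
          _ ≤ _ := by gcongr
      calc t ^ (k - 1 + δ) * (a ^ (1 - N) * b ^ (-k))
          ≤ 4 * a ^ (k - 1 + δ) * (a ^ (1 - N) * b ^ (-k)) := by gcongr
        _ = 4 * ((a ^ (k - 1 + δ) * a ^ (1 - N)) * b ^ (-k)) := by ring
        _ = 4 * (a ^ (k + δ - N) * b ^ (-k)) := by
            rw [← Real.rpow_add ha]; congr 3; ring
        _ ≤ 4 * (b ^ (k + δ - N) * b ^ (-k)) := by
            have := Real.rpow_le_rpow_of_nonpos hb hab (z := k + δ - N) (by linarith)
            have := (hbp (-k)).le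
            gcongr
        _ = 4 * b ^ (-(N - δ)) := by rw [← Real.rpow_add hb]; congr 2; ring
        _ ≤ _ := by have := (hap (-(N - δ))).le; linarith
  have ht' := Real.rpow_pos_of_pos ht (k - 1 + δ)
  rw [Real.rpow_neg ht.le]
  rw [show 4 * (t ^ (k - 1 + δ))⁻¹ * (a ^ (-(N - δ)) + b ^ (-(N - δ))) =
    (t ^ (k - 1 + δ))⁻¹ * (4 * (a ^ (-(N - δ)) + b ^ (-(N - δ)))) by ring]
  rw [le_inv_mul_iff₀ ht']
  exact key

theorem aux_ball_int (n : ℕ) (hn : 3 ≤ n) (p R : ℝ) (hp : p < n) (hR : 0 < R) :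
    IntegrableOn (fun z : EuclideanSpace ℝ (Fin n) => ‖z‖ ^ (-p)) (ball 0 R) := by
  have : Nonempty (Fin n) := ⟨⟨0, by omega⟩⟩
  rw [integrableOn_fun_norm_addHaar volume (f := fun y : ℝ => y ^ (-p))]
  have h := (intervalIntegral.integrableOn_Ioo_rpow_iff (s := (n : ℝ) - 1 - p) hR).2
    (by linarith)
  refine h.congr_fun ?_ measurableSet_Ioo
  intro y hy
  simp only [finrank_euclideanSpace, Fintype.card_fin, smul_eq_mul]
  rw [← Real.rpow_natCast, ← Real.rpow_add hy.1, Nat.cast_sub (by omega)]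
  congr 1
  push_cast
  ring

theorem aux_kernel (n : ℕ) (hn : 3 ≤ n) (δ k R : ℝ) (hδ : 0 < δ) (hδ1 : δ < 1) (hk : 1 ≤ k)
    (hk2 : k ≤ 2) (hR : 0 < R) :
    ∃ K : ℝ, 0 ≤ K ∧ ∀ x : EuclideanSpace ℝ (Fin n), x ≠ 0 → ‖x‖ ≤ R →
      IntegrableOn (fun y : EuclideanSpace ℝ (Fin n) => ‖y - x‖ ^ (1 - (n : ℝ)) * ‖y‖ ^ (-k))
        (ball 0 R) ∧
      ∫ y in ball (0 : EuclideanSpace ℝ (Fin n)) R, ‖y - x‖ ^ (1 - (n : ℝ)) * ‖y‖ ^ (-k) ≤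
        K * ‖x‖ ^ (-(k - 1 + δ)) := by
  have hN : (3 : ℝ) ≤ n := by exact_mod_cast hn
  set p : ℝ := n - δ with hp
  have I1 := aux_ball_int n hn p R (by linarith) hR
  have I2 := aux_ball_int n hn p (2 * R) (by linarith) (by linarith)
  set J2 := ∫ y in ball (0 : EuclideanSpace ℝ (Fin n)) (2 * R), ‖y‖ ^ (-p) with hJ2
  set J1 := ∫ y in ball (0 : EuclideanSpace ℝ (Fin n)) R, ‖y‖ ^ (-p) with hJ1
  have hJ1n : 0 ≤ J1 := integral_nonneg fun y => by positivity
  have hJ2n : 0 ≤ J2 := integral_nonneg fun y => by positivity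
  refine ⟨4 * (J2 + J1), by positivity, fun x hx hxR => ?_⟩
  have hsub : ball (0 : EuclideanSpace ℝ (Fin n)) R ⊆ (fun y => y - x) ⁻¹' ball 0 (2 * R) := by
    intro y hy
    simp only [mem_ball_zero_iff, Set.mem_preimage] at hy ⊢
    calc ‖y - x‖ ≤ ‖y‖ + ‖x‖ := norm_sub_le _ _
      _ < 2 * R := by linarith
  have mp := measurePreserving_sub_right (volume : Measure (EuclideanSpace ℝ (Fin n))) x
  have me : MeasurableEmbedding (fun y : EuclideanSpace ℝ (Fin n) => y - x) :=
    measurableEmbedding_subRight x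
  have I3' : IntegrableOn (fun y : EuclideanSpace ℝ (Fin n) => ‖y - x‖ ^ (-p))
      ((fun y => y - x) ⁻¹' ball 0 (2 * R)) :=
    (mp.integrableOn_comp_preimage me).2 I2
  have I3 := I3'.mono_set hsub
  have J3 : ∫ y in ball (0 : EuclideanSpace ℝ (Fin n)) R, ‖y - x‖ ^ (-p) ≤ J2 := by
    rw [hJ2, ← mp.setIntegral_preimage_emb me (fun y => ‖y‖ ^ (-p)) (ball 0 (2 * R))]
    exact setIntegral_mono_set I3' (Filter.Eventually.of_forall fun y => by
      simp only [Pi.zero_apply]; positivity) hsub.eventuallyLE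
  have hpt : ∀ y : EuclideanSpace ℝ (Fin n), ‖y - x‖ ^ (1 - (n : ℝ)) * ‖y‖ ^ (-k) ≤
      4 * ‖x‖ ^ (-(k - 1 + δ)) * (‖y - x‖ ^ (-p) + ‖y‖ ^ (-p)) := by
    intro y
    by_cases hy : y = 0
    · rw [hy, norm_zero, Real.zero_rpow (x := -k) (by linarith), mul_zero]; positivity
    by_cases hyx : y = x
    · rw [hyx, sub_self, norm_zero, Real.zero_rpow (x := 1 - (n : ℝ)) (by linarith), zero_mul]
      positivity
    apply aux_elem _ _ _ _ _ _ hN hδ hδ1 hk hk2 (norm_pos_iff.2 (sub_ne_zero.2 hyx))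
      (norm_pos_iff.2 hy) (norm_pos_iff.2 hx)
    calc ‖x‖ = ‖y - (y - x)‖ := by simp
      _ ≤ ‖y‖ + ‖y - x‖ := norm_sub_le _ _
      _ = _ := add_comm _ _
  have I4 : IntegrableOn (fun y => 4 * ‖x‖ ^ (-(k - 1 + δ)) * (‖y - x‖ ^ (-p) + ‖y‖ ^ (-p)))
      (ball 0 R) := (I3.add I1).const_mul _
  have I5 : IntegrableOn
      (fun y : EuclideanSpace ℝ (Fin n) => ‖y - x‖ ^ (1 - (n : ℝ)) * ‖y‖ ^ (-k))
      (ball 0 R) := by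
    refine I4.mono' ?_ (Filter.Eventually.of_forall fun y => ?_)
    · exact Measurable.aestronglyMeasurable (by fun_prop)
    · rw [Real.norm_of_nonneg (by positivity)]; exact hpt y
  refine ⟨I5, ?_⟩
  calc _ ≤ ∫ y in ball (0 : EuclideanSpace ℝ (Fin n)) R,
        4 * ‖x‖ ^ (-(k - 1 + δ)) * (‖y - x‖ ^ (-p) + ‖y‖ ^ (-p)) :=
        setIntegral_mono I5 I4 hpt
    _ = 4 * ‖x‖ ^ (-(k - 1 + δ)) *
        ((∫ y in ball (0 : EuclideanSpace ℝ (Fin n)) R, ‖y - x‖ ^ (-p)) + J1) := by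
        rw [integral_const_mul, integral_add I3 I1]
    _ ≤ 4 * ‖x‖ ^ (-(k - 1 + δ)) * (J2 + J1) := by gcongr
    _ = _ := by ring

theorem aux_cliff_s10 {n : ℕ} {V : Type*} [NormedAddCommGroup V] [InnerProductSpace ℂ V]
    (γ : Fin n → V →ₗ[ℂ] V)
    (hcl : ∀ i j (ψ : V), γ i (γ j ψ) + γ j (γ i ψ) =
      if i = j then (-2 : ℂ) • ψ else 0) (a : Fin n → Fin n → ℝ) (ha : ∀ i j, a i j = a j i)
    (v : V) : ∑ j, ∑ i, a i j • γ j (γ i v) = -((∑ i, a i i) • v) := by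
  have h1 : ∑ j, ∑ i, a i j • γ j (γ i v) = ∑ j, ∑ i, a i j • γ i (γ j v) := by
    rw [Finset.sum_comm]
    refine Finset.sum_congr rfl fun i _ => Finset.sum_congr rfl fun j _ => ?_
    rw [ha]
  have h2 : ∑ j, ∑ i, a i j • γ j (γ i v) + ∑ j, ∑ i, a i j • γ j (γ i v) =
      (2 : ℝ) • -((∑ i, a i i) • v) := by
    nth_rewrite 2 [h1]
    simp only [← Finset.sum_add_distrib, ← smul_add, hcl]
    simp only [smul_ite, smul_zero, Finset.sum_ite_eq, Finset.mem_univ,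
      if_true, Finset.sum_smul, ← Finset.sum_neg_distrib, Finset.smul_sum]
    refine Finset.sum_congr rfl fun i _ => ?_
    rw [smul_neg, smul_smul, neg_smul, smul_neg, show (2 : ℂ) • v = (2 : ℝ) • v from
      (RCLike.real_smul_eq_coe_smul (K := ℂ) (2 : ℝ) v).symm ▸ by norm_num, smul_smul, mul_comm]
  rw [← two_smul ℝ] at h2
  exact smul_right_injective V (two_ne_zero' ℝ) h2

theorem aux_integrable_smul {n : ℕ} {V : Type*} [NormedAddCommGroup V] [NormedSpace ℝ V]
    {α : EuclideanSpace ℝ (Fin n) → V} (hloc : LocallyIntegrable α volume)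
    (hsupp : HasCompactSupport α) {φ : EuclideanSpace ℝ (Fin n) → ℝ} (hφ : Continuous φ) :
    Integrable (fun x => φ x • α x) volume := by
  have h := (hloc.integrableOn_isCompact hsupp).continuousOn_smul hφ.continuousOn hsupp
  refine (integrableOn_iff_integrable_of_support_subset ?_).1 h
  intro x hx
  apply subset_tsupport
  intro h0
  exact hx (by simp [h0])

theorem aux_dirac_zero {n : ℕ} {V : Type*} [NormedAddCommGroup V]
    [NormedSpace ℂ V] (γ : Fin n → V →ₗ[ℂ] V)
    (f : EuclideanSpace ℝ (Fin n) → V) (x : EuclideanSpace ℝ (Fin n)) (hx : x ∉ tsupport f) :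
    dirac γ f x = 0 := by
  have : fderiv ℝ f x = 0 := by
    by_contra h
    exact hx (support_fderiv_subset ℝ h)
  simp [dirac, this]

theorem aux_dirac_supp {n : ℕ} {V : Type*} [NormedAddCommGroup V]
    [NormedSpace ℂ V] (γ : Fin n → V →ₗ[ℂ] V)
    (f : EuclideanSpace ℝ (Fin n) → V) (hf : HasCompactSupport f) :
    HasCompactSupport (dirac γ f) :=
  HasCompactSupport.intro hf fun x hx => aux_dirac_zero γ f x hx

theorem aux_weak {n : ℕ} {V : Type*} [NormedAddCommGroup V]
    [InnerProductSpace ℂ V] (γ : Fin n → V →ₗ[ℂ] V)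
    (α : EuclideanSpace ℝ (Fin n) → V)
    (hsupp : HasCompactSupport α)
    (hdistrib : ∀ φ : EuclideanSpace ℝ (Fin n) → ℝ,
      ContDiff ℝ (⊤ : ℕ∞) φ → HasCompactSupport φ →
      -∑ i, ∫ x : EuclideanSpace ℝ (Fin n),
          (fderiv ℝ φ x (EuclideanSpace.single i 1)) • γ i (α x) =
        ∫ x : EuclideanSpace ℝ (Fin n), φ x • dirac γ α x)
    (φ : EuclideanSpace ℝ (Fin n) → ℝ) (hφ : ContDiff ℝ (⊤ : ℕ∞) φ) :
      -∑ i, ∫ x : EuclideanSpace ℝ (Fin n),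
          (fderiv ℝ φ x (EuclideanSpace.single i 1)) • γ i (α x) =
        ∫ x : EuclideanSpace ℝ (Fin n), φ x • dirac γ α x := by
  obtain ⟨R, hR, hsub⟩ := hsupp.isCompact.isBounded.subset_ball_lt 0 0
  let χ : ContDiffBump (0 : EuclideanSpace ℝ (Fin n)) := ⟨R, R + 1, hR, by linarith⟩
  have hev : ∀ x ∈ tsupport α, (fun y => χ y * φ y) =ᶠ[nhds x] φ := by
    intro x hx
    filter_upwards [isOpen_ball.mem_nhds (hsub hx)] with y hy
    rw [χ.one_of_mem_closedBall (ball_subset_closedBall hy), one_mul]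
  have h := hdistrib (fun y => χ y * φ y) (χ.contDiff.mul hφ) (χ.hasCompactSupport.mul_right)
  have e1 : ∀ i, ∫ x : EuclideanSpace ℝ (Fin n),
      (fderiv ℝ (fun y => χ y * φ y) x (EuclideanSpace.single i 1)) • γ i (α x) =
      ∫ x : EuclideanSpace ℝ (Fin n),
      (fderiv ℝ φ x (EuclideanSpace.single i 1)) • γ i (α x) := by
    intro i
    congr 1
    ext x
    by_cases hx : x ∈ tsupport α
    · rw [(hev x hx).fderiv_eq]
    · simp [image_eq_zero_of_notMem_tsupport hx]
  have e2 : ∫ x : EuclideanSpace ℝ (Fin n), (χ x * φ x) • dirac γ α x =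
      ∫ x : EuclideanSpace ℝ (Fin n), φ x • dirac γ α x := by
    congr 1
    ext x
    by_cases hx : x ∈ tsupport α
    · rw [(hev x hx).eq_of_nhds]
    · simp [aux_dirac_zero γ α x hx]
  simp only [e1] at h
  rw [h, e2]

theorem aux_weak2 {n : ℕ} {V : Type*} [NormedAddCommGroup V]
    [InnerProductSpace ℂ V] [FiniteDimensional ℂ V] (γ : Fin n → V →ₗ[ℂ] V)
    (hcl : ∀ i j (ψ : V), γ i (γ j ψ) + γ j (γ i ψ) =
      if i = j then (-2 : ℂ) • ψ else 0)
    (α : EuclideanSpace ℝ (Fin n) → V)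
    (hloc : LocallyIntegrable α volume)
    (hsupp : HasCompactSupport α)
    (hDloc : LocallyIntegrable (dirac γ α) volume)
    (hdistrib : ∀ φ : EuclideanSpace ℝ (Fin n) → ℝ,
      ContDiff ℝ (⊤ : ℕ∞) φ → HasCompactSupport φ →
      -∑ i, ∫ x : EuclideanSpace ℝ (Fin n),
          (fderiv ℝ φ x (EuclideanSpace.single i 1)) • γ i (α x) =
        ∫ x : EuclideanSpace ℝ (Fin n), φ x • dirac γ α x)
    (g : Fin n → EuclideanSpace ℝ (Fin n) → ℝ) (hg : ∀ j, ContDiff ℝ (⊤ : ℕ∞) (g j))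
    (hsym : ∀ i j x, fderiv ℝ (g j) x (EuclideanSpace.single i 1) =
      fderiv ℝ (g i) x (EuclideanSpace.single j 1)) :
    ∫ x, (∑ i, fderiv ℝ (g i) x (EuclideanSpace.single i 1)) • α x =
      ∫ x, ∑ j, g j x • γ j (dirac γ α x) := by
  let Γ : Fin n → V →L[ℝ] V := fun j => (LinearMap.toContinuousLinearMap (γ j)).restrictScalars ℝ
  have hΓ : ∀ j v, γ j v = Γ j v := fun j v => rfl
  have hcont : ∀ i j, Continuous fun x => fderiv ℝ (g j) x (EuclideanSpace.single i 1) := by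
    intro i j
    exact ((hg j).continuous_fderiv (by simp)).clm_apply continuous_const
  have hI : ∀ i j, Integrable
      fun x => fderiv ℝ (g j) x (EuclideanSpace.single i 1) • α x := fun i j =>
    aux_integrable_smul hloc hsupp (hcont i j)
  have hID : ∀ j, Integrable fun x => g j x • dirac γ α x := fun j =>
    aux_integrable_smul hDloc (aux_dirac_supp γ α hsupp) (hg j).continuous
  have hw := fun j => aux_weak γ α hsupp hdistrib (g j) (hg j)
  have hIi : ∀ i j, Integrable
      fun x => fderiv ℝ (g j) x (EuclideanSpace.single i 1) • γ i (α x) := fun i j => by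
    have := (Γ i).integrable_comp (hI i j)
    simpa only [map_smul, hΓ] using this
  have e1 : ∫ x, ∑ j, g j x • γ j (dirac γ α x) = ∑ j, Γ j (∫ x, g j x • dirac γ α x) := by
    rw [integral_finsetSum]
    · refine Finset.sum_congr rfl fun j _ => ?_
      rw [← (Γ j).integral_comp_comm (hID j)]
      simp only [map_smul, hΓ]
    · intro j _
      have := (Γ j).integrable_comp (hID j)
      simpa only [map_smul, hΓ] using this
  have e2 : ∀ j, Γ j (∫ x, g j x • dirac γ α x) =
      -∑ i, ∫ x, fderiv ℝ (g j) x (EuclideanSpace.single i 1) • γ j (γ i (α x)) := by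
    intro j
    rw [← hw j, map_neg, map_sum]
    congr 1
    refine Finset.sum_congr rfl fun i _ => ?_
    rw [← (Γ j).integral_comp_comm (hIi i j)]
    simp only [map_smul, hΓ]
  have hIij : ∀ i j, Integrable
      fun x => fderiv ℝ (g j) x (EuclideanSpace.single i 1) • γ j (γ i (α x)) := fun i j => by
    have := (Γ j).integrable_comp (hIi i j)
    simpa only [map_smul, hΓ] using this
  rw [e1]
  simp only [e2]
  rw [Finset.sum_neg_distrib]
  have e3 : ∑ j, ∑ i, ∫ x, fderiv ℝ (g j) x (EuclideanSpace.single i 1) • γ j (γ i (α x)) =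
      ∫ x, ∑ j, ∑ i, fderiv ℝ (g j) x (EuclideanSpace.single i 1) • γ j (γ i (α x)) := by
    rw [integral_finsetSum _ fun j _ => integrable_finsetSum _ fun i _ => hIij i j]
    refine Finset.sum_congr rfl fun j _ => ?_
    rw [integral_finsetSum _ fun i _ => hIij i j]
  rw [e3, ← integral_neg]
  congr 1
  ext x
  rw [aux_cliff_s10 γ hcl (fun i j => fderiv ℝ (g j) x (EuclideanSpace.single i 1))
    (fun i j => hsym i j x), neg_neg]

theorem aux_kernel_shift (n : ℕ) (hn : 3 ≤ n) (δ k R : ℝ) (hδ : 0 < δ) (hδ1 : δ < 1) (hk : 1 ≤ k)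
    (hk2 : k ≤ 2) (hR : 0 < R) :
    ∃ K : ℝ, 0 ≤ K ∧ ∀ x h : EuclideanSpace ℝ (Fin n), x + h ≠ 0 → ‖h‖ ≤ 1 → ‖x + h‖ ≤ R + 1 →
      IntegrableOn (fun y : EuclideanSpace ℝ (Fin n) =>
        ‖y - x‖ ^ (1 - (n : ℝ)) * ‖y + h‖ ^ (-k)) (ball 0 R) ∧
      ∫ y in ball (0 : EuclideanSpace ℝ (Fin n)) R, ‖y - x‖ ^ (1 - (n : ℝ)) * ‖y + h‖ ^ (-k) ≤
        K * ‖x + h‖ ^ (-(k - 1 + δ)) := by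
  obtain ⟨K, hK, H⟩ := aux_kernel n hn δ k (R + 1) hδ hδ1 hk hk2 (by linarith)
  refine ⟨K, hK, fun x h hxh hh hxR => ?_⟩
  obtain ⟨H1, H2⟩ := H (x + h) hxh hxR
  have hsub : ball (0 : EuclideanSpace ℝ (Fin n)) R ⊆ (fun y => y + h) ⁻¹' ball 0 (R + 1) := by
    intro y hy
    simp only [mem_ball_zero_iff, Set.mem_preimage] at hy ⊢
    calc ‖y + h‖ ≤ ‖y‖ + ‖h‖ := norm_add_le _ _
      _ < R + 1 := by linarith
  have mp := measurePreserving_add_right (volume : Measure (EuclideanSpace ℝ (Fin n))) h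
  have me : MeasurableEmbedding (fun y : EuclideanSpace ℝ (Fin n) => y + h) :=
    measurableEmbedding_addRight h
  have efun : (fun y : EuclideanSpace ℝ (Fin n) =>
      ‖y + h - (x + h)‖ ^ (1 - (n : ℝ)) * ‖y + h‖ ^ (-k)) =
      fun y => ‖y - x‖ ^ (1 - (n : ℝ)) * ‖y + h‖ ^ (-k) := by
    ext y; rw [add_sub_add_right_eq_sub]
  have I3' : IntegrableOn (fun y : EuclideanSpace ℝ (Fin n) =>
      ‖y - x‖ ^ (1 - (n : ℝ)) * ‖y + h‖ ^ (-k))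
      ((fun y => y + h) ⁻¹' ball 0 (R + 1)) := by
    rw [← efun]
    exact (mp.integrableOn_comp_preimage me).2 H1
  refine ⟨I3'.mono_set hsub, le_trans ?_ H2⟩
  rw [← mp.setIntegral_preimage_emb me (fun y => ‖y - (x + h)‖ ^ (1 - (n : ℝ)) * ‖y‖ ^ (-k))
    (ball 0 (R + 1)), efun]
  exact setIntegral_mono_set I3' (Filter.Eventually.of_forall fun y => by
      simp only [Pi.zero_apply]; positivity) hsub.eventuallyLE

noncomputable def Gk (n : ℕ) (s : ℝ) (x : EuclideanSpace ℝ (Fin n)) (j : Fin n)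
    (y : EuclideanSpace ℝ (Fin n)) : ℝ :=
  (y j - x j) * (s ^ 2 + ‖y - x‖ ^ 2) ^ (-(n : ℝ) / 2)

theorem Gk_contDiff (n : ℕ) (s : ℝ) (hs : 0 < s) (x : EuclideanSpace ℝ (Fin n)) (j : Fin n) :
    ContDiff ℝ (⊤ : ℕ∞) (Gk n s x j) := by
  unfold Gk
  refine ContDiff.mul ?_ (ContDiff.rpow_const_of_ne ?_ fun y => by positivity)
  · exact ((EuclideanSpace.proj (𝕜 := ℝ) j).contDiff).sub contDiff_const
  · exact contDiff_const.add ((contDiff_id.sub contDiff_const).norm_sq ℝ)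

theorem Gk_fderiv (n : ℕ) (s : ℝ) (hs : 0 < s) (x : EuclideanSpace ℝ (Fin n)) (i j : Fin n)
    (y : EuclideanSpace ℝ (Fin n)) :
    fderiv ℝ (Gk n s x j) y (EuclideanSpace.single i 1) =
      (if i = j then (s ^ 2 + ‖y - x‖ ^ 2) ^ (-(n : ℝ) / 2) else 0) -
      n * ((y i - x i) * (y j - x j)) * (s ^ 2 + ‖y - x‖ ^ 2) ^ (-(n : ℝ) / 2 - 1) := by
  have h1 : HasFDerivAt (fun y : EuclideanSpace ℝ (Fin n) => y j - x j)
      (EuclideanSpace.proj (𝕜 := ℝ) j) y :=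
    ((EuclideanSpace.proj (𝕜 := ℝ) j).hasFDerivAt (x := y)).sub_const _
  have h2 : HasFDerivAt (fun y : EuclideanSpace ℝ (Fin n) => y - x)
    (ContinuousLinearMap.id ℝ _) y := (hasFDerivAt_id y).sub_const x
  have h3 := (h2.norm_sq.const_add (s ^ 2)).rpow_const (p := -(n : ℝ) / 2)
    (Or.inl (by positivity))
  have h4 := (h1.mul h3).fderiv
  have h5 : fderiv ℝ (Gk n s x j) y = _ := h4
  rw [h5]
  have hpr : (EuclideanSpace.proj (𝕜 := ℝ) j) (EuclideanSpace.single i (1 : ℝ)) =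
      if j = i then (1 : ℝ) else 0 := PiLp.single_apply 2 ℝ i (1 : ℝ) j
  simp only [add_apply, smul_apply, ContinuousLinearMap.comp_apply,
    innerSL_apply_apply, ContinuousLinearMap.id_apply, EuclideanSpace.inner_single_right,
    hpr, smul_eq_mul, PiLp.sub_apply]
  by_cases hij : i = j
  · subst hij; simp; ring
  · have : j ≠ i := fun h => hij h.symm
    simp [hij, this]; ring

theorem Gk_div (n : ℕ) (s : ℝ) (hs : 0 < s) (x y : EuclideanSpace ℝ (Fin n)) :
    ∑ i, fderiv ℝ (Gk n s x i) y (EuclideanSpace.single i 1) =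
      n * s ^ 2 * (s ^ 2 + ‖y - x‖ ^ 2) ^ (-(n : ℝ) / 2 - 1) := by
  have hw : 0 < s ^ 2 + ‖y - x‖ ^ 2 := by positivity
  simp only [Gk_fderiv n s hs, if_true, Finset.sum_sub_distrib, ← Finset.sum_mul,
    ← Finset.mul_sum]
  have : ∑ i, (y i - x i) * (y i - x i) = ‖y - x‖ ^ 2 := by
    rw [EuclideanSpace.norm_sq_eq]
    refine Finset.sum_congr rfl fun i _ => ?_
    rw [PiLp.sub_apply, Real.norm_eq_abs, sq_abs, sq]
  rw [this]
  have h2 : (s ^ 2 + ‖y - x‖ ^ 2) ^ (-(n : ℝ) / 2) =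
      (s ^ 2 + ‖y - x‖ ^ 2) * (s ^ 2 + ‖y - x‖ ^ 2) ^ (-(n : ℝ) / 2 - 1) := by
    nth_rewrite 2 [← Real.rpow_one (s ^ 2 + ‖y - x‖ ^ 2)]
    rw [← Real.rpow_add hw]; congr 1; ring
  simp only [Finset.sum_const, Finset.card_univ, Fintype.card_fin, nsmul_eq_mul]
  rw [h2]; ring

theorem Gk_bound (n : ℕ) (s : ℝ) (x y : EuclideanSpace ℝ (Fin n))
    (j : Fin n) : ‖Gk n s x j y‖ ≤ ‖y - x‖ ^ (1 - (n : ℝ)) := by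
  by_cases hyx : y = x
  · subst hyx
    simp only [Gk, sub_self, zero_mul, norm_zero]
    positivity
  have h0 : 0 < ‖y - x‖ := norm_pos_iff.2 (sub_ne_zero.2 hyx)
  have h1 : ‖y j - x j‖ ≤ ‖y - x‖ := PiLp.norm_apply_le (y - x) j
  have h2 : (s ^ 2 + ‖y - x‖ ^ 2) ^ (-(n : ℝ) / 2) ≤ ‖y - x‖ ^ (-(n : ℝ)) := by
    calc _ ≤ (‖y - x‖ ^ 2) ^ (-(n : ℝ) / 2) :=
          Real.rpow_le_rpow_of_nonpos (by positivity) (by nlinarith [sq_nonneg s])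
            (by have : (0 : ℝ) ≤ n := n.cast_nonneg
                linarith)
      _ = _ := by
          rw [← Real.rpow_natCast, ← Real.rpow_mul h0.le]; congr 1; push_cast; ring
  rw [Gk, norm_mul, Real.norm_of_nonneg (by positivity :
    0 ≤ (s ^ 2 + ‖y - x‖ ^ 2) ^ (-(n : ℝ) / 2))]
  calc _ ≤ ‖y - x‖ * ‖y - x‖ ^ (-(n : ℝ)) := by gcongr
    _ = _ := by
      rw [sub_eq_add_neg 1, Real.rpow_add h0, Real.rpow_one]

theorem aux_peak {n : ℕ} (hn : 3 ≤ n) {V : Type*} [NormedAddCommGroup V] [NormedSpace ℝ V]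
    [CompleteSpace V] :
    ∃ I : ℝ, 0 < I ∧ ∀ (α : EuclideanSpace ℝ (Fin n) → V) (x : EuclideanSpace ℝ (Fin n)),
      Integrable α volume → ContinuousAt α x → Filter.Tendsto (fun c : ℝ => ∫ y,
      (c ^ n * (I⁻¹ * (1 + ‖c • (x - y)‖ ^ 2) ^ (-((n : ℝ) + 2) / 2))) • α y) Filter.atTop
      (nhds (α x)) := by
  have hN : (3 : ℝ) ≤ n := by exact_mod_cast hn
  let P : EuclideanSpace ℝ (Fin n) → ℝ := fun z => (1 + ‖z‖ ^ 2) ^ (-((n : ℝ) + 2) / 2)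
  have hPpos : ∀ z, 0 < P z := fun z => by positivity
  have hPI : Integrable P volume := by
    apply integrable_rpow_neg_one_add_norm_sq
    simp
  have hI : 0 < ∫ z, P z := by
    rw [integral_pos_iff_support_of_nonneg (fun z => (hPpos z).le) hPI]
    have : Function.support P = Set.univ := by
      ext z; simp [(hPpos z).ne']
    rw [this]
    exact isOpen_univ.measure_pos _ Set.univ_nonempty
  obtain ⟨I, hIdef⟩ : ∃ I, I = ∫ z, P z := ⟨_, rfl⟩
  rw [← hIdef] at hI
  have hdecay : Filter.Tendsto (fun z : EuclideanSpace ℝ (Fin n) =>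
      ‖z‖ ^ Module.finrank ℝ (EuclideanSpace ℝ (Fin n)) * (I⁻¹ * P z))
      (Bornology.cobounded _) (nhds 0) := by
    have h1 : Filter.Tendsto (fun z : EuclideanSpace ℝ (Fin n) => I⁻¹ * (‖z‖ ^ 2)⁻¹)
        (Bornology.cobounded _) (nhds 0) := by
      rw [← mul_zero I⁻¹]
      refine Filter.Tendsto.const_mul _ (Filter.Tendsto.inv_tendsto_atTop ?_)
      exact (Filter.tendsto_pow_atTop two_ne_zero).comp tendsto_norm_cobounded_atTop
    refine squeeze_zero' (Filter.Eventually.of_forall fun z => ?_) ?_ h1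
    · have := (hPpos z).le; positivity
    · have : ∀ᶠ z : EuclideanSpace ℝ (Fin n) in Bornology.cobounded _, 1 ≤ ‖z‖ :=
        tendsto_norm_cobounded_atTop.eventually_ge_atTop 1
      filter_upwards [this] with z hz
      have hz0 : 0 < ‖z‖ := by linarith
      have h2 : P z ≤ (‖z‖ ^ 2) ^ (-((n : ℝ) + 2) / 2) :=
        Real.rpow_le_rpow_of_nonpos (by positivity) (by linarith) (by linarith)
      have h3 : (‖z‖ ^ 2) ^ (-((n : ℝ) + 2) / 2) = (‖z‖ ^ n)⁻¹ * (‖z‖ ^ 2)⁻¹ := by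
        rw [← Real.rpow_natCast, ← Real.rpow_natCast, ← Real.rpow_mul hz0.le,
          ← Real.rpow_neg hz0.le, ← Real.rpow_neg hz0.le, ← Real.rpow_add hz0]
        congr 1; push_cast; ring
      rw [h3] at h2
      rw [finrank_euclideanSpace, Fintype.card_fin]
      calc ‖z‖ ^ n * (I⁻¹ * P z) ≤ ‖z‖ ^ n * (I⁻¹ * ((‖z‖ ^ n)⁻¹ * (‖z‖ ^ 2)⁻¹)) := by gcongr
        _ = _ := by field_simp
  refine ⟨I, hI, fun α x hα hx => ?_⟩
  have hnn : ∀ z, 0 ≤ I⁻¹ * P z := fun z => mul_nonneg (inv_nonneg.2 hI.le) (hPpos z).le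
  have hone : ∫ z, I⁻¹ * P z = 1 := by
    rw [integral_const_mul, ← hIdef, inv_mul_cancel₀ hI.ne']
  have hpeak := tendsto_integral_comp_smul_smul_of_integrable' (μ := volume)
    (φ := fun z => I⁻¹ * P z) hnn hone hdecay hα hx
  rw [finrank_euclideanSpace, Fintype.card_fin] at hpeak
  exact hpeak

theorem aux_rep {n : ℕ} (hn : 3 ≤ n) {V : Type*} [NormedAddCommGroup V]
    [InnerProductSpace ℂ V] [FiniteDimensional ℂ V] (γ : Fin n → V →ₗ[ℂ] V)
    (hcl : ∀ i j (ψ : V), γ i (γ j ψ) + γ j (γ i ψ) =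
      if i = j then (-2 : ℂ) • ψ else 0)
    (α : EuclideanSpace ℝ (Fin n) → V)
    (hloc : LocallyIntegrable α volume)
    (hsupp : HasCompactSupport α)
    (hDloc : LocallyIntegrable (dirac γ α) volume)
    (hdistrib : ∀ φ : EuclideanSpace ℝ (Fin n) → ℝ,
      ContDiff ℝ (⊤ : ℕ∞) φ → HasCompactSupport φ →
      -∑ i, ∫ x : EuclideanSpace ℝ (Fin n),
          (fderiv ℝ φ x (EuclideanSpace.single i 1)) • γ i (α x) =
        ∫ x : EuclideanSpace ℝ (Fin n), φ x • dirac γ α x) :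
    ∃ κ : ℝ, 0 < κ ∧ ∀ x, ContinuousAt α x → Filter.Tendsto
      (fun c : ℝ => ∫ y, ∑ j, Gk n c⁻¹ x j y • γ j (dirac γ α y)) Filter.atTop
      (nhds (κ • α x)) := by
  have hcomp : CompleteSpace V := FiniteDimensional.complete ℂ V
  obtain ⟨I, hI, hP⟩ := aux_peak hn (V := V)
  have hn0 : (0 : ℝ) < n := by exact_mod_cast (by omega : 0 < n)
  refine ⟨n * I, by positivity, fun x hx => ?_⟩
  have hαint : Integrable α volume := by
    simpa using aux_integrable_smul hloc hsupp (φ := fun _ => (1 : ℝ)) continuous_const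
  have hpeak := hP α x hαint hx
  have h2 := hpeak.const_smul ((n : ℝ) * I)
  refine h2.congr' ?_
  filter_upwards [Filter.eventually_gt_atTop (0 : ℝ)] with c hc
  rw [← aux_weak2 γ hcl α hloc hsupp hDloc hdistrib (fun j => Gk n c⁻¹ x j)
    (fun j => Gk_contDiff n c⁻¹ (by positivity) x j)
    (fun i j y => by
      rw [Gk_fderiv n _ (by positivity), Gk_fderiv n _ (by positivity)]
      by_cases hij : i = j
      · rw [hij]
      · have : j ≠ i := fun h => hij h.symm
        simp only [hij, this, if_false]; ring), ← integral_smul]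
  congr 1
  ext y
  rw [Gk_div n _ (by positivity), smul_smul]
  congr 1
  have h3 : (c⁻¹ ^ 2 + ‖y - x‖ ^ 2) = c⁻¹ ^ 2 * (1 + ‖c • (x - y)‖ ^ 2) := by
    rw [norm_smul, Real.norm_of_nonneg hc.le, norm_sub_rev]; field_simp
  have h4 : (c⁻¹ ^ 2) ^ (-(n : ℝ) / 2 - 1) = c ^ n * c ^ 2 := by
    rw [inv_pow, ← Real.rpow_natCast, ← Real.rpow_natCast, ← Real.rpow_neg hc.le,
      ← Real.rpow_mul hc.le, ← Real.rpow_add hc]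
    congr 1; push_cast; ring
  rw [h3, Real.mul_rpow (by positivity) (by positivity), h4,
    show -(n : ℝ) / 2 - 1 = -((n : ℝ) + 2) / 2 by ring]
  field_simp

theorem aux_est {n : ℕ} {V : Type*} [NormedAddCommGroup V]
    [InnerProductSpace ℂ V] [FiniteDimensional ℂ V] (γ : Fin n → V →ₗ[ℂ] V) :
    ∃ B : ℝ, 0 ≤ B ∧ ∀ (s R : ℝ) (x : EuclideanSpace ℝ (Fin n))
      (F : EuclideanSpace ℝ (Fin n) → V) (M : EuclideanSpace ℝ (Fin n) → ℝ),
      (∀ y ∉ ball (0 : EuclideanSpace ℝ (Fin n)) R, F y = 0) →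
      (∀ᵐ y, ‖F y‖ ≤ M y) →
      IntegrableOn (fun y => ‖y - x‖ ^ (1 - (n : ℝ)) * M y) (ball 0 R) →
      ‖∫ y, ∑ j, Gk n s x j y • γ j (F y)‖ ≤
        B * ∫ y in ball (0 : EuclideanSpace ℝ (Fin n)) R, ‖y - x‖ ^ (1 - (n : ℝ)) * M y := by
  let Γ : Fin n → V →L[ℂ] V := fun j => LinearMap.toContinuousLinearMap (γ j)
  have hΓ : ∀ j v, γ j v = Γ j v := fun j v => rfl
  refine ⟨∑ j, ‖Γ j‖, by positivity, fun s R x F M hF hM hI => ?_⟩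
  rw [← setIntegral_eq_integral_of_forall_compl_eq_zero (s := ball 0 R)
    (fun y hy => by simp [hF y hy]), ← integral_const_mul]
  refine norm_integral_le_of_norm_le (hI.const_mul _) (ae_restrict_of_ae ?_)
  filter_upwards [hM] with y hy
  refine (norm_sum_le _ _).trans ?_
  rw [Finset.sum_mul]
  refine Finset.sum_le_sum fun j _ => ?_
  rw [norm_smul]
  calc ‖Gk n s x j y‖ * ‖γ j (F y)‖ ≤ ‖y - x‖ ^ (1 - (n : ℝ)) * (‖Γ j‖ * M y) := by
        gcongr
        · exact Gk_bound n s x y j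
        · exact (Γ j).le_opNorm_of_le hy
    _ = _ := by ring

theorem aux_dirac_diff {n : ℕ} {V : Type*} [NormedAddCommGroup V]
    [InnerProductSpace ℂ V] [FiniteDimensional ℂ V] (γ : Fin n → V →ₗ[ℂ] V)
    (α : EuclideanSpace ℝ (Fin n) → V)
    (hα : ContDiffOn ℝ (⊤ : ℕ∞) α {0}ᶜ) (x : EuclideanSpace ℝ (Fin n)) (hx : x ≠ 0) :
    DifferentiableAt ℝ (dirac γ α) x := by
  let Γ : Fin n → V →L[ℝ] V := fun j => (LinearMap.toContinuousLinearMap (γ j)).restrictScalars ℝ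
  have h1 : ContDiffAt ℝ (⊤ : ℕ∞) α x := hα.contDiffAt (isOpen_compl_singleton.mem_nhds hx)
  have h2 : DifferentiableAt ℝ (fderiv ℝ α) x :=
    (h1.fderiv_right (m := 1) (by norm_cast)).differentiableAt (by simp)
  have : dirac γ α = fun x => ∑ i, Γ i (fderiv ℝ α x (EuclideanSpace.single i 1)) := rfl
  rw [this]
  fun_prop

theorem aux_fdiff {n : ℕ} {V : Type*} [NormedAddCommGroup V] [NormedSpace ℝ V]
    (f : EuclideanSpace ℝ (Fin n) → V) (hf : ∀ x, x ≠ 0 → DifferentiableAt ℝ f x)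
    (C : ℝ) (hC : 0 < C)
    (hD : ∀ x : EuclideanSpace ℝ (Fin n), x ≠ 0 → ‖f x‖ ≤ C / ‖x‖)
    (hD' : ∀ x : EuclideanSpace ℝ (Fin n), x ≠ 0 → ∀ i : Fin n,
      ‖fderiv ℝ f x (EuclideanSpace.single i 1)‖ ≤ C / ‖x‖ ^ 2) :
    ∃ K : ℝ, 0 ≤ K ∧ ∀ y h : EuclideanSpace ℝ (Fin n), y ≠ 0 → y + h ≠ 0 →
      ‖f (y + h) - f y‖ ≤ K * ‖h‖ * (‖y‖ ^ (-2 : ℝ) + ‖y + h‖ ^ (-2 : ℝ)) := by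
  refine ⟨4 * n * C + 3 * C, by positivity, fun y h hy hyh => ?_⟩
  have hy0 : 0 < ‖y‖ := norm_pos_iff.2 hy
  have hyh0 : 0 < ‖y + h‖ := norm_pos_iff.2 hyh
  have hop : ∀ x : EuclideanSpace ℝ (Fin n), x ≠ 0 → ‖fderiv ℝ f x‖ ≤ n * (C / ‖x‖ ^ 2) := by
    intro x hx
    refine ContinuousLinearMap.opNorm_le_bound _ (by positivity) fun v => ?_
    have hv : v = ∑ i, v i • EuclideanSpace.single i (1 : ℝ) := by
      have := (EuclideanSpace.basisFun (Fin n) ℝ).sum_repr v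
      simpa using this.symm
    have h1 : fderiv ℝ f x v = ∑ i, v i • fderiv ℝ f x (EuclideanSpace.single i (1 : ℝ)) := by
      conv_lhs => rw [hv]
      simp only [map_sum, map_smul]
    rw [h1]
    refine (norm_sum_le _ _).trans ?_
    calc ∑ i, ‖v i • fderiv ℝ f x (EuclideanSpace.single i (1 : ℝ))‖
        ≤ ∑ i : Fin n, ‖v‖ * (C / ‖x‖ ^ 2) := by
          refine Finset.sum_le_sum fun i _ => ?_
          rw [norm_smul]
          gcongr
          · exact PiLp.norm_apply_le v i
          · exact hD' x hx i
      _ = _ := by simp; ring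
  have e2 : ∀ t : ℝ, 0 < t → t ^ (-2 : ℝ) = (t ^ 2)⁻¹ := by
    intro t ht
    rw [Real.rpow_neg ht.le]; norm_num
  rw [e2 _ hy0, e2 _ hyh0]
  have p1 : 0 < (‖y‖ ^ 2)⁻¹ := by positivity
  have p2 : 0 < (‖y + h‖ ^ 2)⁻¹ := by positivity
  rcases le_total (2 * ‖h‖) ‖y‖ with hc | hc
  · have hz : ∀ z ∈ closedBall y ‖h‖, ‖y‖ / 2 ≤ ‖z‖ := by
      intro z hz
      rw [mem_closedBall, dist_eq_norm, norm_sub_rev] at hz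
      have := norm_sub_norm_le y z
      linarith
    have hz0 : ∀ z ∈ closedBall y ‖h‖, z ≠ 0 := by
      intro z hzz h0
      have := hz z hzz
      rw [h0, norm_zero] at this
      linarith
    have := (convex_closedBall y ‖h‖).norm_image_sub_le_of_norm_fderiv_le (𝕜 := ℝ) (f := f)
      (C := n * (C / (‖y‖ / 2) ^ 2)) (x := y) (y := y + h)
      (fun z hzz => hf z (hz0 z hzz))
      (fun z hzz => (hop z (hz0 z hzz)).trans (by have := hz z hzz; gcongr))
      (mem_closedBall_self (norm_nonneg _)) (by simp [dist_eq_norm])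
    rw [add_sub_cancel_left] at this
    refine this.trans ?_
    calc n * (C / (‖y‖ / 2) ^ 2) * ‖h‖ = (4 * n * C) * ‖h‖ * ((‖y‖ ^ 2)⁻¹) := by
          field_simp; ring
      _ ≤ _ := by
          gcongr
          · linarith
          · linarith
  · have h1 : ‖f y‖ ≤ 3 * C * ‖h‖ * (‖y‖ ^ 2)⁻¹ := by
      refine (hD y hy).trans ?_
      rw [div_eq_mul_inv]
      have : ‖y‖⁻¹ = ‖y‖ * (‖y‖ ^ 2)⁻¹ := by field_simp
      rw [this]
      calc C * (‖y‖ * (‖y‖ ^ 2)⁻¹) ≤ C * (3 * ‖h‖ * (‖y‖ ^ 2)⁻¹) := by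
            gcongr; linarith [norm_nonneg h]
        _ = _ := by ring
    have h2 : ‖f (y + h)‖ ≤ 3 * C * ‖h‖ * (‖y + h‖ ^ 2)⁻¹ := by
      refine (hD _ hyh).trans ?_
      rw [div_eq_mul_inv]
      have : ‖y + h‖⁻¹ = ‖y + h‖ * (‖y + h‖ ^ 2)⁻¹ := by field_simp
      rw [this]
      calc C * (‖y + h‖ * (‖y + h‖ ^ 2)⁻¹) ≤ C * (3 * ‖h‖ * (‖y + h‖ ^ 2)⁻¹) := by
            gcongr; linarith [norm_add_le y h]
        _ = _ := by ring
    calc ‖f (y + h) - f y‖ ≤ ‖f (y + h)‖ + ‖f y‖ := norm_sub_le _ _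
      _ ≤ 3 * C * ‖h‖ * ((‖y‖ ^ 2)⁻¹ + (‖y + h‖ ^ 2)⁻¹) := by linarith
      _ ≤ _ := by
        gcongr
        have : 0 ≤ 4 * (n : ℝ) * C := by positivity
        linarith

theorem aux_bounds {n : ℕ} (hn : 3 ≤ n) {V : Type*} [NormedAddCommGroup V]
    [InnerProductSpace ℂ V] [FiniteDimensional ℂ V] (γ : Fin n → V →ₗ[ℂ] V)
    (hcl : ∀ i j (ψ : V), γ i (γ j ψ) + γ j (γ i ψ) =
      if i = j then (-2 : ℂ) • ψ else 0)
    (α : EuclideanSpace ℝ (Fin n) → V)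
    (hloc : LocallyIntegrable α volume)
    (hsupp : HasCompactSupport α)
    (hα : ContDiffOn ℝ (⊤ : ℕ∞) α {0}ᶜ)
    (hDloc : LocallyIntegrable (dirac γ α) volume)
    (hdistrib : ∀ φ : EuclideanSpace ℝ (Fin n) → ℝ,
      ContDiff ℝ (⊤ : ℕ∞) φ → HasCompactSupport φ →
      -∑ i, ∫ x : EuclideanSpace ℝ (Fin n),
          (fderiv ℝ φ x (EuclideanSpace.single i 1)) • γ i (α x) =
        ∫ x : EuclideanSpace ℝ (Fin n), φ x • dirac γ α x)
    (C : ℝ) (hC : 0 < C)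
    (hD : ∀ x : EuclideanSpace ℝ (Fin n), x ≠ 0 → ‖dirac γ α x‖ ≤ C / ‖x‖)
    (hD' : ∀ x : EuclideanSpace ℝ (Fin n), x ≠ 0 → ∀ i : Fin n,
      ‖fderiv ℝ (dirac γ α) x (EuclideanSpace.single i 1)‖ ≤ C / ‖x‖ ^ 2)
    (δ : ℝ) (hδ : 0 < δ) (hδ1 : δ < 1) :
    (∃ K : ℝ, 0 ≤ K ∧ ∀ x : EuclideanSpace ℝ (Fin n), x ≠ 0 → ‖x‖ ≤ 1 →
      ‖α x‖ ≤ K * ‖x‖ ^ (-δ)) ∧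
    (∃ K : ℝ, 0 ≤ K ∧ ∀ x h : EuclideanSpace ℝ (Fin n), x ≠ 0 → x + h ≠ 0 → ‖x‖ ≤ 1 → ‖h‖ ≤ 1 →
      ‖α (x + h) - α x‖ ≤ K * ‖h‖ * (‖x‖ ^ (-(1 + δ)) + ‖x + h‖ ^ (-(1 + δ)))) := by
  have : Nonempty (Fin n) := ⟨⟨0, by omega⟩⟩
  obtain ⟨κ, hκ, hrep⟩ := aux_rep hn γ hcl α hloc hsupp hDloc hdistrib
  obtain ⟨B, hB, hest⟩ := aux_est γ
  obtain ⟨R, hR, hsub⟩ := hsupp.isCompact.isBounded.subset_ball_lt 1 0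
  have hcont : ∀ x, x ≠ 0 → ContinuousAt α x := fun x hx =>
    (hα.contDiffAt (isOpen_compl_singleton.mem_nhds hx)).continuousAt
  have hf0 : ∀ y, R ≤ ‖y‖ → dirac γ α y = 0 := by
    intro y hy
    apply aux_dirac_zero
    intro h
    have := hsub h
    rw [mem_ball_zero_iff] at this
    linarith
  constructor
  · obtain ⟨K, hK, hker⟩ := aux_kernel n hn δ 1 R hδ hδ1 le_rfl (by norm_num) (by linarith)
    refine ⟨κ⁻¹ * (B * (C * K)), by positivity, fun x hx hx1 => ?_⟩
    obtain ⟨H1, H2⟩ := hker x hx (by linarith)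
    have hb : ∀ c : ℝ, ‖∫ y, ∑ j, Gk n c⁻¹ x j y • γ j (dirac γ α y)‖ ≤
        B * (C * K * ‖x‖ ^ (-δ)) := by
      intro c
      have e : (fun y : EuclideanSpace ℝ (Fin n) =>
          ‖y - x‖ ^ (1 - (n : ℝ)) * (C * ‖y‖ ^ (-1 : ℝ))) =
          fun y => C * (‖y - x‖ ^ (1 - (n : ℝ)) * ‖y‖ ^ (-1 : ℝ)) := by
        ext y; ring
      refine (hest c⁻¹ R x (dirac γ α) (fun y => C * ‖y‖ ^ (-1 : ℝ)) ?_ ?_ ?_).trans ?_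
      · intro y hy
        apply hf0
        simpa using hy
      · filter_upwards [Measure.ae_ne volume (0 : EuclideanSpace ℝ (Fin n))] with y hy
        rw [Real.rpow_neg_one]
        exact hD y hy
      · rw [e]
        exact H1.const_mul C
      · rw [e, integral_const_mul]
        refine mul_le_mul_of_nonneg_left ?_ hB
        rw [mul_assoc]
        refine mul_le_mul_of_nonneg_left ?_ hC.le
        simpa using H2
    have := le_of_tendsto (hrep x (hcont x hx)).norm (Filter.Eventually.of_forall hb)
    rw [norm_smul, Real.norm_of_nonneg hκ.le] at this
    rw [mul_assoc, le_inv_mul_iff₀ hκ]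
    refine this.trans (le_of_eq ?_)
    ring
  · obtain ⟨K1, hK1, hker1⟩ := aux_kernel n hn δ 2 (R + 1) hδ hδ1 (by norm_num) le_rfl
      (by linarith)
    obtain ⟨K2, hK2, hker2⟩ := aux_kernel_shift n hn δ 2 (R + 1) hδ hδ1 (by norm_num) le_rfl
      (by linarith)
    obtain ⟨L, hL, hfd⟩ := aux_fdiff (dirac γ α) (aux_dirac_diff γ α hα) C hC hD hD'
    refine ⟨κ⁻¹ * (B * (L * (K1 + K2))), by positivity, fun x h hx hxh hx1 hh => ?_⟩
    obtain ⟨H1, H2⟩ := hker1 x hx (by linarith)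
    obtain ⟨H3, H4⟩ := hker2 x h hxh hh (by linarith [norm_add_le x h])
    rw [show (2 : ℝ) - 1 + δ = 1 + δ by ring] at H2 H4
    have hint : ∀ c : ℝ, 0 < c → ∀ x, Integrable
        fun y => ∑ j, Gk n c⁻¹ x j y • γ j (dirac γ α y) := by
      intro c hc x
      refine integrable_finsetSum _ fun j _ => ?_
      have h1 : Integrable fun y => Gk n c⁻¹ x j y • dirac γ α y :=
        aux_integrable_smul hDloc (aux_dirac_supp γ α hsupp)
          (Gk_contDiff n c⁻¹ (by positivity) x j).continuous
      have := ((LinearMap.toContinuousLinearMap (γ j)).restrictScalars ℝ).integrable_comp h1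
      simp only [map_smul] at this
      exact this
    have hshift : ∀ (c : ℝ) y, ∑ j, Gk n c⁻¹ (x + h) j (y + h) • γ j (dirac γ α (y + h)) =
        ∑ j, Gk n c⁻¹ x j y • γ j (dirac γ α (y + h)) := by
      intro c y
      refine Finset.sum_congr rfl fun j _ => ?_
      simp only [Gk, add_sub_add_right_eq_sub, PiLp.add_apply]
    have hdiff : ∀ c : ℝ, 0 < c →
        (∫ y, ∑ j, Gk n c⁻¹ (x + h) j y • γ j (dirac γ α y)) -
          ∫ y, ∑ j, Gk n c⁻¹ x j y • γ j (dirac γ α y) =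
        ∫ y, ∑ j, Gk n c⁻¹ x j y • γ j (dirac γ α (y + h) - dirac γ α y) := by
      intro c hc
      have i1 := (hint c hc (x + h)).comp_add_right h
      rw [← integral_add_right_eq_self (fun y => ∑ j, Gk n c⁻¹ (x + h) j y • γ j (dirac γ α y)) h,
        ← integral_sub i1 (hint c hc x)]
      congr 1
      ext y
      rw [hshift, ← Finset.sum_sub_distrib]
      refine Finset.sum_congr rfl fun j _ => ?_
      rw [map_sub, smul_sub]
    have hb : ∀ c : ℝ, 0 < c → ‖(∫ y, ∑ j, Gk n c⁻¹ (x + h) j y • γ j (dirac γ α y)) -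
          ∫ y, ∑ j, Gk n c⁻¹ x j y • γ j (dirac γ α y)‖ ≤
        B * (L * ‖h‖ * (K1 * ‖x‖ ^ (-(1 + δ)) + K2 * ‖x + h‖ ^ (-(1 + δ)))) := by
      intro c hc
      rw [hdiff c hc]
      have e : (fun y : EuclideanSpace ℝ (Fin n) =>
          ‖y - x‖ ^ (1 - (n : ℝ)) * (L * ‖h‖ * (‖y‖ ^ (-2 : ℝ) + ‖y + h‖ ^ (-2 : ℝ)))) =
          fun y => L * ‖h‖ * (‖y - x‖ ^ (1 - (n : ℝ)) * ‖y‖ ^ (-2 : ℝ) +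
            ‖y - x‖ ^ (1 - (n : ℝ)) * ‖y + h‖ ^ (-2 : ℝ)) := by
        ext y; ring
      refine (hest c⁻¹ (R + 1) x (fun y => dirac γ α (y + h) - dirac γ α y)
        (fun y => L * ‖h‖ * (‖y‖ ^ (-2 : ℝ) + ‖y + h‖ ^ (-2 : ℝ))) ?_ ?_ ?_).trans ?_
      · intro y hy
        have hy' : R + 1 ≤ ‖y‖ := by simpa using hy
        have : ‖y‖ ≤ ‖y + h‖ + ‖h‖ := by
          calc ‖y‖ = ‖y + h - h‖ := by simp
            _ ≤ _ := norm_sub_le _ _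
        simp only [hf0 y (by linarith), hf0 (y + h) (by linarith), sub_zero]
      · filter_upwards [Measure.ae_ne volume (0 : EuclideanSpace ℝ (Fin n)),
          Measure.ae_ne volume (-h)] with y hy hyh
        exact hfd y h hy fun h0 => hyh (eq_neg_of_add_eq_zero_left h0)
      · rw [e]
        exact (H1.add H3).const_mul _
      · rw [e, integral_const_mul, integral_add H1 H3]
        refine mul_le_mul_of_nonneg_left ?_ hB
        refine mul_le_mul_of_nonneg_left (add_le_add H2 H4) (by positivity)
    have := le_of_tendsto ((hrep _ (hcont _ hxh)).sub (hrep x (hcont x hx))).norm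
      ((Filter.eventually_gt_atTop 0).mono hb)
    rw [← smul_sub, norm_smul, Real.norm_of_nonneg hκ.le] at this
    rw [mul_assoc, mul_assoc, le_inv_mul_iff₀ hκ]
    refine this.trans ?_
    have q1 : 0 ≤ ‖x‖ ^ (-(1 + δ)) := by positivity
    have q2 : 0 ≤ ‖x + h‖ ^ (-(1 + δ)) := by positivity
    calc _ ≤ B * (L * ‖h‖ * ((K1 + K2) * ‖x‖ ^ (-(1 + δ)) + (K1 + K2) * ‖x + h‖ ^ (-(1 + δ)))) := by
          gcongr <;> linarith
      _ = _ := by ring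

theorem aux_cont_zero {E W : Type*} [NormedAddCommGroup E] [NormedAddCommGroup W]
    (u : E → W) (h0 : u 0 = 0) (hc : ∀ x, x ≠ 0 → ContinuousAt u x) (K η : ℝ) (hη : 0 < η)
    (hb : ∀ x, x ≠ 0 → ‖x‖ ≤ 1 → ‖u x‖ ≤ K * ‖x‖ ^ η) : Continuous u := by
  rw [continuous_iff_continuousAt]
  intro x
  by_cases hx : x = 0
  · subst hx
    rw [ContinuousAt, h0]
    have ht : Filter.Tendsto (fun x : E => K * ‖x‖ ^ η) (nhds 0) (nhds 0) := by
      have : ContinuousAt (fun x : E => K * ‖x‖ ^ η) 0 :=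
        continuousAt_const.mul (continuousAt_id.norm.rpow_const (Or.inr hη.le))
      simpa [ContinuousAt, Real.zero_rpow hη.ne'] using this
    refine squeeze_zero_norm' ?_ ht
    filter_upwards [closedBall_mem_nhds (0 : E) one_pos] with y hy
    by_cases hy0 : y = 0
    · subst hy0; simp [h0, Real.zero_rpow hη.ne']
    · exact hb y hy0 (by simpa using hy)
  · exact hc x hx

/-- Regularity Lemma: if `α` is compactly supported, smooth away from `0`,
its distributional Dirac derivative has no singular part at the origin, and
`Dα = O(1/r)`, `∂ᵢ(Dα) = O(1/r²)`, then for every `ε > 0` the functions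
`|x|^ε α` and `|x|^{1+ε} ‖(dα)ₓ‖` extend continuously to all of `ℝⁿ`. -/
theorem stmt10 (n : ℕ) (hn : 3 ≤ n) (V : Type*) [NormedAddCommGroup V]
    [InnerProductSpace ℂ V] [FiniteDimensional ℂ V] [Nontrivial V]
    (γ : Fin n → V →ₗ[ℂ] V)
    (hcl : ∀ i j (ψ : V), γ i (γ j ψ) + γ j (γ i ψ) =
      if i = j then (-2 : ℂ) • ψ else 0)
    (hsk : ∀ i (φ ψ : V), ⟪γ i φ, ψ⟫_ℂ = -⟪φ, γ i ψ⟫_ℂ)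
    (α : EuclideanSpace ℝ (Fin n) → V)
    (hloc : LocallyIntegrable α volume)
    (hsupp : HasCompactSupport α)
    (hα : ContDiffOn ℝ (⊤ : ℕ∞) α {0}ᶜ)
    (hDloc : LocallyIntegrable (dirac γ α) volume)
    (hdistrib : ∀ φ : EuclideanSpace ℝ (Fin n) → ℝ,
      ContDiff ℝ (⊤ : ℕ∞) φ → HasCompactSupport φ →
      -∑ i, ∫ x : EuclideanSpace ℝ (Fin n),
          (fderiv ℝ φ x (EuclideanSpace.single i 1)) • γ i (α x) =
        ∫ x : EuclideanSpace ℝ (Fin n), φ x • dirac γ α x)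
    (C : ℝ) (hC : 0 < C)
    (hD : ∀ x : EuclideanSpace ℝ (Fin n), x ≠ 0 → ‖dirac γ α x‖ ≤ C / ‖x‖)
    (hD' : ∀ x : EuclideanSpace ℝ (Fin n), x ≠ 0 → ∀ i : Fin n,
      ‖fderiv ℝ (dirac γ α) x (EuclideanSpace.single i 1)‖ ≤ C / ‖x‖ ^ 2) :
    ∀ ε : ℝ, 0 < ε →
      (∃ g : EuclideanSpace ℝ (Fin n) → V, Continuous g ∧
        ∀ x : EuclideanSpace ℝ (Fin n), x ≠ 0 → g x = ‖x‖ ^ ε • α x) ∧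
      (∃ h : EuclideanSpace ℝ (Fin n) → ℝ, Continuous h ∧
        ∀ x : EuclideanSpace ℝ (Fin n), x ≠ 0 →
          h x = ‖x‖ ^ (1 + ε) * ‖fderiv ℝ α x‖) := by
  intro ε hε
  obtain ⟨δ, hδ, hδ1, hδε⟩ : ∃ δ : ℝ, 0 < δ ∧ δ < 1 ∧ δ < ε :=
    ⟨min (ε / 2) (1 / 2), by positivity, (min_le_right _ _).trans_lt (by norm_num),
      (min_le_left _ _).trans_lt (by linarith)⟩
  obtain ⟨⟨K, hK, hb⟩, ⟨L, hL, hb'⟩⟩ := aux_bounds hn γ hcl α hloc hsupp hα hDloc hdistrib C hC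
    hD hD' δ hδ hδ1
  have hsm : ∀ x, x ≠ 0 → ContDiffAt ℝ (⊤ : ℕ∞) α x := fun x hx =>
    hα.contDiffAt (isOpen_compl_singleton.mem_nhds hx)
  have hder : ∀ x, x ≠ 0 → ‖x‖ ≤ 1 →
      ‖fderiv ℝ α x‖ ≤ L * (‖x‖ ^ (-(1 + δ)) + (‖x‖ / 2) ^ (-(1 + δ))) := by
    intro x hx hx1
    have hx0 : 0 < ‖x‖ := norm_pos_iff.2 hx
    refine norm_fderiv_le_of_lip' ℝ (by positivity) ?_
    filter_upwards [ball_mem_nhds x (half_pos hx0)] with z hz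
    rw [mem_ball, dist_eq_norm] at hz
    have hz2 : ‖x‖ / 2 ≤ ‖z‖ := by
      have := norm_sub_norm_le x z
      rw [norm_sub_rev] at this
      linarith
    have hz0 : z ≠ 0 := norm_pos_iff.1 (by linarith)
    have h1 := hb' x (z - x) hx (by rwa [add_sub_cancel]) hx1 (by linarith)
    rw [add_sub_cancel] at h1
    refine h1.trans ?_
    have h2 : ‖z‖ ^ (-(1 + δ)) ≤ (‖x‖ / 2) ^ (-(1 + δ)) :=
      Real.rpow_le_rpow_of_nonpos (by positivity) hz2 (by linarith)
    calc _ ≤ L * ‖z - x‖ * (‖x‖ ^ (-(1 + δ)) + (‖x‖ / 2) ^ (-(1 + δ))) := by gcongr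
      _ = _ := by ring
  refine ⟨⟨fun x => ‖x‖ ^ ε • α x, ?_, fun x _ => rfl⟩,
    ⟨fun x => ‖x‖ ^ (1 + ε) * ‖fderiv ℝ α x‖, ?_, fun x _ => rfl⟩⟩
  · refine aux_cont_zero _ (by simp [Real.zero_rpow hε.ne']) ?_ K (ε - δ) (by linarith) ?_
    · intro x hx
      exact (continuousAt_id.norm.rpow_const (Or.inr hε.le)).smul (hsm x hx).continuousAt
    · intro x hx hx1
      have hx0 : 0 < ‖x‖ := norm_pos_iff.2 hx
      rw [norm_smul, Real.norm_of_nonneg (by positivity)]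
      calc ‖x‖ ^ ε * ‖α x‖ ≤ ‖x‖ ^ ε * (K * ‖x‖ ^ (-δ)) := by gcongr; exact hb x hx hx1
        _ = K * (‖x‖ ^ ε * ‖x‖ ^ (-δ)) := by ring
        _ = _ := by rw [← Real.rpow_add hx0]; rfl
  · refine aux_cont_zero _ (by simp [Real.zero_rpow (by linarith : 1 + ε ≠ 0)]) ?_
      (L * (1 + ((1 : ℝ) / 2) ^ (-(1 + δ)))) (ε - δ) (by linarith) ?_
    · intro x hx
      have h2 : ContinuousAt (fderiv ℝ α) x :=
        ((hsm x hx).fderiv_right (m := 1) (by norm_cast)).continuousAt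
      exact (continuousAt_id.norm.rpow_const (Or.inr (by linarith))).mul h2.norm
    · intro x hx hx1
      have hx0 : 0 < ‖x‖ := norm_pos_iff.2 hx
      rw [Real.norm_of_nonneg (by positivity)]
      calc ‖x‖ ^ (1 + ε) * ‖fderiv ℝ α x‖
          ≤ ‖x‖ ^ (1 + ε) * (L * (‖x‖ ^ (-(1 + δ)) + (‖x‖ / 2) ^ (-(1 + δ)))) := by
            gcongr; exact hder x hx hx1
        _ = L * (1 + ((1 : ℝ) / 2) ^ (-(1 + δ))) * (‖x‖ ^ (1 + ε) * ‖x‖ ^ (-(1 + δ))) := by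
            rw [div_eq_mul_one_div ‖x‖ 2, Real.mul_rpow hx0.le (by norm_num)]; ring
        _ = _ := by
            rw [← Real.rpow_add hx0]; congr 2; ring
end

section
/- Let U be an open neighborhood of 0 in ℝⁿ and G : U → Mₙ(ℝ) a smooth map such that G(x) is a symmetric positive definite matrix for each x ∈ U, and suppose G(x) = I + A(x) + E(x), where A(x) = Σ_{α,β=1}^{n} x_α x_β A_{αβ} for fixed symmetric matrices A_{αβ} ∈ Mₙ(ℝ), and ‖E(x)‖ ≤ C|x|³ near 0 for some constant C. For each x ∈ U let B(x) be the unique symmetric positive definite matrix with B(x)² = G(x)⁻¹. Then B(x) = I - (1/2)A(x) + O(|x|³) as x → 0, i.e. there exist C' > 0 and a neighborhood of 0 on which ‖B(x) - I + (1/2)A(x)‖ ≤ C'|x|³. -/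
open Metric

attribute [local instance] Matrix.normedAddCommGroup Matrix.normedSpace

noncomputable def fro {n : ℕ} (M : Matrix (Fin n) (Fin n) ℝ) : ℝ :=
  √(∑ p : Fin n × Fin n, (M p.1 p.2) ^ 2)

lemma fro_eq {n : ℕ} (M : Matrix (Fin n) (Fin n) ℝ) :
    fro M = (Matrix.frobeniusNormedAddCommGroup (m := Fin n) (n := Fin n) (α := ℝ)).norm M := by
  refine Eq.trans ?_ (Matrix.frobenius_norm_def M).symm
  unfold fro
  rw [Real.sqrt_eq_rpow, Fintype.sum_prod_type]
  simp

lemma fro_nonneg {n : ℕ} (M : Matrix (Fin n) (Fin n) ℝ) : 0 ≤ fro M := Real.sqrt_nonneg _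

lemma fro_mul {n : ℕ} (M N : Matrix (Fin n) (Fin n) ℝ) : fro (M * N) ≤ fro M * fro N := by
  simp only [fro_eq]
  exact Matrix.frobenius_norm_mul M N

lemma fro_add {n : ℕ} (M N : Matrix (Fin n) (Fin n) ℝ) : fro (M + N) ≤ fro M + fro N := by
  simp only [fro_eq]
  exact @norm_add_le _ (Matrix.frobeniusNormedAddCommGroup (m := Fin n) (n := Fin n) (α := ℝ)).toSeminormedAddCommGroup.toSeminormedAddGroup M N

lemma fro_smul {n : ℕ} (c : ℝ) (M : Matrix (Fin n) (Fin n) ℝ) : fro (c • M) = |c| * fro M := by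
  unfold fro
  simp only [Matrix.smul_apply, smul_eq_mul, mul_pow, ← Finset.mul_sum]
  rw [Real.sqrt_mul (sq_nonneg c), Real.sqrt_sq_eq_abs]

lemma fro_neg {n : ℕ} (M : Matrix (Fin n) (Fin n) ℝ) : fro (-M) = fro M := by
  simp [fro]

lemma fro_sub {n : ℕ} (M N : Matrix (Fin n) (Fin n) ℝ) : fro (M - N) ≤ fro M + fro N := by
  have := fro_add M (-N)
  rwa [fro_neg, ← sub_eq_add_neg] at this

lemma trace_eq {n : ℕ} (M N : Matrix (Fin n) (Fin n) ℝ) (hM : M.IsSymm) :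
    (M * N).trace = ∑ p : Fin n × Fin n, M p.1 p.2 * N p.1 p.2 := by
  rw [Fintype.sum_prod_type, Finset.sum_comm]
  simp only [Matrix.trace, Matrix.diag, Matrix.mul_apply]
  refine Finset.sum_congr rfl fun i _ => Finset.sum_congr rfl fun j _ => ?_
  rw [hM.apply]

lemma trace_le {n : ℕ} (M N : Matrix (Fin n) (Fin n) ℝ) (hM : M.IsSymm) :
    (M * N).trace ≤ fro M * fro N := by
  rw [trace_eq M N hM]
  exact Real.sum_mul_le_sqrt_mul_sqrt _ _ _

lemma trace_self {n : ℕ} (M : Matrix (Fin n) (Fin n) ℝ) (hM : M.IsSymm) :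
    (M * M).trace = fro M ^ 2 := by
  rw [trace_eq M M hM, fro, Real.sq_sqrt (Finset.sum_nonneg fun _ _ => sq_nonneg _)]
  simp only [sq]

lemma norm_le_fro {n : ℕ} (M : Matrix (Fin n) (Fin n) ℝ) : ‖M‖ ≤ fro M := by
  rw [Matrix.norm_le_iff (fro_nonneg M)]
  intro i j
  apply Real.abs_le_sqrt
  exact Finset.single_le_sum (f := fun p : Fin n × Fin n => (M p.1 p.2) ^ 2)
    (fun _ _ => sq_nonneg _) (Finset.mem_univ (i, j))

lemma fro_le_norm {n : ℕ} (M : Matrix (Fin n) (Fin n) ℝ) : fro M ≤ n * ‖M‖ := by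
  unfold fro
  apply Real.sqrt_le_iff.2
  refine ⟨by positivity, ?_⟩
  calc _ ≤ ∑ p : Fin n × Fin n, ‖M‖ ^ 2 := by
        refine Finset.sum_le_sum fun p _ => ?_
        have := Matrix.norm_entry_le_entrywise_sup_norm M (i := p.1) (j := p.2)
        rw [← sq_abs]
        exact pow_le_pow_left₀ (abs_nonneg _) this 2
    _ = _ := by simp; ring

lemma key {n : ℕ} (G A E B : Matrix (Fin n) (Fin n) ℝ) (hGp : G.PosDef) (hA : A.IsSymm)
    (hG : G = 1 + A + E) (hBs : B.IsSymm) (hBp : B.PosDef) (hB : B * B = G⁻¹)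
    (hq : fro A ≤ 1) (hK : fro A ^ 2 + fro E * (fro (1 : Matrix (Fin n) (Fin n) ℝ) + 2) ≤ 1 / 2) :
    fro (B - 1 + (1 / 2 : ℝ) • A) ≤ 4 * (fro (1 : Matrix (Fin n) (Fin n) ℝ) + 2) *
      (fro A ^ 2 + fro E * (fro (1 : Matrix (Fin n) (Fin n) ℝ) + 2)) := by
  set s := fro (1 : Matrix (Fin n) (Fin n) ℝ) with hs
  have hs0 : 0 ≤ s := fro_nonneg _
  have hq0 := fro_nonneg A
  have he0 := fro_nonneg E
  set q := fro A
  set e := fro E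
  set D : Matrix (Fin n) (Fin n) ℝ := 1 - (1 / 2 : ℝ) • A with hD
  have hDD : D * D = 1 - A + (1 / 4 : ℝ) • (A * A) := by
    rw [hD]
    simp only [sub_mul, mul_sub, one_mul, mul_one, smul_mul_assoc, mul_smul_comm]
    module
  have hfA2 : fro (A * A) ≤ q ^ 2 := by rw [sq]; exact fro_mul A A
  have hfDD : fro (D * D) ≤ s + 2 := by
    rw [hDD]
    have h1 := fro_add (1 - A) ((1 / 4 : ℝ) • (A * A))
    have h2 := fro_sub 1 A
    rw [fro_smul, abs_of_pos (by norm_num)] at h1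
    nlinarith
  set K := 1 - G * (D * D) with hKd
  have hKe : K = (3 / 4 : ℝ) • (A * A) - (1 / 4 : ℝ) • (A * (A * A)) - E * (D * D) := by
    rw [hKd, hG, add_mul _ E, hDD]
    simp only [add_mul, mul_sub, mul_add, one_mul, mul_one, mul_smul_comm]
    module
  have hfK : fro K ≤ q ^ 2 + e * (s + 2) := by
    rw [hKe]
    have h1 := fro_sub ((3 / 4 : ℝ) • (A * A) - (1 / 4 : ℝ) • (A * (A * A))) (E * (D * D))
    have h2 := fro_sub ((3 / 4 : ℝ) • (A * A)) ((1 / 4 : ℝ) • (A * (A * A)))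
    rw [fro_smul, fro_smul, abs_of_pos (by norm_num), abs_of_pos (by norm_num)] at h2
    have h3 := fro_mul E (D * D)
    have h4 : fro E * fro (D * D) ≤ e * (s + 2) := mul_le_mul_of_nonneg_left hfDD he0
    have h5 : fro (A * (A * A)) ≤ q * fro (A * A) := fro_mul A (A * A)
    have h6 : q * fro (A * A) ≤ 1 * fro (A * A) := mul_le_mul_of_nonneg_right hq (fro_nonneg _)
    linarith
  set R := G⁻¹ - D * D with hR
  have hdet : IsUnit G.det := hGp.isUnit.map Matrix.detMonoidHom
  have hRK : R = (D * D) * K + R * K := by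
    have : R = G⁻¹ * K := by
      rw [hKd, mul_sub, mul_one, ← mul_assoc, Matrix.nonsing_inv_mul _ hdet, one_mul]
    rw [← add_mul, hR, add_sub_cancel, ← this]
  have hfR : fro R ≤ 2 * (s + 2) * (q ^ 2 + e * (s + 2)) := by
    have h1 : fro R ≤ fro (D * D * K) + fro (R * K) := by
      conv_lhs => rw [hRK]
      exact fro_add _ _
    have h2 := fro_mul (D * D) K
    have h3 := fro_mul R K
    have h4 : fro (D * D) * fro K ≤ (s + 2) * (q ^ 2 + e * (s + 2)) :=
      mul_le_mul hfDD hfK (fro_nonneg _) (by positivity)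
    have h5 : fro R * fro K ≤ fro R * (1 / 2) :=
      mul_le_mul_of_nonneg_left (hfK.trans hK) (fro_nonneg _)
    linarith
  have hXe : B - 1 + (1 / 2 : ℝ) • A = B - D := by rw [hD]; abel
  rw [hXe]
  set X := B - D with hX
  have hDs : D.IsSymm := by
    rw [hD]; exact Matrix.IsSymm.sub Matrix.isSymm_one (hA.smul _)
  have hXs : X.IsSymm := hBs.sub hDs
  have htr : (X * (B * X)).trace + (X * (D * X)).trace = (X * R).trace := by
    have e1 : (2 : ℝ) • R = (B + D) * X + X * (B + D) := by
      rw [hR, ← hB, hX]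
      simp only [add_mul, mul_sub, mul_add, sub_mul]
      module
    have e2 : (2 : ℝ) * (X * R).trace = (X * ((B + D) * X)).trace + (X * (X * (B + D))).trace := by
      rw [← Matrix.trace_add, ← mul_add, ← e1, mul_smul_comm, Matrix.trace_smul, smul_eq_mul]
    have e3 : (X * (X * (B + D))).trace = (X * ((B + D) * X)).trace := by
      rw [Matrix.trace_mul_comm, mul_assoc]
    have e4 : (X * ((B + D) * X)).trace = (X * (B * X)).trace + (X * (D * X)).trace := by
      rw [add_mul, mul_add, Matrix.trace_add]
    linarith
  have hB0 : 0 ≤ (X * (B * X)).trace := by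
    have := (hBp.posSemidef.conjTranspose_mul_mul_same X).trace_nonneg
    rwa [Matrix.conjTranspose_eq_transpose_of_trivial, hXs.eq, mul_assoc] at this
  have hD0 : (X * (D * X)).trace = fro X ^ 2 - 1 / 2 * (X * (A * X)).trace := by
    clear_value X D
    rw [← trace_self X hXs, hD, sub_mul, one_mul, mul_sub, Matrix.trace_sub, smul_mul_assoc,
      mul_smul_comm, Matrix.trace_smul, smul_eq_mul]
  have hA0 : (X * (A * X)).trace ≤ fro X ^ 2 := by
    have h1 := trace_le X (A * X) hXs
    have h2 : fro (A * X) ≤ q * fro X := fro_mul A X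
    have h3 := fro_nonneg X
    nlinarith [mul_le_mul_of_nonneg_left h2 h3, mul_nonneg h3 h3]
  have hR0 := trace_le X R hXs
  have hfin : fro X ≤ 2 * fro R := by
    rcases (fro_nonneg X).eq_or_lt with h | h
    · rw [← h]; have := fro_nonneg R; positivity
    · have : fro X * fro X ≤ fro X * (2 * fro R) := by nlinarith
      exact le_of_mul_le_mul_left this h
  linarith

/-- If a smooth family `G(x)` of symmetric positive definite matrices satisfies
`G(x) = I + A(x) + O(|x|³)` with `A(x) = ∑ x_α x_β A_{αβ}`, then the unique
symmetric positive definite square root `B(x)` of `G(x)⁻¹` satisfies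
`B(x) = I - A(x)/2 + O(|x|³)` as `x → 0`. -/
theorem stmt12 (n : ℕ)
    (U : Set (EuclideanSpace ℝ (Fin n))) (hU : IsOpen U) (h0U : (0 : EuclideanSpace ℝ (Fin n)) ∈ U)
    (G : EuclideanSpace ℝ (Fin n) → Matrix (Fin n) (Fin n) ℝ)
    (hG : ContDiffOn ℝ (⊤ : ℕ∞) G U)
    (hGsym : ∀ x ∈ U, (G x).IsSymm) (hGpos : ∀ x ∈ U, (G x).PosDef)
    (A : Fin n → Fin n → Matrix (Fin n) (Fin n) ℝ)
    (hAsym : ∀ a b, (A a b).IsSymm)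
    (E : EuclideanSpace ℝ (Fin n) → Matrix (Fin n) (Fin n) ℝ)
    (hGAE : ∀ x ∈ U, G x = 1 + (∑ a, ∑ b, (x a * x b) • A a b) + E x)
    (CE rE : ℝ) (hrE : 0 < rE)
    (hE : ∀ x : EuclideanSpace ℝ (Fin n), ‖x‖ < rE → ‖E x‖ ≤ CE * ‖x‖ ^ 3)
    (B : EuclideanSpace ℝ (Fin n) → Matrix (Fin n) (Fin n) ℝ)
    (hB : ∀ x ∈ U, (B x).IsSymm ∧ (B x).PosDef ∧ B x * B x = (G x)⁻¹) :
    ∃ C' > (0 : ℝ), ∃ r > (0 : ℝ), ∀ x ∈ U, ‖x‖ < r →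
      ‖B x - 1 + (1 / 2 : ℝ) • (∑ a, ∑ b, (x a * x b) • A a b)‖ ≤ C' * ‖x‖ ^ 3 := by
  set a : ℝ := n * ∑ a, ∑ b, ‖A a b‖ with ha
  set m : ℝ := fro (1 : Matrix (Fin n) (Fin n) ℝ) + 2 with hm
  set c : ℝ := n * |CE| with hc
  have ha0 : 0 ≤ a := by positivity
  have hc0 : 0 ≤ c := by positivity
  have hm0 : 0 < m := by have := fro_nonneg (1 : Matrix (Fin n) (Fin n) ℝ); positivity
  have hcm : 0 ≤ c * m := by positivity
  set L : ℝ := 1 + a + 2 * (a ^ 2 + c * m) with hL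
  have hL0 : 0 < L := by positivity
  refine ⟨4 * m * (a ^ 2 + c * m) + 1, by positivity, min rE (1 / L), by positivity, ?_⟩
  intro x hx hxr
  have hx1 : ‖x‖ < rE := lt_of_lt_of_le hxr (min_le_left _ _)
  have hxL : ‖x‖ * L < 1 := by
    have := lt_of_lt_of_le hxr (min_le_right _ _)
    rwa [lt_div_iff₀ hL0] at this
  set t := ‖x‖ with ht
  have ht0 : 0 ≤ t := norm_nonneg x
  have hta : 0 ≤ t * a := by positivity
  have htac : 0 ≤ t * (a ^ 2 + c * m) := by positivity
  have hexp : t * L = t + t * a + 2 * (t * (a ^ 2 + c * m)) := by rw [hL]; ring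
  have ht1 : t ≤ 1 := by linarith
  have ht2 : t ^ 2 ≤ t := by nlinarith
  have ht3 : t ^ 3 ≤ t := by nlinarith
  have ht4 : t ^ 4 ≤ t ^ 3 := pow_le_pow_of_le_one ht0 ht1 (by norm_num)
  set S := ∑ a, ∑ b, (x a * x b) • A a b with hS
  have hSn : ‖S‖ ≤ (∑ a, ∑ b, ‖A a b‖) * t ^ 2 := by
    rw [hS, Finset.sum_mul]
    refine (norm_sum_le _ _).trans (Finset.sum_le_sum fun i _ => ?_)
    rw [Finset.sum_mul]
    refine (norm_sum_le _ _).trans (Finset.sum_le_sum fun j _ => ?_)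
    rw [norm_smul, norm_mul, mul_comm, sq]
    have h1 := PiLp.norm_apply_le x i
    have h2 := PiLp.norm_apply_le x j
    gcongr
  have hfS : fro S ≤ a * t ^ 2 := by
    refine (fro_le_norm S).trans ?_
    rw [ha, mul_assoc]
    gcongr
  have hfE : fro (E x) ≤ c * t ^ 3 := by
    refine (fro_le_norm _).trans ?_
    rw [hc, mul_assoc]
    gcongr
    refine (hE x hx1).trans ?_
    gcongr
    exact le_abs_self _
  have hSs : S.IsSymm := by
    rw [hS, Matrix.IsSymm, Matrix.transpose_sum]
    refine Finset.sum_congr rfl fun i _ => ?_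
    rw [Matrix.transpose_sum]
    refine Finset.sum_congr rfl fun j _ => ?_
    rw [Matrix.transpose_smul, (hAsym i j).eq]
  have hq : fro S ≤ 1 := by
    have : a * t ^ 2 ≤ a * t := mul_le_mul_of_nonneg_left ht2 ha0
    linarith
  have hsum : fro S ^ 2 + fro (E x) * m ≤ (a ^ 2 + c * m) * t ^ 3 := by
    have h1 : fro S ^ 2 ≤ (a * t ^ 2) ^ 2 := pow_le_pow_left₀ (fro_nonneg _) hfS 2
    have h2 : fro (E x) * m ≤ c * t ^ 3 * m := mul_le_mul_of_nonneg_right hfE hm0.le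
    have h3 : a ^ 2 * t ^ 4 ≤ a ^ 2 * t ^ 3 := mul_le_mul_of_nonneg_left ht4 (sq_nonneg a)
    nlinarith
  have hK : fro S ^ 2 + fro (E x) * m ≤ 1 / 2 := by
    have : (a ^ 2 + c * m) * t ^ 3 ≤ (a ^ 2 + c * m) * t :=
      mul_le_mul_of_nonneg_left ht3 (by positivity)
    linarith
  obtain ⟨hb1, hb2, hb3⟩ := hB x hx
  have := key (G x) S (E x) (B x) (hGpos x hx) hSs (hGAE x hx) hb1 hb2 hb3 hq hK
  refine (norm_le_fro _).trans (this.trans ?_)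
  have h1 : 4 * m * (fro S ^ 2 + fro (E x) * m) ≤ 4 * m * ((a ^ 2 + c * m) * t ^ 3) :=
    mul_le_mul_of_nonneg_left hsum (by positivity)
  have h2 : 0 ≤ t ^ 3 := by positivity
  linarith
end
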